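/- There exists a universal constant C > 0 (independent of the dimension, the nonlinearity, the domain, the solution, and the truncation level) with the following property. Let n ∈ {2,3,4}, let f : ℝ → ℝ be C∞, let Ω ⊆ ℝⁿ be a bounded smooth domain, and let u be a classical semi-stable solution of −Δu = f(u) in Ω with u = 0 on ∂Ω and u(x) > 0 for every x ∈ Ω. Then for every real t > 0, sup_{x ∈ Ω} u(x) ≤ t + (C/t) · |Ω|^{(4−n)/(2n)} · ( ∫_{{x ∈ Ω : u(x) < t}} ‖∇u(x)‖⁴ dx )^{1/2}. -/

import Mathlib

open MeasureTheory Filter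

noncomputable section

/-- The Euclidean Laplacian: trace of the Hessian. -/
def lapl {n : ℕ} (u : EuclideanSpace ℝ (Fin n) → ℝ) (x : EuclideanSpace ℝ (Fin n)) : ℝ :=
  ∑ i : Fin n, fderiv ℝ (fun y => fderiv ℝ u y (EuclideanSpace.single i 1)) x
    (EuclideanSpace.single i 1)

/-- Entries of the Hessian matrix. -/
def hess {n : ℕ} (u : EuclideanSpace ℝ (Fin n) → ℝ) (x : EuclideanSpace ℝ (Fin n))
    (i j : Fin n) : ℝ :=
  fderiv ℝ (fun y => fderiv ℝ u y (EuclideanSpace.single j 1)) x (EuclideanSpace.single i 1)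

/-- A bounded smooth domain of ℝⁿ. -/
def IsSmoothBoundedDomain {n : ℕ} (Ω : Set (EuclideanSpace ℝ (Fin n))) : Prop :=
  IsOpen Ω ∧ Bornology.IsBounded Ω ∧ Ω.Nonempty ∧
  ∃ ρ : EuclideanSpace ℝ (Fin n) → ℝ, ContDiff ℝ (⊤ : ℕ∞) ρ ∧
    Ω = {x | ρ x < 0} ∧ frontier Ω = {x | ρ x = 0} ∧
    ∀ x ∈ frontier Ω, gradient ρ x ≠ 0

/-- Classical solution of −Δu = f(u) in Ω, u = 0 on ∂Ω. -/
def IsClassicalSol {n : ℕ} (Ω : Set (EuclideanSpace ℝ (Fin n))) (f : ℝ → ℝ)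
    (u : EuclideanSpace ℝ (Fin n) → ℝ) : Prop :=
  (∃ U, IsOpen U ∧ closure Ω ⊆ U ∧ ContDiffOn ℝ 2 u U) ∧
  (∀ x ∈ Ω, lapl u x + f (u x) = 0) ∧
  (∀ x ∈ frontier Ω, u x = 0)

/-- Semi-stability of a solution u. -/
def IsSemiStable {n : ℕ} (Ω : Set (EuclideanSpace ℝ (Fin n))) (f : ℝ → ℝ)
    (u : EuclideanSpace ℝ (Fin n) → ℝ) : Prop :=
  ∀ ξ : EuclideanSpace ℝ (Fin n) → ℝ, (∃ K : NNReal, LipschitzWith K ξ) →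
    (∀ x ∈ frontier Ω, ξ x = 0) →
    0 ≤ ∫ x in Ω, (‖gradient ξ x‖ ^ 2 - deriv f (u x) * ξ x ^ 2)

/-- Weak solution of −Δu = f(u) in Ω, u = 0 on ∂Ω. -/
def IsWeakSol {n : ℕ} (Ω : Set (EuclideanSpace ℝ (Fin n))) (f : ℝ → ℝ)
    (u : EuclideanSpace ℝ (Fin n) → ℝ) : Prop :=
  IntegrableOn u Ω volume ∧
  IntegrableOn (fun x => f (u x) * Metric.infDist x (frontier Ω)) Ω volume ∧
  ∀ ξ : EuclideanSpace ℝ (Fin n) → ℝ,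
    (∃ U, IsOpen U ∧ closure Ω ⊆ U ∧ ContDiffOn ℝ 2 ξ U) →
    (∀ x ∈ frontier Ω, ξ x = 0) →
    ∫ x in Ω, (u x * lapl ξ x + f (u x) * ξ x) = 0

open scoped Topology ENNReal Convolution

/-- A sequence of smooth bumps on the line shrinking to the origin. -/
def lineBump (k : ℕ) : ContDiffBump (0 : ℝ) where
  rIn := 1 / (k + 1)
  rOut := 2 / (k + 1)
  rIn_pos := by positivity
  rIn_lt_rOut := by gcongr; norm_num

/-- The normalized mollifying kernels attached to `lineBump`. -/
def lineKernel (k : ℕ) : ℝ → ℝ := (lineBump k).normed volume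

lemma lineKernel_nonneg (k : ℕ) (s : ℝ) : 0 ≤ lineKernel k s :=
  (lineBump k).nonneg_normed s

lemma contDiff_lineKernel (k : ℕ) {n : ℕ∞} : ContDiff ℝ n (lineKernel k) :=
  (lineBump k).contDiff_normed

lemma continuous_lineKernel (k : ℕ) : Continuous (lineKernel k) :=
  (lineBump k).continuous_normed

lemma hasCompactSupport_lineKernel (k : ℕ) : HasCompactSupport (lineKernel k) :=
  (lineBump k).hasCompactSupport_normed

lemma lineBump_rOut_tendsto : Tendsto (fun k => (lineBump k).rOut) atTop (𝓝 0) := by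
  have := (tendsto_one_div_add_atTop_nhds_zero_nat (𝕜 := ℝ)).const_mul 2
  simpa [lineBump, div_eq_mul_inv] using this

lemma lineKernel_conv_ae {g : ℝ → ℝ} (hg : LocallyIntegrable g volume) :
    ∀ᵐ s, Tendsto (fun k => ∫ σ, lineKernel k (s - σ) * g σ) atTop (𝓝 (g s)) := by
  have h := ContDiffBump.ae_convolution_tendsto_right_of_locallyIntegrable (K := 2) (μ := volume)
    (φ := lineBump) (l := atTop) lineBump_rOut_tendsto
    (Eventually.of_forall fun k => by simp [lineBump, div_eq_mul_inv]) hg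
  filter_upwards [h] with s hs
  refine hs.congr fun k => ?_
  rw [MeasureTheory.convolution_eq_swap]
  simp [lineKernel]

section levelDensity

variable {α : Type*} [MeasurableSpace α] (μ : Measure α)

/-- The density at level `s` of the push-forward under `v` of the measure with density `a`. -/
def levelDensity (v : α → ℝ) (a : α → ℝ≥0∞) : ℝ → ℝ≥0∞ :=
  (Measure.map v (μ.withDensity a)).rnDeriv volume

/-- The weight `a` does not charge the preimages under `v` of Lebesgue null sets. -/
def NullPreimages (v : α → ℝ) (a : α → ℝ≥0∞) : Prop :=
  ∀ N : Set ℝ, MeasurableSet N → volume N = 0 → ∫⁻ x in v ⁻¹' N, a x ∂μ = 0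

variable {μ}
variable {v : α → ℝ} {a b : α → ℝ≥0∞}

lemma measurable_levelDensity : Measurable (levelDensity μ v a) :=
  Measure.measurable_rnDeriv _ _

lemma NullPreimages.mono (h : NullPreimages μ v a)
    (hab : ∀ x, a x = 0 → b x = 0) (ha : Measurable a) (hb : Measurable b) :
    NullPreimages μ v b := by
  intro N hN hN0
  have := h N hN hN0
  rw [lintegral_eq_zero_iff ha] at this
  rw [lintegral_eq_zero_iff hb]
  filter_upwards [this] with x hx
  exact hab x hx

lemma NullPreimages.map_absolutelyContinuous (h : NullPreimages μ v a) (hv : Measurable v) :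
    Measure.map v (μ.withDensity a) ≪ volume := by
  refine Measure.AbsolutelyContinuous.mk fun N hN hN0 => ?_
  rw [Measure.map_apply hv hN, withDensity_apply _ (hv hN)]
  exact h N hN hN0

lemma lintegral_levelDensity_mul (h : NullPreimages μ v a) (hv : Measurable v) (ha : Measurable a)
    (hfin : ∫⁻ x, a x ∂μ ≠ ∞) {ψ : ℝ → ℝ≥0∞} (hψ : Measurable ψ) :
    ∫⁻ s, levelDensity μ v a s * ψ s = ∫⁻ x, a x * ψ (v x) ∂μ := by
  have : IsFiniteMeasure (μ.withDensity a) := isFiniteMeasure_withDensity hfin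
  have h1 : volume.withDensity (levelDensity μ v a) = Measure.map v (μ.withDensity a) :=
    Measure.withDensity_rnDeriv_eq _ _ (h.map_absolutelyContinuous hv)
  have h2 := lintegral_withDensity_eq_lintegral_mul (volume : Measure ℝ)
    (measurable_levelDensity (μ := μ) (v := v) (a := a)) hψ
  rw [h1, lintegral_map hψ hv] at h2
  have h3 := lintegral_withDensity_eq_lintegral_mul μ ha (hψ.comp hv)
  simp only [Function.comp_apply] at h3
  rw [h3] at h2
  exact h2.symm

lemma lintegral_levelDensity (h : NullPreimages μ v a) (hv : Measurable v) (ha : Measurable a)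
    (hfin : ∫⁻ x, a x ∂μ ≠ ∞) : ∫⁻ s, levelDensity μ v a s = ∫⁻ x, a x ∂μ := by
  simpa using lintegral_levelDensity_mul h hv ha hfin (ψ := fun _ => 1) measurable_const

lemma levelDensity_ne_top (h : NullPreimages μ v a) (hv : Measurable v) (ha : Measurable a)
    (hfin : ∫⁻ x, a x ∂μ ≠ ∞) : ∀ᵐ s, levelDensity μ v a s ≠ ∞ := by
  filter_upwards [ae_lt_top measurable_levelDensity
    ((lintegral_levelDensity h hv ha hfin).trans_ne hfin)] with s hs using hs.ne

/-- Mollified level integrals converge almost everywhere to the level density. -/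
lemma levelDensity_tendsto (h : NullPreimages μ v a) (hv : Measurable v) (ha : Measurable a)
    (hfin : ∫⁻ x, a x ∂μ ≠ ∞) :
    ∀ᵐ s, Tendsto (fun k => ∫⁻ x, a x * ENNReal.ofReal (lineKernel k (s - v x)) ∂μ) atTop
      (𝓝 (levelDensity μ v a s)) := by
  have hI : Integrable (fun s => (levelDensity μ v a s).toReal) :=
    integrable_toReal_of_lintegral_ne_top measurable_levelDensity.aemeasurable
      ((lintegral_levelDensity h hv ha hfin).trans_ne hfin)
  filter_upwards [lineKernel_conv_ae hI.locallyIntegrable, levelDensity_ne_top h hv ha hfin]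
    with s hs hs'
  have h1 := ENNReal.tendsto_ofReal hs
  rw [ENNReal.ofReal_toReal hs'] at h1
  refine h1.congr fun k => ?_
  have hm : Measurable fun σ => ENNReal.ofReal (lineKernel k (s - σ)) :=
    ((continuous_lineKernel k).measurable.comp (measurable_const.sub measurable_id)).ennreal_ofReal
  rw [← lintegral_levelDensity_mul h hv ha hfin hm, ofReal_integral_eq_lintegral_ofReal]
  · refine lintegral_congr_ae ?_
    filter_upwards [levelDensity_ne_top h hv ha hfin] with σ hσ
    rw [ENNReal.ofReal_mul (lineKernel_nonneg _ _), ENNReal.ofReal_toReal hσ, mul_comm]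
  · obtain ⟨C, hC⟩ := (hasCompactSupport_lineKernel k).exists_bound_of_continuous
      (continuous_lineKernel k)
    exact hI.bdd_mul (c := C) ((continuous_lineKernel k).comp
      (continuous_const.sub continuous_id)).aestronglyMeasurable
      (Eventually.of_forall fun σ => hC _)
  · exact Eventually.of_forall fun σ => mul_nonneg (lineKernel_nonneg _ _) ENNReal.toReal_nonneg

/-- Hölder's inequality for level densities. -/
lemma levelDensity_holder (ha0 : NullPreimages μ v a) (hb0 : NullPreimages μ v b)
    (hv : Measurable v) (ha : Measurable a) (hb : Measurable b)
    (hfa : ∫⁻ x, a x ∂μ ≠ ∞) (hfb : ∫⁻ x, b x ∂μ ≠ ∞) {c : α → ℝ≥0∞} (hc : Measurable c)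
    {p q : ℝ} (hp : 0 < p) (hq : 0 < q) (hpq : p + q = 1)
    (hcab : ∀ x, c x ≤ a x ^ p * b x ^ q) :
    ∀ᵐ s, levelDensity μ v c s ≤ levelDensity μ v a s ^ p * levelDensity μ v b s ^ q := by
  have key : ∀ k : ℝ → ℝ≥0∞, Measurable k → ∫⁻ x, c x * k (v x) ∂μ ≤
      (∫⁻ x, a x * k (v x) ∂μ) ^ p * (∫⁻ x, b x * k (v x) ∂μ) ^ q := by
    intro k hk
    refine le_trans (lintegral_mono fun x => ?_) (ENNReal.lintegral_mul_norm_pow_le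
      (ha.mul (hk.comp hv)).aemeasurable (hb.mul (hk.comp hv)).aemeasurable hp.le hq.le hpq)
    simp only [Pi.mul_apply, Function.comp]
    rw [ENNReal.mul_rpow_of_nonneg _ _ hp.le, ENNReal.mul_rpow_of_nonneg _ _ hq.le]
    calc c x * k (v x) ≤ (a x ^ p * b x ^ q) * (k (v x) ^ p * k (v x) ^ q) := by
          rw [← ENNReal.rpow_add_of_nonneg _ _ hp.le hq.le, hpq, ENNReal.rpow_one]
          gcongr; exact hcab x
      _ = _ := by ring
  have hc0 : NullPreimages μ v c := by
    intro N hN hN0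
    have h1 := key (N.indicator 1) (measurable_one.indicator hN)
    have h2 : ∀ f : α → ℝ≥0∞, ∫⁻ x, f x * N.indicator (1 : ℝ → ℝ≥0∞) (v x) ∂μ
        = ∫⁻ x in v ⁻¹' N, f x ∂μ := by
      intro f
      rw [← lintegral_indicator (hv hN)]
      refine lintegral_congr fun x => ?_
      by_cases hx : v x ∈ N <;> simp [hx, Set.indicator]
    rw [h2, h2, h2, ha0 N hN hN0, ENNReal.zero_rpow_of_pos hp, zero_mul] at h1
    exact le_antisymm h1 zero_le
  have hfc : ∫⁻ x, c x ∂μ ≠ ∞ := by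
    have h1 := key 1 measurable_one
    simp only [Pi.one_apply, mul_one] at h1
    exact ne_top_of_le_ne_top (ENNReal.mul_ne_top (ENNReal.rpow_ne_top_of_nonneg hp.le hfa)
      (ENNReal.rpow_ne_top_of_nonneg hq.le hfb)) h1
  filter_upwards [levelDensity_tendsto ha0 hv ha hfa, levelDensity_tendsto hb0 hv hb hfb,
    levelDensity_tendsto hc0 hv hc hfc, levelDensity_ne_top ha0 hv ha hfa,
    levelDensity_ne_top hb0 hv hb hfb] with s h1 h2 h3 h4 h5
  refine le_of_tendsto_of_tendsto' h3 (ENNReal.Tendsto.mul (h1.ennrpow_const p)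
    (Or.inr (ENNReal.rpow_ne_top_of_nonneg hq.le h5)) (h2.ennrpow_const q)
    (Or.inr (ENNReal.rpow_ne_top_of_nonneg hp.le h4))) fun k => ?_
  exact key (fun σ => ENNReal.ofReal (lineKernel k (s - σ)))
    (((continuous_lineKernel k).measurable.comp
      (measurable_const.sub measurable_id)).ennreal_ofReal)

end levelDensity

section line

variable {w : ℝ → ℝ}

/-- Near a noncritical point a `C¹` function is injective, and its image is a neighborhood. -/
lemma exists_injOn_nhds_of_deriv_ne_zero (hw : ContDiff ℝ 1 w) {y : ℝ} (hy : deriv w y ≠ 0)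
    {O : Set ℝ} (hO : O ∈ 𝓝 y) :
    ∃ I, IsOpen I ∧ y ∈ I ∧ I ⊆ O ∧ Set.InjOn w I ∧ w '' I ∈ 𝓝 (w y) := by
  have hs : HasStrictDerivAt w (deriv w y) y :=
    hw.contDiffAt.hasStrictDerivAt (by norm_num)
  have hs' := hs.hasStrictFDerivAt_equiv hy
  set e := hs'.toOpenPartialHomeomorph w
  have he : y ∈ e.source := hs'.mem_toOpenPartialHomeomorph_source
  refine ⟨e.source ∩ interior O, e.open_source.inter isOpen_interior,
    ⟨he, mem_interior_iff_mem_nhds.2 hO⟩, Set.inter_subset_right.trans interior_subset,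
    e.injOn.mono Set.inter_subset_left, ?_⟩
  rw [← hs.map_nhds_eq hy]
  exact image_mem_map ((e.open_source.inter isOpen_interior).mem_nhds
    ⟨he, mem_interior_iff_mem_nhds.2 hO⟩)

lemma lintegral_enorm_deriv_mul_eq_lintegral_image (hw : ContDiff ℝ 1 w) {I : Set ℝ}
    (hI : MeasurableSet I) (hinj : Set.InjOn w I) (ψ : ℝ → ℝ≥0∞) :
    ∫⁻ y in I, ‖deriv w y‖ₑ * ψ (w y) = ∫⁻ s in w '' I, ψ s := by
  rw [lintegral_image_eq_lintegral_abs_deriv_mul hI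
    (fun y _ => (hw.differentiable (by norm_num) y).hasDerivAt.hasDerivWithinAt) hinj]
  simp [Real.enorm_eq_ofReal_abs]

lemma measurable_enorm_deriv (w : ℝ → ℝ) : Measurable fun y => ‖deriv w y‖ₑ :=
  (measurable_deriv w).enorm

lemma nullPreimages_enorm_deriv (hw : ContDiff ℝ 1 w) :
    NullPreimages volume w (fun y => ‖deriv w y‖ₑ) := by
  intro N hN hN0
  have hNw : MeasurableSet (w ⁻¹' N) := hw.continuous.measurable hN
  rw [lintegral_eq_zero_iff (measurable_enorm_deriv w)]
  have hd : MeasurableSet {y | deriv w y ≠ 0} :=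
    (measurable_deriv w) (measurableSet_singleton 0).compl
  suffices h : volume (w ⁻¹' N ∩ {y | deriv w y ≠ 0}) = 0 by
    rw [EventuallyEq, ae_restrict_iff' hNw]
    refine (measure_eq_zero_iff_ae_notMem.1 h).mono fun y hy hyN => ?_
    by_contra hne
    exact hy ⟨hyN, fun h0 => hne (by simp [h0])⟩
  refine measure_null_of_locally_null _ fun y hy => ?_
  obtain ⟨I, hIo, hyI, -, hinj, -⟩ := exists_injOn_nhds_of_deriv_ne_zero hw hy.2 univ_mem
  refine ⟨(w ⁻¹' N ∩ {y | deriv w y ≠ 0}) ∩ I,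
    inter_mem_nhdsWithin _ (hIo.mem_nhds hyI), ?_⟩
  have hm : MeasurableSet ((w ⁻¹' N ∩ {y | deriv w y ≠ 0}) ∩ I) :=
    (hNw.inter hd).inter hIo.measurableSet
  have h1 := lintegral_enorm_deriv_mul_eq_lintegral_image hw hm
    (hinj.mono Set.inter_subset_right) 1
  have h2 : volume (w '' ((w ⁻¹' N ∩ {y | deriv w y ≠ 0}) ∩ I)) = 0 := by
    refine measure_mono_null ?_ hN0
    rintro _ ⟨z, hz, rfl⟩
    exact hz.1.1
  simp only [Pi.one_apply, mul_one, lintegral_one, Measure.restrict_apply_univ, h2] at h1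
  rw [lintegral_eq_zero_iff (measurable_enorm_deriv w), EventuallyEq, ae_restrict_iff' hm] at h1
  refine measure_eq_zero_iff_ae_notMem.2 (h1.mono fun z hz hzm => ?_)
  have := hz hzm
  simp at this
  exact hzm.1.2 this

/-- Lower bound for mollified crossing sums by a single crossing. -/
lemma enorm_deriv_sq_le_liminf (hw : ContDiff ℝ 1 w) (y : ℝ) :
    ‖deriv w y‖ₑ ^ 2 ≤ liminf (fun k => ∫⁻ z, ‖deriv w z‖ₑ ^ 3 *
      ENNReal.ofReal (lineKernel k (w y - w z))) atTop := by
  by_cases hy : deriv w y = 0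
  · simp [hy]
  refine le_of_forall_lt fun c hc => lt_of_lt_of_le ?_ (le_refl _)
  obtain ⟨c', hcc', hc'⟩ := exists_between hc
  refine lt_of_lt_of_le hcc' ?_
  have hcont : Continuous fun z => ‖deriv w z‖ₑ ^ 2 :=
    (ENNReal.continuous_pow 2).comp (hw.continuous_deriv le_rfl).enorm
  obtain ⟨I, hIo, hyI, hIsub, hinj, himg⟩ := exists_injOn_nhds_of_deriv_ne_zero hw hy
    (hcont.continuousAt.eventually (lt_mem_nhds hc'))
  obtain ⟨ε, hε, hball⟩ := Metric.mem_nhds_iff.1 himg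
  refine le_liminf_of_le (by isBoundedDefault) ?_
  have hev : ∀ᶠ k in atTop, (lineBump k).rOut < ε :=
    lineBump_rOut_tendsto.eventually (gt_mem_nhds hε)
  filter_upwards [hev] with k hk
  have hone : ∫⁻ s in w '' I, ENNReal.ofReal (lineKernel k (w y - s)) = 1 := by
    have h1 : ∫⁻ s, ENNReal.ofReal (lineKernel k (w y - s)) = 1 := by
      rw [lintegral_sub_left_eq_self (fun s => ENNReal.ofReal (lineKernel k s)),
        ← ofReal_integral_eq_lintegral_ofReal]
      · rw [lineKernel, ContDiffBump.integral_normed]; simp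
      · exact (continuous_lineKernel k).integrable_of_hasCompactSupport
          (hasCompactSupport_lineKernel k)
      · exact Eventually.of_forall (lineKernel_nonneg k)
    rw [← h1]
    refine setLIntegral_eq_of_support_subset ?_
    intro s hs
    apply hball
    have : lineKernel k (w y - s) ≠ 0 := by
      intro h0
      simp [h0] at hs
    have h2 : w y - s ∈ Function.support ((lineBump k).normed volume) := this
    rw [ContDiffBump.support_normed_eq, Metric.mem_ball, dist_zero_right] at h2
    rw [Metric.mem_ball, dist_comm, dist_eq_norm]
    exact h2.trans hk
  calc c' = c' * ∫⁻ z in I, ‖deriv w z‖ₑ * ENNReal.ofReal (lineKernel k (w y - w z)) := by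
        rw [lintegral_enorm_deriv_mul_eq_lintegral_image hw hIo.measurableSet hinj
          (fun s => ENNReal.ofReal (lineKernel k (w y - s))), hone, mul_one]
    _ ≤ ∫⁻ z in I, c' * (‖deriv w z‖ₑ * ENNReal.ofReal (lineKernel k (w y - w z))) :=
        lintegral_const_mul_le _ _
    _ ≤ ∫⁻ z in I, ‖deriv w z‖ₑ ^ 3 * ENNReal.ofReal (lineKernel k (w y - w z)) := by
        refine setLIntegral_mono' hIo.measurableSet fun z hz => ?_
        rw [← mul_assoc, pow_succ]
        gcongr
        exact (hIsub hz).le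
    _ ≤ _ := setLIntegral_le_lintegral _ _

lemma lintegral_crossing_le (hw : ContDiff ℝ 1 w) (hfin : ∫⁻ z, ‖deriv w z‖ₑ ^ 3 ≠ ∞)
    {q : ℝ} (hq : 1 ≤ q) {ψ : ℝ → ℝ≥0∞} (hψ : Measurable ψ) :
    ∫⁻ y, ‖deriv w y‖ₑ * (‖deriv w y‖ₑ ^ 2) ^ q * ψ (w y) ≤
      ∫⁻ s, (liminf (fun k => ∫⁻ z, ‖deriv w z‖ₑ ^ 3 *
        ENNReal.ofReal (lineKernel k (s - w z))) atTop) ^ q * ψ s := by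
  have hwm := hw.continuous.measurable
  have ha : Measurable fun z => ‖deriv w z‖ₑ ^ 3 := (measurable_enorm_deriv w).pow_const 3
  have h0 : NullPreimages volume w (fun z => ‖deriv w z‖ₑ ^ 3) :=
    (nullPreimages_enorm_deriv hw).mono (fun x hx => by simp [hx]) (measurable_enorm_deriv w) ha
  set L : ℝ → ℝ≥0∞ := fun s => liminf (fun k => ∫⁻ z, ‖deriv w z‖ₑ ^ 3 *
    ENNReal.ofReal (lineKernel k (s - w z))) atTop with hL
  have hLeq : ∀ᵐ s, L s = levelDensity volume w (fun z => ‖deriv w z‖ₑ ^ 3) s := by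
    filter_upwards [levelDensity_tendsto h0 hwm ha hfin] with s hs using hs.liminf_eq
  set P := levelDensity volume w (fun z => ‖deriv w z‖ₑ ^ 3) with hP
  have hPm : Measurable P := measurable_levelDensity
  have hbad : ∀ᵐ y, ‖deriv w y‖ₑ ≠ 0 → L (w y) = P (w y) := by
    obtain ⟨N, hN, hNm, hN0⟩ := exists_measurable_superset_of_null (ae_iff.1 hLeq)
    have h1 := nullPreimages_enorm_deriv hw N hNm hN0
    rw [lintegral_eq_zero_iff (measurable_enorm_deriv w), EventuallyEq,
      ae_restrict_iff' (hwm hNm)] at h1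
    refine h1.mono fun y hy hne => ?_
    by_contra hcon
    exact hne (hy (hN hcon))
  calc ∫⁻ y, ‖deriv w y‖ₑ * (‖deriv w y‖ₑ ^ 2) ^ q * ψ (w y)
      ≤ ∫⁻ y, ‖deriv w y‖ₑ ^ 3 * (P (w y) ^ (q - 1) * ψ (w y)) := by
        refine lintegral_mono_ae (hbad.mono fun y hy => ?_)
        by_cases hd : ‖deriv w y‖ₑ = 0
        · simp [hd]
        have h1 := enorm_deriv_sq_le_liminf hw y
        have h2 : (‖deriv w y‖ₑ ^ 2) ^ q = ‖deriv w y‖ₑ ^ 2 * (‖deriv w y‖ₑ ^ 2) ^ (q - 1) := by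
          conv_lhs => rw [show q = 1 + (q - 1) by ring]
          rw [ENNReal.rpow_add_of_nonneg _ _ zero_le_one (by linarith), ENNReal.rpow_one]
        rw [h2, ← mul_assoc, ← mul_assoc, ← pow_succ', ← hy hd]
        gcongr
    _ = ∫⁻ s, P s * (P s ^ (q - 1) * ψ s) :=
        (lintegral_levelDensity_mul h0 hwm ha hfin
          (ψ := fun s => P s ^ (q - 1) * ψ s) ((hPm.pow_const _).mul hψ)).symm
    _ = ∫⁻ s, L s ^ q * ψ s := by
        refine lintegral_congr_ae (hLeq.mono fun s hs => ?_)
        simp only []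
        rw [hs, ← mul_assoc]
        congr 1
        conv_rhs => rw [show q = 1 + (q - 1) by ring]
        rw [ENNReal.rpow_add_of_nonneg _ _ zero_le_one (by linarith), ENNReal.rpow_one]

end line

section dirDeriv

variable {E : Type*} [NormedAddCommGroup E] [NormedSpace ℝ E] {v : E → ℝ}

/-- The derivative of `v` in the direction `e`. -/
def dirDeriv (v : E → ℝ) (e x : E) : ℝ := fderiv ℝ v x e

lemma ContDiff.dirDeriv {m n : WithTop ℕ∞} (hv : ContDiff ℝ n v) (hmn : m + 1 ≤ n) (e : E) :
    ContDiff ℝ m (dirDeriv v e) :=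
  (hv.fderiv_right hmn).clm_apply contDiff_const

lemma ContDiff.continuous_dirDeriv (hv : ContDiff ℝ 1 v) (e : E) :
    Continuous (_root_.dirDeriv v e) :=
  (hv.dirDeriv (m := 0) (by norm_num) e).continuous

lemma HasCompactSupport.dirDeriv (hv : HasCompactSupport v) (e : E) :
    HasCompactSupport (dirDeriv v e) :=
  hv.fderiv_apply (𝕜 := ℝ) e

lemma dirDeriv_comm (hv : ContDiff ℝ 2 v) (e e' x : E) :
    dirDeriv (dirDeriv v e) e' x = dirDeriv (dirDeriv v e') e x := by
  have hd : DifferentiableAt ℝ (fderiv ℝ v) x :=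
    (hv.fderiv_right (m := 1) (by norm_num)).differentiable (by norm_num) x
  have h1 : ∀ a b : E, dirDeriv (dirDeriv v a) b x = fderiv ℝ (fderiv ℝ v) x b a := by
    intro a b
    simp only [dirDeriv]
    change fderiv ℝ (fun y => fderiv ℝ v y a) x b = _
    rw [fderiv_clm_apply hd (differentiableAt_const a)]
    simp
  rw [h1, h1]
  exact (hv.contDiffAt.isSymmSndFDerivAt (by simp)).eq e' e

lemma hasDerivAt_mul_abs (t : ℝ) : HasDerivAt (fun t : ℝ => t * |t|) (2 * |t|) t := by
  rcases lt_trichotomy t 0 with h | h | h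
  · have := (hasDerivAt_id t).mul (hasDerivAt_abs_neg h)
    refine this.congr_deriv ?_
    simp [abs_of_neg h]; ring
  · subst h
    rw [hasDerivAt_iff_isLittleO]
    simp only [mul_zero, abs_zero, sub_zero, smul_eq_mul]
    have : (fun x : ℝ => |x|) =o[𝓝 0] (fun _ => (1 : ℝ)) := by
      rw [Asymptotics.isLittleO_one_iff]
      simpa using (continuous_abs (G := ℝ)).tendsto 0
    simpa using (Asymptotics.isBigO_refl (fun x : ℝ => x) (𝓝 0)).mul_isLittleO this
  · have := (hasDerivAt_id t).mul (hasDerivAt_abs_pos h)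
    refine this.congr_deriv ?_
    simp [abs_of_pos h]; ring

lemma contDiff_mul_abs : ContDiff ℝ 1 fun t : ℝ => t * |t| := by
  rw [contDiff_one_iff_deriv]
  refine ⟨fun t => (hasDerivAt_mul_abs t).differentiableAt, ?_⟩
  rw [show deriv (fun t : ℝ => t * |t|) = fun t => 2 * |t| from
    funext fun t => (hasDerivAt_mul_abs t).deriv]
  fun_prop

end dirDeriv

section slice

lemma HasCompactSupport.integral_slice {F : Type*} [NormedAddCommGroup F] {g : F × ℝ → ℝ}
    (hc : HasCompactSupport g) :
    HasCompactSupport fun z => ∫ y, g (z, y) := by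
  refine HasCompactSupport.intro (hc.isCompact.image continuous_fst) fun z hz => ?_
  rw [← integral_zero ℝ ℝ]
  refine integral_congr_ae (Eventually.of_forall fun y => ?_)
  by_contra hne
  exact hz ⟨(z, y), subset_tsupport _ hne, rfl⟩

lemma HasCompactSupport.slice {F : Type*} [NormedAddCommGroup F] {g : F × ℝ → ℝ}
    (hc : HasCompactSupport g) (z : F) :
    HasCompactSupport fun y => g (z, y) := by
  refine HasCompactSupport.intro (hc.isCompact.image continuous_snd) fun y hy => ?_
  by_contra hne
  exact hy ⟨(z, y), subset_tsupport _ hne, rfl⟩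

variable {F : Type*} [NormedAddCommGroup F] [NormedSpace ℝ F] [FiniteDimensional ℝ F]

lemma hasFDerivAt_integral_slice {g : F × ℝ → ℝ} (hg : ContDiff ℝ 1 g) (hc : HasCompactSupport g)
    (z : F) : HasFDerivAt (fun z => ∫ y, g (z, y))
      (∫ y, (fderiv ℝ g (z, y)).comp (ContinuousLinearMap.inl ℝ F ℝ)) z := by
  set K : Set ℝ := Prod.snd '' tsupport g with hK
  have hKc : IsCompact K := hc.isCompact.image continuous_snd
  have hcont : Continuous fun p : F × ℝ =>
      (fderiv ℝ g p).comp (ContinuousLinearMap.inl ℝ F ℝ) :=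
    (hg.continuous_fderiv (by norm_num)).clm_comp continuous_const
  have hcs : HasCompactSupport fun p : F × ℝ =>
      (fderiv ℝ g p).comp (ContinuousLinearMap.inl ℝ F ℝ) :=
    (hc.fderiv (𝕜 := ℝ)).comp_left (g := fun L : F × ℝ →L[ℝ] ℝ =>
      L.comp (ContinuousLinearMap.inl ℝ F ℝ)) (by simp)
  obtain ⟨C, hC⟩ := hcs.exists_bound_of_continuous hcont
  refine hasFDerivAt_integral_of_dominated_of_fderiv_le (s := Set.univ) univ_mem
    (bound := K.indicator fun _ => C)
    (F' := fun z y => (fderiv ℝ g (z, y)).comp (ContinuousLinearMap.inl ℝ F ℝ))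
    (Eventually.of_forall fun x => ?_) ?_ ?_ (Eventually.of_forall fun y x _ => ?_) ?_
    (Eventually.of_forall fun y x _ => ?_)
  · exact (hg.continuous.comp (by fun_prop)).aestronglyMeasurable
  · exact (hg.continuous.comp (by fun_prop)).integrable_of_hasCompactSupport (hc.slice z)
  · exact (hcont.comp (by fun_prop : Continuous fun y : ℝ => (z, y))).aestronglyMeasurable
  · by_cases hy : y ∈ K
    · simpa [hy] using hC (x, y)
    · have : fderiv ℝ g (x, y) = 0 := by
        by_contra hne
        exact hy ⟨(x, y), support_fderiv_subset ℝ hne, rfl⟩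
      simp [hy, this]
  · exact (integrable_indicator_iff hKc.measurableSet).2
      (integrableOn_const hKc.measure_lt_top.ne)
  · exact ((hg.differentiable (by norm_num) (x, y)).hasFDerivAt).comp x (hasFDerivAt_prodMk_left x y)

lemma contDiff_integral_slice {g : F × ℝ → ℝ} (hg : ContDiff ℝ 1 g) (hc : HasCompactSupport g) :
    ContDiff ℝ 1 fun z => ∫ y, g (z, y) := by
  rw [contDiff_one_iff_fderiv]
  refine ⟨fun z => (hasFDerivAt_integral_slice hg hc z).differentiableAt, ?_⟩
  have h1 : fderiv ℝ (fun z => ∫ y, g (z, y)) =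
      fun z => ∫ y, (fderiv ℝ g (z, y)).comp (ContinuousLinearMap.inl ℝ F ℝ) :=
    funext fun z => (hasFDerivAt_integral_slice hg hc z).fderiv
  set K : Set ℝ := Prod.snd '' tsupport g with hK
  have h2 : ∀ z, ∫ y, (fderiv ℝ g (z, y)).comp (ContinuousLinearMap.inl ℝ F ℝ) =
      ∫ y in K, (fderiv ℝ g (z, y)).comp (ContinuousLinearMap.inl ℝ F ℝ) := by
    intro z
    refine (setIntegral_eq_integral_of_forall_compl_eq_zero fun y hy => ?_).symm
    have : fderiv ℝ g (z, y) = 0 := by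
      by_contra hne
      exact hy ⟨(z, y), support_fderiv_subset ℝ hne, rfl⟩
    simp [this]
  rw [h1, funext h2]
  refine continuous_parametric_integral_of_continuous ?_ (hc.isCompact.image continuous_snd)
  exact (hg.continuous_fderiv (by norm_num)).clm_comp continuous_const

lemma fderiv_integral_slice {g : F × ℝ → ℝ} (hg : ContDiff ℝ 1 g) (hc : HasCompactSupport g)
    (z e : F) : fderiv ℝ (fun z => ∫ y, g (z, y)) z e = ∫ y, dirDeriv g (e, 0) (z, y) := by
  have hcont : Continuous fun p : F × ℝ =>
      (fderiv ℝ g p).comp (ContinuousLinearMap.inl ℝ F ℝ) :=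
    (hg.continuous_fderiv (by norm_num)).clm_comp continuous_const
  rw [(hasFDerivAt_integral_slice hg hc z).fderiv, ContinuousLinearMap.integral_apply]
  · simp [dirDeriv]
  · refine (hcont.comp (by fun_prop : Continuous fun y : ℝ => (z, y))).integrable_of_hasCompactSupport
      (HasCompactSupport.intro (hc.isCompact.image continuous_snd) fun y hy => ?_)
    have : fderiv ℝ g (z, y) = 0 := by
      by_contra hne
      exact hy ⟨(z, y), support_fderiv_subset ℝ hne, rfl⟩
    simp [this]

end slice

section sliceMean

/-- The integral over vertical lines of the cube of the vertical slope, weighted in terms of the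
level. -/
def sliceMean {F : Type*} [NormedAddCommGroup F] [NormedSpace ℝ F] (V : F × ℝ → ℝ) (ρ : ℝ → ℝ)
    (z : F) : ℝ :=
  ∫ y, dirDeriv V (0, 1) (z, y) * (dirDeriv V (0, 1) (z, y) * |dirDeriv V (0, 1) (z, y)|) *
    ρ (V (z, y))

section

variable {F : Type*} [NormedAddCommGroup F] [NormedSpace ℝ F]
variable {V : F × ℝ → ℝ} {ρ : ℝ → ℝ}

lemma hasDerivAt_slice {g : F × ℝ → ℝ} (hg : ContDiff ℝ 1 g) (z : F) (y : ℝ) :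
    HasDerivAt (fun y => g (z, y)) (dirDeriv g (0, 1) (z, y)) y := by
  have h := ((hg.differentiable (by norm_num) (z, y)).hasFDerivAt).comp y
    (hasFDerivAt_prodMk_right z y)
  exact h.hasDerivAt.congr_deriv (by simp [dirDeriv])

lemma contDiff_sliceMean_integrand (hV : ContDiff ℝ 2 V) (hρ : ContDiff ℝ 1 ρ) :
    ContDiff ℝ 1 fun p => dirDeriv V (0, 1) p * (dirDeriv V (0, 1) p * |dirDeriv V (0, 1) p|) *
      ρ (V p) :=
  ((hV.dirDeriv (by norm_num) _).mul (contDiff_mul_abs.comp (hV.dirDeriv (by norm_num) _))).mul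
    (hρ.comp (hV.of_le (by norm_num)))

lemma hasCompactSupport_sliceMean_integrand (hVc : HasCompactSupport V) :
    HasCompactSupport fun p => dirDeriv V (0, 1) p *
      (dirDeriv V (0, 1) p * |dirDeriv V (0, 1) p|) * ρ (V p) :=
  ((hVc.dirDeriv _).mul_right).mul_right

lemma hasCompactSupport_sliceMean (hVc : HasCompactSupport V) :
    HasCompactSupport (sliceMean V ρ) :=
  (hasCompactSupport_sliceMean_integrand hVc).integral_slice

variable [FiniteDimensional ℝ F]

lemma contDiff_sliceMean (hV : ContDiff ℝ 2 V) (hVc : HasCompactSupport V) (hρ : ContDiff ℝ 1 ρ) :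
    ContDiff ℝ 1 (sliceMean V ρ) :=
  contDiff_integral_slice (contDiff_sliceMean_integrand hV hρ)
    (hasCompactSupport_sliceMean_integrand hVc)

lemma fderiv_sliceMean (hV : ContDiff ℝ 2 V) (hVc : HasCompactSupport V) (hρ : ContDiff ℝ 1 ρ)
    (z e : F) : fderiv ℝ (sliceMean V ρ) z e =
      ∫ y, 2 * |dirDeriv V (0, 1) (z, y)| *
        (dirDeriv V (0, 1) (z, y) * dirDeriv (dirDeriv V (0, 1)) (e, 0) (z, y) -
          dirDeriv V (e, 0) (z, y) * dirDeriv (dirDeriv V (0, 1)) (0, 1) (z, y)) *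
        ρ (V (z, y)) := by
  set U := dirDeriv V (0, 1) with hU
  set W := dirDeriv V (e, 0) with hW
  have hU1 : ContDiff ℝ 1 U := hV.dirDeriv (by norm_num) _
  have hW1 : ContDiff ℝ 1 W := hV.dirDeriv (by norm_num) _
  have hV1 : ContDiff ℝ 1 V := hV.of_le (by norm_num)
  have hUc : HasCompactSupport U := hVc.dirDeriv _
  have hr1 : Continuous (deriv ρ) := hρ.continuous_deriv le_rfl
  have hdU : ∀ e', Continuous (dirDeriv U e') := hU1.continuous_dirDeriv
  have h1 : ∀ p, dirDeriv (fun p => U p * (U p * |U p|) * ρ (V p)) (e, 0) p =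
      dirDeriv U (e, 0) p * (U p * |U p|) * ρ (V p) +
        U p * (2 * |U p| * dirDeriv U (e, 0) p) * ρ (V p) +
        U p * (U p * |U p|) * (deriv ρ (V p) * W p) := by
    intro p
    have a1 := (hU1.differentiable (by norm_num) p).hasFDerivAt
    have a2 := (hasDerivAt_mul_abs (U p)).comp_hasFDerivAt p a1
    have a3 := ((hρ.differentiable (by norm_num) (V p)).hasDerivAt).comp_hasFDerivAt p
      (hV1.differentiable (by norm_num) p).hasFDerivAt
    have a4 := (a1.mul a2).mul a3
    change fderiv ℝ _ p (e, 0) = _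
    have a5 := a4.fderiv
    simp only [Pi.mul_def, Function.comp_def] at a5
    rw [a5]
    simp only [add_apply, smul_apply,
      smul_eq_mul, dirDeriv, hW]
    ring
  have h2 : ∀ y, HasDerivAt (fun y => U (z, y) * |U (z, y)| * W (z, y) * ρ (V (z, y)))
      (2 * |U (z, y)| * dirDeriv U (0, 1) (z, y) * W (z, y) * ρ (V (z, y)) +
        U (z, y) * |U (z, y)| * dirDeriv U (e, 0) (z, y) * ρ (V (z, y)) +
        U (z, y) * |U (z, y)| * W (z, y) * (deriv ρ (V (z, y)) * U (z, y))) y := by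
    intro y
    have a1 := hasDerivAt_slice hU1 z y
    have a2 := (hasDerivAt_mul_abs (U (z, y))).comp y a1
    have a3 := hasDerivAt_slice hW1 z y
    have a4 := ((hρ.differentiable (by norm_num) (V (z, y))).hasDerivAt).comp y
      (hasDerivAt_slice hV1 z y)
    rw [hW, dirDeriv_comm hV, ← hU, ← hW] at a3
    refine ((a2.mul a3).mul a4).congr_deriv ?_
    simp only [Function.comp_apply, Pi.mul_apply]
    ring
  have h_int : ∀ g : F × ℝ → ℝ, Continuous g → Integrable fun y => U (z, y) * g (z, y) :=
    fun g hg => ((hU1.continuous.mul hg).comp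
      (by fun_prop : Continuous fun y : ℝ => (z, y))).integrable_of_hasCompactSupport
        ((hUc.mul_right (f' := g)).slice z)
  have h_int' : ∀ g : F × ℝ → ℝ, Continuous g → Integrable fun y => |U (z, y)| * g (z, y) :=
    fun g hg => ((hU1.continuous.abs.mul hg).comp
      (by fun_prop : Continuous fun y : ℝ => (z, y))).integrable_of_hasCompactSupport
        (((hUc.comp_left (g := fun t => |t|) (abs_zero)).mul_right (f' := g)).slice z)
  have hUc0 := hU1.continuous
  have hWc0 := hW1.continuous
  have hVc0 := hV1.continuous
  have hρ0 := hρ.continuous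
  have hd0 := hdU (e, 0)
  have hd1 := hdU (0, 1)
  have i1 := h_int' (fun p => 2 * dirDeriv U (0, 1) p * W p * ρ (V p) +
        U p * dirDeriv U (e, 0) p * ρ (V p) +
        U p * W p * (deriv ρ (V p) * U p)) (by fun_prop)
  have i2 := h_int (fun p => |U p| * W p * ρ (V p)) (by fun_prop)
  have h3 := integral_eq_zero_of_hasDerivAt_of_integrable h2
    (i1.congr (Eventually.of_forall fun y => by simp only []; ring))
    (i2.congr (Eventually.of_forall fun y => by simp only []; ring))
  change fderiv ℝ (fun z => ∫ y, (fun p => U p * (U p * |U p|) * ρ (V p)) (z, y)) z e = _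
  rw [fderiv_integral_slice (contDiff_sliceMean_integrand hV hρ)
    (hasCompactSupport_sliceMean_integrand hVc)]
  have h4 := congrArg (fun r : ℝ => (∫ y, dirDeriv (fun p => U p * (U p * |U p|) * ρ (V p)) (e, 0)
    (z, y)) - r) h3
  simp only [sub_zero] at h4
  refine h4.symm.trans ?_
  rw [← integral_sub]
  · refine integral_congr_ae (Eventually.of_forall fun y => ?_)
    simp only []
    rw [h1]
    ring
  · have := h_int (fun p => dirDeriv U (e, 0) p * (|U p|) * ρ (V p) +
        (2 * |U p| * dirDeriv U (e, 0) p) * ρ (V p) +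
        (U p * |U p|) * (deriv ρ (V p) * W p)) (by fun_prop)
    refine this.congr (Eventually.of_forall fun y => ?_)
    simp only []
    rw [h1]
    ring
  · exact i1.congr (Eventually.of_forall fun y => by simp only []; ring)

end

variable {m : ℕ} {V : (Fin m → ℝ) × ℝ → ℝ} {ρ : ℝ → ℝ}

/-- The weight controlling the horizontal variation of `sliceMean`. -/
def sliceWeight (V : (Fin m → ℝ) × ℝ → ℝ) (p : (Fin m → ℝ) × ℝ) : ℝ≥0∞ :=
  ∑ i : Fin m, ‖|dirDeriv V (0, 1) p| *
    (dirDeriv V (0, 1) p * dirDeriv (dirDeriv V (0, 1)) (Pi.single i 1, 0) p -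
      dirDeriv V (Pi.single i 1, 0) p * dirDeriv (dirDeriv V (0, 1)) (0, 1) p)‖ₑ

lemma opNorm_le_sum_single (L : (Fin m → ℝ) →L[ℝ] ℝ) : ‖L‖ ≤ ∑ i, ‖L (Pi.single i 1)‖ := by
  refine L.opNorm_le_bound (by positivity) fun x => ?_
  have h1 : L x = ∑ i, x i * L (Pi.single i 1) := by
    have := LinearMap.pi_apply_eq_sum_univ (L : (Fin m → ℝ) →ₗ[ℝ] ℝ) x
    simp only [ContinuousLinearMap.coe_coe, smul_eq_mul] at this
    rw [this]
    refine Finset.sum_congr rfl fun i _ => ?_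
    congr 2
    ext k
    simp [Pi.single_apply, eq_comm]
  rw [h1, Finset.sum_mul]
  refine (norm_sum_le _ _).trans (Finset.sum_le_sum fun i _ => ?_)
  rw [norm_mul, mul_comm]
  exact mul_le_mul_of_nonneg_left (norm_le_pi_norm x i) (norm_nonneg _)

lemma measurable_sliceWeight (hV : ContDiff ℝ 2 V) : Measurable (sliceWeight V) := by
  have hU1 : ContDiff ℝ 1 (dirDeriv V (0, 1)) := hV.dirDeriv (by norm_num) _
  refine Finset.measurable_fun_sum _ fun i _ => ?_
  have h1 := hU1.continuous
  have h2 := hU1.continuous_dirDeriv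
  have h3 := (hV.of_le (by norm_num : (1 : WithTop ℕ∞) ≤ 2)).continuous_dirDeriv
  have h4 := h2 (Pi.single i 1, 0)
  have h5 := h2 (0, 1)
  have h6 := h3 (Pi.single i 1, 0)
  exact Continuous.measurable (by fun_prop)

lemma enorm_fderiv_sliceMean_le (hV : ContDiff ℝ 2 V) (hVc : HasCompactSupport V)
    (hρ : ContDiff ℝ 1 ρ) (hρ0 : ∀ s, 0 ≤ ρ s) (z : Fin m → ℝ) :
    ‖fderiv ℝ (sliceMean V ρ) z‖ₑ ≤
      2 * ∫⁻ y, sliceWeight V (z, y) * ENNReal.ofReal (ρ (V (z, y))) := by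
  have h0 : ‖fderiv ℝ (sliceMean V ρ) z‖ₑ ≤
      ∑ i, ‖fderiv ℝ (sliceMean V ρ) z (Pi.single i 1)‖ₑ := by
    have := opNorm_le_sum_single (fderiv ℝ (sliceMean V ρ) z)
    simp only [← ofReal_norm]
    rw [← ENNReal.ofReal_sum_of_nonneg fun i _ => norm_nonneg _]
    exact ENNReal.ofReal_le_ofReal this
  have hsec : Measurable fun y : ℝ => (z, y) := measurable_prodMk_left
  have hU1 : ContDiff ℝ 1 (dirDeriv V (0, 1)) := hV.dirDeriv (by norm_num) _
  have h1 := hU1.continuous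
  have h2 := hU1.continuous_dirDeriv
  have h3 := (hV.of_le (by norm_num : (1 : WithTop ℕ∞) ≤ 2)).continuous_dirDeriv
  have hVc0 := hV.continuous
  have hρc := hρ.continuous
  refine h0.trans ?_
  simp only [sliceWeight, Finset.sum_mul]
  rw [lintegral_finsetSum _ fun i _ => ?_, Finset.mul_sum]
  · refine Finset.sum_le_sum fun i _ => ?_
    rw [fderiv_sliceMean hV hVc hρ, ← lintegral_const_mul' _ _ (by simp)]
    refine (enorm_integral_le_lintegral_enorm _).trans (lintegral_mono fun y => le_of_eq ?_)
    have : ENNReal.ofReal (ρ (V (z, y))) = ‖ρ (V (z, y))‖ₑ := by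
      rw [Real.enorm_eq_ofReal (hρ0 _)]
    rw [this, ← mul_assoc, enorm_mul, enorm_mul, enorm_mul, enorm_mul]
    congr 1
    rw [← mul_assoc]
    congr 2
    simp [Real.enorm_eq_ofReal]
  · have h4 := h2 (Pi.single i 1, 0)
    have h5 := h2 (0, 1)
    have h6 := h3 (Pi.single i 1, 0)
    exact (Continuous.measurable (by fun_prop :
      Continuous fun y : ℝ => |dirDeriv V (0, 1) (z, y)| * (dirDeriv V (0, 1) (z, y) *
        dirDeriv (dirDeriv V (0, 1)) (Pi.single i 1, 0) (z, y) -
        dirDeriv V (Pi.single i 1, 0) (z, y) *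
        dirDeriv (dirDeriv V (0, 1)) (0, 1) (z, y)))).enorm.mul
      (Continuous.measurable (by fun_prop : Continuous fun y => ρ (V (z, y)))).ennreal_ofReal

end sliceMean

section sliceLevels

lemma Continuous.lintegral_enorm_ne_top {X : Type*} [TopologicalSpace X] [MeasurableSpace X]
    [OpensMeasurableSpace X] {μ : Measure X} [IsFiniteMeasureOnCompacts μ] {f : X → ℝ}
    (hf : Continuous f) (hc : HasCompactSupport f) : ∫⁻ x, ‖f x‖ₑ ∂μ ≠ ∞ :=
  (hf.integrable_of_hasCompactSupport hc).hasFiniteIntegral.ne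

lemma contDiff_lineKernel_sub (k : ℕ) (s : ℝ) : ContDiff ℝ 1 fun σ => lineKernel k (s - σ) :=
  (contDiff_lineKernel k (n := 1)).comp (contDiff_const.sub contDiff_id)

variable {m : ℕ} {V : (Fin m → ℝ) × ℝ → ℝ}

lemma deriv_slice (hV : ContDiff ℝ 1 V) (z : Fin m → ℝ) (y : ℝ) :
    deriv (fun y => V (z, y)) y = dirDeriv V (0, 1) (z, y) :=
  (hasDerivAt_slice hV z y).deriv

lemma contDiff_slice (hV : ContDiff ℝ 1 V) (z : Fin m → ℝ) : ContDiff ℝ 1 fun y => V (z, y) :=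
  hV.comp (by fun_prop)

lemma nullPreimages_dirDeriv_slice (hV : ContDiff ℝ 1 V) :
    NullPreimages volume V fun p => ‖dirDeriv V (0, 1) p‖ₑ := by
  intro N hN hN0
  have hm : Measurable fun p => ‖dirDeriv V (0, 1) p‖ₑ :=
    (hV.continuous_dirDeriv _).measurable.enorm
  rw [← lintegral_indicator (hV.continuous.measurable hN), Measure.volume_eq_prod,
    lintegral_prod _ (hm.indicator (hV.continuous.measurable hN)).aemeasurable]
  refine (lintegral_congr fun z => ?_).trans lintegral_zero
  have h := nullPreimages_enorm_deriv (contDiff_slice hV z) N hN hN0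
  rw [← lintegral_indicator ((contDiff_slice hV z).continuous.measurable hN)] at h
  rw [← h]
  refine lintegral_congr fun y => ?_
  simp only [Set.indicator, deriv_slice hV]
  rfl

lemma lintegral_sliceWeight_ne_top (hV : ContDiff ℝ 2 V) (hVc : HasCompactSupport V) :
    ∫⁻ p, sliceWeight V p ≠ ∞ := by
  have hU1 : ContDiff ℝ 1 (dirDeriv V (0, 1)) := hV.dirDeriv (by norm_num) _
  have h1 := hU1.continuous
  have h2 := hU1.continuous_dirDeriv
  have h3 := (hV.of_le (by norm_num : (1 : WithTop ℕ∞) ≤ 2)).continuous_dirDeriv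
  have hc : ∀ i : Fin m, Continuous fun p => |dirDeriv V (0, 1) p| *
      (dirDeriv V (0, 1) p * dirDeriv (dirDeriv V (0, 1)) (Pi.single i 1, 0) p -
      dirDeriv V (Pi.single i 1, 0) p * dirDeriv (dirDeriv V (0, 1)) (0, 1) p) := by
    intro i
    have h4 := h2 (Pi.single i 1, 0)
    have h5 := h2 (0, 1)
    have h6 := h3 (Pi.single i 1, 0)
    fun_prop
  simp only [sliceWeight]
  rw [lintegral_finsetSum _ fun i _ => (hc i).measurable.enorm]
  refine ENNReal.sum_ne_top.2 fun i _ => (hc i).lintegral_enorm_ne_top ?_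
  exact ((hVc.dirDeriv _).comp_left (g := fun t => |t|) abs_zero).mul_right

lemma nullPreimages_sliceWeight (hV : ContDiff ℝ 2 V) :
    NullPreimages volume V (sliceWeight V) := by
  have hV1 : ContDiff ℝ 1 V := hV.of_le (by norm_num)
  refine (nullPreimages_dirDeriv_slice hV1).mono (fun p hp => ?_)
    (hV1.continuous_dirDeriv _).measurable.enorm (measurable_sliceWeight hV)
  rw [enorm_eq_zero] at hp
  simp [sliceWeight, hp]

lemma enorm_sliceMean {ρ : ℝ → ℝ} (hV : ContDiff ℝ 2 V) (hVc : HasCompactSupport V)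
    (hρ : ContDiff ℝ 1 ρ) (hρ0 : ∀ s, 0 ≤ ρ s) (z : Fin m → ℝ) :
    ‖sliceMean V ρ z‖ₑ =
      ∫⁻ y, ‖dirDeriv V (0, 1) (z, y)‖ₑ ^ 3 * ENNReal.ofReal (ρ (V (z, y))) := by
  have h0 : ∀ y, 0 ≤ dirDeriv V (0, 1) (z, y) *
      (dirDeriv V (0, 1) (z, y) * |dirDeriv V (0, 1) (z, y)|) * ρ (V (z, y)) := by
    intro y
    rw [← mul_assoc (dirDeriv V (0, 1) (z, y))]
    exact mul_nonneg (mul_nonneg (mul_self_nonneg _) (abs_nonneg _)) (hρ0 _)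
  rw [sliceMean, Real.enorm_eq_ofReal (integral_nonneg h0), ofReal_integral_eq_lintegral_ofReal]
  · refine lintegral_congr fun y => ?_
    rw [ENNReal.ofReal_mul' (hρ0 _), ← mul_assoc, ← enorm_pow, Real.enorm_eq_ofReal_abs, abs_pow,
      ← abs_mul_abs_self (dirDeriv V (0, 1) (z, y))]
    congr 2
    ring
  · exact ((contDiff_sliceMean_integrand hV hρ).continuous.comp
      (by fun_prop : Continuous fun y : ℝ => (z, y))).integrable_of_hasCompactSupport
        ((hasCompactSupport_sliceMean_integrand hVc).slice z)
  · exact Eventually.of_forall h0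

lemma lintegral_enorm_fderiv_sliceMean_le {ρ : ℝ → ℝ} (hV : ContDiff ℝ 2 V)
    (hVc : HasCompactSupport V) (hρ : ContDiff ℝ 1 ρ) (hρ0 : ∀ s, 0 ≤ ρ s) :
    ∫⁻ z, ‖fderiv ℝ (sliceMean V ρ) z‖ₑ ≤
      2 * ∫⁻ p, sliceWeight V p * ENNReal.ofReal (ρ (V p)) := by
  refine (lintegral_mono (enorm_fderiv_sliceMean_le hV hVc hρ hρ0)).trans ?_
  have hm : Measurable fun p => sliceWeight V p * ENNReal.ofReal (ρ (V p)) :=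
    (measurable_sliceWeight hV).mul (hρ.continuous.comp hV.continuous).measurable.ennreal_ofReal
  rw [lintegral_const_mul' _ _ (by simp), Measure.volume_eq_prod, lintegral_prod _ hm.aemeasurable]

lemma liminf_rpow (f : ℕ → ℝ≥0∞) {q : ℝ} (hq : 0 < q) :
    (liminf f atTop) ^ q = liminf (fun k => f k ^ q) atTop := by
  have := (ENNReal.orderIsoRpow q hq).liminf_apply (u := f) (f := atTop)
  simpa using this

/-- The mollified sum of the squared slopes over the crossings of the level `s` by a vertical
line. -/
def sliceCrossing (V : (Fin m → ℝ) × ℝ → ℝ) (k : ℕ) (s : ℝ) (z : Fin m → ℝ) : ℝ≥0∞ :=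
  ∫⁻ y, ‖dirDeriv V (0, 1) (z, y)‖ₑ ^ 3 * ENNReal.ofReal (lineKernel k (s - V (z, y)))

lemma measurable_sliceCrossing (hV : ContDiff ℝ 1 V) (k : ℕ) :
    Measurable fun x : (Fin m → ℝ) × ℝ => sliceCrossing V k x.2 x.1 := by
  have hf : Measurable fun x : ((Fin m → ℝ) × ℝ) × ℝ =>
      ‖dirDeriv V (0, 1) (x.1.1, x.2)‖ₑ ^ 3 *
        ENNReal.ofReal (lineKernel k (x.1.2 - V (x.1.1, x.2))) := by
    have h0 := hV.continuous_dirDeriv (0, 1)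
    have h1 := continuous_lineKernel k
    have h2 := hV.continuous
    have h3 : Continuous fun x : ((Fin m → ℝ) × ℝ) × ℝ => dirDeriv V (0, 1) (x.1.1, x.2) := by
      fun_prop
    have h4 : Continuous fun x : ((Fin m → ℝ) × ℝ) × ℝ =>
        lineKernel k (x.1.2 - V (x.1.1, x.2)) := by
      fun_prop
    exact (h3.measurable.enorm.pow_const 3).mul h4.measurable.ennreal_ofReal
  exact hf.lintegral_prod_right'

lemma measurable_sliceCrossing_left (hV : ContDiff ℝ 1 V) (k : ℕ) (s : ℝ) :
    Measurable fun z => sliceCrossing V k s z := by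
  have h1 : Measurable fun z : Fin m → ℝ => (z, s) := measurable_prodMk_right
  have h2 := (measurable_sliceCrossing hV k).comp h1
  simpa only [Function.comp_def] using h2

lemma lintegral_liminf_sliceCrossing_le (hV : ContDiff ℝ 2 V) (hVc : HasCompactSupport V) {q : ℝ}
    (hq0 : 0 < q) {c : ℝ≥0∞} (hctop : c ≠ ∞)
    (hsob : ∀ g : (Fin m → ℝ) → ℝ, ContDiff ℝ 1 g → HasCompactSupport g →
      ∫⁻ z, ‖g z‖ₑ ^ q ≤ c * (∫⁻ z, ‖fderiv ℝ g z‖ₑ) ^ q) :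
    ∀ᵐ s, ∫⁻ z, (liminf (fun k => sliceCrossing V k s z) atTop) ^ q ≤
      c * 2 ^ q * levelDensity volume V (sliceWeight V) s ^ q := by
  have hV1 : ContDiff ℝ 1 V := hV.of_le (by norm_num)
  have hGs := measurable_sliceCrossing_left hV1
  filter_upwards [levelDensity_tendsto (nullPreimages_sliceWeight hV) hV.continuous.measurable
    (measurable_sliceWeight hV) (lintegral_sliceWeight_ne_top hV hVc)] with s hs
  have hlim := (ENNReal.Tendsto.const_mul (a := c * 2 ^ q) (hs.ennrpow_const q)
    (Or.inr (ENNReal.mul_ne_top hctop (by finiteness)))).liminf_eq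
  rw [← hlim]
  simp only [liminf_rpow _ hq0]
  refine (lintegral_liminf_le fun k => (hGs k s).pow_const q).trans ?_
  refine liminf_le_liminf (Eventually.of_forall fun k => ?_)
  have hρ := contDiff_lineKernel_sub k s
  have hρ0 : ∀ σ, 0 ≤ lineKernel k (s - σ) := fun σ => lineKernel_nonneg _ _
  have h1 := hsob _ (contDiff_sliceMean hV hVc hρ) (hasCompactSupport_sliceMean hVc)
  simp only [enorm_sliceMean hV hVc hρ hρ0] at h1
  refine h1.trans ?_
  rw [mul_assoc, ← ENNReal.mul_rpow_of_nonneg _ _ hq0.le]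
  gcongr
  exact lintegral_enorm_fderiv_sliceMean_le hV hVc hρ hρ0

/-- Sobolev-type control of the vertical slope on almost every level. -/
lemma lintegral_slice_crossing_le (hV : ContDiff ℝ 2 V) (hVc : HasCompactSupport V) {q : ℝ}
    (hq : 1 ≤ q) {c : ℝ≥0∞} (hctop : c ≠ ∞)
    (hsob : ∀ g : (Fin m → ℝ) → ℝ, ContDiff ℝ 1 g → HasCompactSupport g →
      ∫⁻ z, ‖g z‖ₑ ^ q ≤ c * (∫⁻ z, ‖fderiv ℝ g z‖ₑ) ^ q) {ψ : ℝ → ℝ≥0∞} (hψ : Measurable ψ) :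
    ∫⁻ p, ‖dirDeriv V (0, 1) p‖ₑ * (‖dirDeriv V (0, 1) p‖ₑ ^ 2) ^ q * ψ (V p) ≤
      c * 2 ^ q * ∫⁻ s, levelDensity volume V (sliceWeight V) s ^ q * ψ s := by
  have hV1 : ContDiff ℝ 1 V := hV.of_le (by norm_num)
  have hU := hV1.continuous_dirDeriv (0, 1)
  have hUm : Measurable fun p => ‖dirDeriv V (0, 1) p‖ₑ := hU.measurable.enorm
  have hGm := measurable_sliceCrossing hV1
  have hGs := measurable_sliceCrossing_left hV1
  have hfin : ∀ z, ∫⁻ y, ‖deriv (fun y => V (z, y)) y‖ₑ ^ 3 ≠ ∞ := by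
    intro z
    simp only [deriv_slice hV1, ← enorm_pow]
    refine Continuous.lintegral_enorm_ne_top (by fun_prop) ?_
    exact ((hVc.dirDeriv (0, 1)).slice z).comp_left (g := fun t => t ^ 3) (by simp)
  calc ∫⁻ p, ‖dirDeriv V (0, 1) p‖ₑ * (‖dirDeriv V (0, 1) p‖ₑ ^ 2) ^ q * ψ (V p)
      = ∫⁻ z, ∫⁻ y, ‖dirDeriv V (0, 1) (z, y)‖ₑ * (‖dirDeriv V (0, 1) (z, y)‖ₑ ^ 2) ^ q *
          ψ (V (z, y)) := by
        rw [Measure.volume_eq_prod, lintegral_prod]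
        exact ((hUm.mul ((hUm.pow_const 2).pow_const q)).mul
          (hψ.comp hV.continuous.measurable)).aemeasurable
    _ ≤ ∫⁻ z, ∫⁻ s, (liminf (fun k => sliceCrossing V k s z) atTop) ^ q * ψ s := by
        refine lintegral_mono fun z => ?_
        have := lintegral_crossing_le (contDiff_slice hV1 z) (hfin z) hq hψ
        simpa only [deriv_slice hV1, sliceCrossing] using this
    _ = ∫⁻ s, ∫⁻ z, (liminf (fun k => sliceCrossing V k s z) atTop) ^ q * ψ s := by
        refine lintegral_lintegral_swap ?_
        exact (((Measurable.liminf hGm).pow_const q).mul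
          (hψ.comp measurable_snd)).aemeasurable
    _ ≤ ∫⁻ s, c * 2 ^ q * (levelDensity volume V (sliceWeight V) s ^ q * ψ s) := by
        refine lintegral_mono_ae ((lintegral_liminf_sliceCrossing_le hV hVc (by linarith)
          hctop hsob).mono fun s hs => ?_)
        rw [lintegral_mul_const _ ((Measurable.liminf fun k => hGs k s).pow_const q), ← mul_assoc]
        gcongr
    _ = _ := by
        rw [lintegral_const_mul' _ _ (ENNReal.mul_ne_top hctop (by finiteness))]

end sliceLevels

section planeLevels

variable {V : (Fin 1 → ℝ) × ℝ → ℝ}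

lemma enorm_le_lintegral_enorm_fderiv {g : (Fin 1 → ℝ) → ℝ} (hg : ContDiff ℝ 1 g)
    (hc : HasCompactSupport g) (z : Fin 1 → ℝ) : ‖g z‖ₑ ≤ ∫⁻ z, ‖fderiv ℝ g z‖ₑ := by
  set L : ℝ ≃L[ℝ] (Fin 1 → ℝ) := (ContinuousLinearEquiv.funUnique (Fin 1) ℝ ℝ).symm with hL
  have hm : MeasurePreserving (⇑L) := (volume_preserving_funUnique (Fin 1) ℝ).symm
  have h1 := HasCompactSupport.enorm_le_lintegral_Ici_deriv (f := g ∘ L) (hg.comp L.contDiff)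
    (hc.comp_homeomorph L.toHomeomorph) (L.symm z)
  simp only [Function.comp_apply, L.apply_symm_apply] at h1
  refine h1.trans ((setLIntegral_le_lintegral _ _).trans ?_)
  rw [← hm.lintegral_comp (hg.continuous_fderiv (by norm_num)).enorm.measurable]
  refine lintegral_mono fun τ => ?_
  have h2 := ((hg.differentiable (by norm_num) (L τ)).hasFDerivAt.comp_hasDerivAt τ
    L.hasFDerivAt.hasDerivAt).deriv
  rw [h2]
  simp only [ContinuousLinearEquiv.coe_coe]
  have h3 := (fderiv ℝ g (L τ)).le_opNorm (L 1)
  have h4 : ‖L 1‖ = 1 := by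
    rw [Pi.norm_def]; simp [hL]
  rw [h4, mul_one] at h3
  rw [← ofReal_norm, ← ofReal_norm]
  exact ENNReal.ofReal_le_ofReal h3

/-- In the plane the vertical slope is pointwise controlled on almost every level. -/
lemma enorm_dirDeriv_sq_le (hV : ContDiff ℝ 2 V) (hVc : HasCompactSupport V) :
    ∀ᵐ s, ∀ p, V p = s →
      ‖dirDeriv V (0, 1) p‖ₑ ^ 2 ≤ 2 * levelDensity volume V (sliceWeight V) s := by
  have hV1 : ContDiff ℝ 1 V := hV.of_le (by norm_num)
  filter_upwards [levelDensity_tendsto (nullPreimages_sliceWeight hV) hV.continuous.measurable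
      (measurable_sliceWeight hV) (lintegral_sliceWeight_ne_top hV hVc)] with s hs
  rintro ⟨z, y⟩ rfl
  have h1 := enorm_deriv_sq_le_liminf (contDiff_slice hV1 z) y
  simp only [deriv_slice hV1] at h1
  refine h1.trans ?_
  rw [← (ENNReal.Tendsto.const_mul (a := 2) hs (Or.inr (by simp))).liminf_eq]
  refine liminf_le_liminf (Eventually.of_forall fun k => ?_)
  have hρ := contDiff_lineKernel_sub k (V (z, y))
  have hρ0 : ∀ σ, 0 ≤ lineKernel k (V (z, y) - σ) := fun σ => lineKernel_nonneg _ _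
  have h2 := enorm_le_lintegral_enorm_fderiv (contDiff_sliceMean hV hVc hρ)
    (hasCompactSupport_sliceMean hVc) z
  rw [enorm_sliceMean hV hVc hρ hρ0] at h2
  exact h2.trans (lintegral_enorm_fderiv_sliceMean_le hV hVc hρ hρ0)

end planeLevels

section geometry

variable {n : ℕ} {v : EuclideanSpace ℝ (Fin n) → ℝ}

/-- The partial derivative of `v` with respect to the coordinate `i`. -/
def partialDeriv (v : EuclideanSpace ℝ (Fin n) → ℝ) (i : Fin n) :
    EuclideanSpace ℝ (Fin n) → ℝ :=
  dirDeriv v (EuclideanSpace.single i 1)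

/-- The squared length of the gradient. -/
def gradSq (v : EuclideanSpace ℝ (Fin n) → ℝ) (x : EuclideanSpace ℝ (Fin n)) : ℝ :=
  ∑ i, partialDeriv v i x ^ 2

/-- The squared Hilbert–Schmidt norm of the Hessian. -/
def hessSq (v : EuclideanSpace ℝ (Fin n) → ℝ) (x : EuclideanSpace ℝ (Fin n)) : ℝ :=
  ∑ k, ∑ i, partialDeriv (partialDeriv v i) k x ^ 2

/-- The components of the Hessian applied to the gradient. -/
def hessGrad (v : EuclideanSpace ℝ (Fin n) → ℝ) (k : Fin n) (x : EuclideanSpace ℝ (Fin n)) : ℝ :=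
  ∑ i, partialDeriv v i x * partialDeriv (partialDeriv v i) k x

/-- The defect `|D²v|² - |∇|∇v||²`. -/
def katoDefect (v : EuclideanSpace ℝ (Fin n) → ℝ) (x : EuclideanSpace ℝ (Fin n)) : ℝ :=
  hessSq v x - (∑ k, hessGrad v k x ^ 2) / gradSq v x

lemma gradSq_nonneg (x) : 0 ≤ gradSq v x := Finset.sum_nonneg fun _ _ => sq_nonneg _

lemma hessSq_nonneg (x) : 0 ≤ hessSq v x :=
  Finset.sum_nonneg fun _ _ => Finset.sum_nonneg fun _ _ => sq_nonneg _

lemma sq_partialDeriv_le_gradSq (i : Fin n) (x) : partialDeriv v i x ^ 2 ≤ gradSq v x :=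
  Finset.single_le_sum (f := fun i => partialDeriv v i x ^ 2) (fun _ _ => sq_nonneg _)
    (Finset.mem_univ i)

lemma partialDeriv_eq_zero_of_gradSq_eq_zero {x} (h : gradSq v x = 0) (i : Fin n) :
    partialDeriv v i x = 0 := by
  have := sq_partialDeriv_le_gradSq (v := v) i x
  rw [h] at this
  exact pow_eq_zero_iff (two_ne_zero) |>.1 (le_antisymm this (sq_nonneg _))

lemma katoDefect_le_hessSq (x) : katoDefect v x ≤ hessSq v x := by
  have : 0 ≤ (∑ k, hessGrad v k x ^ 2) / gradSq v x :=
    div_nonneg (Finset.sum_nonneg fun _ _ => sq_nonneg _) (gradSq_nonneg x)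
  simp only [katoDefect]
  linarith

/-- A quantitative Cauchy–Schwarz inequality. -/
lemma sq_wedge_le {ι : Type*} [Fintype ι] (a b : ι → ℝ) (i j : ι) :
    (a j * b i - a i * b j) ^ 2 ≤ (∑ k, a k ^ 2) * (∑ k, b k ^ 2) - (∑ k, a k * b k) ^ 2 := by
  classical
  have h1 : ∑ k, ∑ l, (a k * b l - a l * b k) ^ 2 =
      2 * ((∑ k, a k ^ 2) * (∑ k, b k ^ 2) - (∑ k, a k * b k) ^ 2) := by
    have e1 : ∀ k l, (a k * b l - a l * b k) ^ 2 =
        a k ^ 2 * b l ^ 2 + b k ^ 2 * a l ^ 2 - 2 * ((a k * b k) * (a l * b l)) := by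
      intro k l; ring
    simp only [e1, Finset.sum_sub_distrib, Finset.sum_add_distrib, ← Finset.mul_sum,
      ← Finset.sum_mul]
    ring
  have h0 : ∀ k l, 0 ≤ (a k * b l - a l * b k) ^ 2 := fun k l => sq_nonneg _
  by_cases hij : i = j
  · subst hij
    have : 0 ≤ ∑ k, ∑ l, (a k * b l - a l * b k) ^ 2 :=
      Finset.sum_nonneg fun k _ => Finset.sum_nonneg fun l _ => h0 k l
    rw [h1] at this
    rw [sub_self, zero_pow two_ne_zero]
    linarith
  · have h2 : (∑ l, (a i * b l - a l * b i) ^ 2) + (∑ l, (a j * b l - a l * b j) ^ 2) ≤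
        ∑ k, ∑ l, (a k * b l - a l * b k) ^ 2 := by
      rw [← Finset.sum_pair (f := fun k => ∑ l, (a k * b l - a l * b k) ^ 2) hij]
      exact Finset.sum_le_sum_of_subset_of_nonneg (Finset.subset_univ _)
        fun k _ _ => Finset.sum_nonneg fun l _ => h0 k l
    have h3 := Finset.single_le_sum (f := fun l => (a i * b l - a l * b i) ^ 2)
      (fun l _ => h0 i l) (Finset.mem_univ j)
    have h4 := Finset.single_le_sum (f := fun l => (a j * b l - a l * b j) ^ 2)
      (fun l _ => h0 j l) (Finset.mem_univ i)
    nlinarith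

lemma gradSq_mul_katoDefect (x) : gradSq v x * katoDefect v x =
    gradSq v x * hessSq v x - ∑ k, hessGrad v k x ^ 2 := by
  by_cases h : gradSq v x = 0
  · simp [h, hessGrad, partialDeriv_eq_zero_of_gradSq_eq_zero h]
  · rw [katoDefect]; field_simp

lemma sum_wedge_eq (x) : gradSq v x * katoDefect v x =
    ∑ k, ((∑ i, partialDeriv v i x ^ 2) * (∑ i, partialDeriv (partialDeriv v i) k x ^ 2) -
      (∑ i, partialDeriv v i x * partialDeriv (partialDeriv v i) k x) ^ 2) := by
  rw [gradSq_mul_katoDefect, Finset.sum_sub_distrib, ← Finset.mul_sum]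
  rfl

lemma sq_wedge_le_gradSq_mul_katoDefect (i j : Fin n) (x) :
    (partialDeriv v j x * partialDeriv (partialDeriv v i) j x -
      partialDeriv v i x * partialDeriv (partialDeriv v j) j x) ^ 2 ≤
      gradSq v x * katoDefect v x := by
  rw [sum_wedge_eq]
  have h := fun k => sq_wedge_le (fun i => partialDeriv v i x)
    (fun i => partialDeriv (partialDeriv v i) k x)
  refine (h j i j).trans (Finset.single_le_sum (f := fun k =>
    ((∑ i, partialDeriv v i x ^ 2) * (∑ i, partialDeriv (partialDeriv v i) k x ^ 2) -
      (∑ i, partialDeriv v i x * partialDeriv (partialDeriv v i) k x) ^ 2))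
    (fun k _ => ?_) (Finset.mem_univ j))
  exact (sq_nonneg _).trans (h k i j)

lemma katoDefect_nonneg (x) : 0 ≤ katoDefect v x := by
  by_cases h : gradSq v x = 0
  · simp [katoDefect, h, hessSq_nonneg]
  · have h1 : 0 ≤ gradSq v x * katoDefect v x := by
      rw [sum_wedge_eq]
      refine Finset.sum_nonneg fun k _ => ?_
      have := Finset.sum_mul_sq_le_sq_mul_sq Finset.univ (fun i => partialDeriv v i x)
        (fun i => partialDeriv (partialDeriv v i) k x)
      linarith
    exact nonneg_of_mul_nonneg_right h1 (lt_of_le_of_ne (gradSq_nonneg x) (Ne.symm h))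

lemma ContDiff.partialDeriv {m k : WithTop ℕ∞} (hv : ContDiff ℝ k v) (hmn : m + 1 ≤ k)
    (i : Fin n) : ContDiff ℝ m (partialDeriv v i) :=
  hv.dirDeriv hmn _

lemma ContDiff.continuous_partialDeriv (hv : ContDiff ℝ 1 v) (i : Fin n) :
    Continuous (_root_.partialDeriv v i) :=
  hv.continuous_dirDeriv _

lemma ContDiff.continuous_partialDeriv_partialDeriv (hv : ContDiff ℝ 2 v) (i k : Fin n) :
    Continuous (_root_.partialDeriv (_root_.partialDeriv v i) k) :=
  (hv.partialDeriv (m := 1) (by norm_num) i).continuous_partialDeriv k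

lemma continuous_gradSq (hv : ContDiff ℝ 1 v) : Continuous (gradSq v) :=
  continuous_finsetSum _ fun i _ => (hv.continuous_partialDeriv i).pow 2

lemma continuous_hessSq (hv : ContDiff ℝ 2 v) : Continuous (hessSq v) :=
  continuous_finsetSum _ fun k _ => continuous_finsetSum _ fun i _ =>
    (hv.continuous_partialDeriv_partialDeriv i k).pow 2

lemma continuous_hessGrad (hv : ContDiff ℝ 2 v) (k : Fin n) : Continuous (hessGrad v k) :=
  continuous_finsetSum _ fun i _ =>
    ((hv.of_le (by norm_num)).continuous_partialDeriv i).mul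
      (hv.continuous_partialDeriv_partialDeriv i k)

lemma measurable_katoDefect (hv : ContDiff ℝ 2 v) : Measurable (katoDefect v) :=
  (continuous_hessSq hv).measurable.sub (Measurable.div
    (Finset.measurable_fun_sum _ fun k _ => (continuous_hessGrad hv k).measurable.pow_const 2)
    (continuous_gradSq (hv.of_le (by norm_num))).measurable)

lemma partialDeriv_eq_zero_of_notMem_tsupport {x} (hx : x ∉ tsupport v) (i : Fin n) :
    partialDeriv v i x = 0 := by
  have : fderiv ℝ v x = 0 := by
    by_contra hne
    exact hx (support_fderiv_subset ℝ hne)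
  simp [partialDeriv, dirDeriv, this]

lemma tsupport_partialDeriv_subset (i : Fin n) : tsupport (partialDeriv v i) ⊆ tsupport v := by
  refine closure_minimal (fun x hx => ?_) (isClosed_tsupport v)
  by_contra h
  exact hx (partialDeriv_eq_zero_of_notMem_tsupport h i)

lemma gradSq_eq_zero_of_notMem_tsupport {x} (hx : x ∉ tsupport v) : gradSq v x = 0 := by
  simp [gradSq, partialDeriv_eq_zero_of_notMem_tsupport hx]

lemma hasCompactSupport_gradSq (hc : HasCompactSupport v) : HasCompactSupport (gradSq v) :=
  HasCompactSupport.intro hc fun _ hx => gradSq_eq_zero_of_notMem_tsupport hx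

lemma hasCompactSupport_hessSq (hc : HasCompactSupport v) : HasCompactSupport (hessSq v) :=
  HasCompactSupport.intro hc fun x hx => by
    simp [hessSq, partialDeriv_eq_zero_of_notMem_tsupport
      (fun h => hx (tsupport_partialDeriv_subset _ h))]

end geometry

section sliceEquiv

variable {m : ℕ}

/-- The linear coordinates on Euclidean space which single out the coordinate `j`. -/
def sliceEquiv (j : Fin (m + 1)) : ((Fin m → ℝ) × ℝ) ≃L[ℝ] EuclideanSpace ℝ (Fin (m + 1)) :=
  LinearEquiv.toContinuousLinearEquiv
    { toFun := fun p => WithLp.toLp 2 (j.insertNth p.2 p.1)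
      invFun := fun x => (fun i => x (j.succAbove i), x j)
      map_add' := fun p q => by
        ext i
        refine j.succAboveCases ?_ (fun i => ?_) i <;> simp
      map_smul' := fun c p => by
        ext i
        refine j.succAboveCases ?_ (fun i => ?_) i <;> simp
      left_inv := fun p => by ext <;> simp
      right_inv := fun x => by
        ext i
        refine j.succAboveCases ?_ (fun i => ?_) i <;> simp }

lemma sliceEquiv_apply (j : Fin (m + 1)) (p : (Fin m → ℝ) × ℝ) :
    sliceEquiv j p = WithLp.toLp 2 (j.insertNth p.2 p.1) := rfl

lemma sliceEquiv_zero_one (j : Fin (m + 1)) :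
    sliceEquiv j (0, 1) = EuclideanSpace.single j 1 := by
  ext i
  refine j.succAboveCases ?_ (fun i => ?_) i <;> simp [sliceEquiv_apply]

lemma sliceEquiv_single_zero (j : Fin (m + 1)) (i : Fin m) :
    sliceEquiv j (Pi.single i 1, 0) = EuclideanSpace.single (j.succAbove i) 1 := by
  ext k
  refine j.succAboveCases ?_ (fun k => ?_) k
  · simp [sliceEquiv_apply]
  · by_cases h : k = i
    · subst h; simp [sliceEquiv_apply]
    · simp [sliceEquiv_apply, h]

lemma measurePreserving_sliceEquiv (j : Fin (m + 1)) :
    MeasurePreserving (sliceEquiv j) volume volume := by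
  have h1 := (volume_preserving_piFinSuccAbove (fun _ : Fin (m + 1) => ℝ) j).symm
  have h2 : MeasurePreserving (Prod.swap : (Fin m → ℝ) × ℝ → ℝ × (Fin m → ℝ)) volume volume :=
    Measure.measurePreserving_swap
  have h3 := PiLp.volume_preserving_toLp (Fin (m + 1))
  exact h3.comp (h1.comp h2)

lemma lintegral_comp_sliceEquiv (j : Fin (m + 1)) (g : EuclideanSpace ℝ (Fin (m + 1)) → ℝ≥0∞) :
    ∫⁻ p, g (sliceEquiv j p) = ∫⁻ x, g x :=
  (measurePreserving_sliceEquiv j).lintegral_comp_emb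
    (sliceEquiv j).toHomeomorph.measurableEmbedding g

lemma dirDeriv_comp_sliceEquiv {v : EuclideanSpace ℝ (Fin (m + 1)) → ℝ} (hv : Differentiable ℝ v)
    (j : Fin (m + 1)) (e) :
    dirDeriv (v ∘ sliceEquiv j) e = dirDeriv v (sliceEquiv j e) ∘ sliceEquiv j := by
  ext p
  simp only [dirDeriv, Function.comp]
  have := ((hv (sliceEquiv j p)).hasFDerivAt.comp p (sliceEquiv j).hasFDerivAt).fderiv
  rw [this]
  simp

lemma dirDeriv_comp_sliceEquiv_normal {v : EuclideanSpace ℝ (Fin (m + 1)) → ℝ}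
    (hv : Differentiable ℝ v) (j : Fin (m + 1)) :
    dirDeriv (v ∘ sliceEquiv j) (0, 1) = partialDeriv v j ∘ sliceEquiv j := by
  rw [dirDeriv_comp_sliceEquiv hv, sliceEquiv_zero_one]; rfl

lemma dirDeriv_comp_sliceEquiv_tangent {v : EuclideanSpace ℝ (Fin (m + 1)) → ℝ}
    (hv : Differentiable ℝ v) (j : Fin (m + 1)) (i : Fin m) :
    dirDeriv (v ∘ sliceEquiv j) (Pi.single i 1, 0) =
      partialDeriv v (j.succAbove i) ∘ sliceEquiv j := by
  rw [dirDeriv_comp_sliceEquiv hv, sliceEquiv_single_zero]; rfl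

lemma partialDeriv_comm {n : ℕ} {v : EuclideanSpace ℝ (Fin n) → ℝ} (hv : ContDiff ℝ 2 v)
    (i j : Fin n) (x) :
    partialDeriv (partialDeriv v i) j x = partialDeriv (partialDeriv v j) i x :=
  dirDeriv_comm hv _ _ x

end sliceEquiv

section levelWeights

variable {n : ℕ}

/-- The density of the quartic energy. -/
def energyWeight (v : EuclideanSpace ℝ (Fin n) → ℝ) (x : EuclideanSpace ℝ (Fin n)) : ℝ≥0∞ :=
  ENNReal.ofReal (gradSq v x ^ 2)

/-- The density of the curvature term, restricted to the regular points. -/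
def curvWeight (v : EuclideanSpace ℝ (Fin n) → ℝ) (x : EuclideanSpace ℝ (Fin n)) : ℝ≥0∞ :=
  ENNReal.ofReal (if gradSq v x = 0 then 0 else katoDefect v x)

/-- The density of the regular points. -/
def regularWeight (v : EuclideanSpace ℝ (Fin n) → ℝ) (x : EuclideanSpace ℝ (Fin n)) : ℝ≥0∞ :=
  if gradSq v x = 0 then 0 else 1

/-- The geometric mean of the energy and curvature densities. -/
def mixedWeight (v : EuclideanSpace ℝ (Fin n) → ℝ) (x : EuclideanSpace ℝ (Fin n)) : ℝ≥0∞ :=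
  energyWeight v x ^ (1 / 2 : ℝ) * curvWeight v x ^ (1 / 2 : ℝ)

variable {v : EuclideanSpace ℝ (Fin n) → ℝ}

lemma measurable_energyWeight (hv : ContDiff ℝ 2 v) : Measurable (energyWeight v) :=
  ENNReal.measurable_ofReal.comp ((continuous_gradSq (hv.of_le (by norm_num))).measurable.pow_const 2)

lemma measurableSet_gradSq_eq_zero (hv : ContDiff ℝ 2 v) : MeasurableSet {x | gradSq v x = 0} :=
  (continuous_gradSq (hv.of_le (by norm_num))).measurable (measurableSet_singleton 0)

lemma measurable_curvWeight (hv : ContDiff ℝ 2 v) : Measurable (curvWeight v) :=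
  ENNReal.measurable_ofReal.comp
    (Measurable.ite (measurableSet_gradSq_eq_zero hv) measurable_const (measurable_katoDefect hv))

lemma measurable_regularWeight (hv : ContDiff ℝ 2 v) : Measurable (regularWeight v) :=
  Measurable.ite (measurableSet_gradSq_eq_zero hv) measurable_const measurable_const

lemma measurable_mixedWeight (hv : ContDiff ℝ 2 v) : Measurable (mixedWeight v) :=
  ((measurable_energyWeight hv).pow_const _).mul ((measurable_curvWeight hv).pow_const _)

lemma lintegral_energyWeight_ne_top (hv : ContDiff ℝ 2 v) (hc : HasCompactSupport v) :
    ∫⁻ x, energyWeight v x ≠ ∞ := by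
  have h := Continuous.lintegral_enorm_ne_top (μ := volume)
    (f := fun x => gradSq v x ^ 2) ((continuous_gradSq (hv.of_le (by norm_num))).pow 2)
    ((hasCompactSupport_gradSq hc).comp_left (g := fun s : ℝ => s ^ 2) (by norm_num))
  refine ne_top_of_le_ne_top h (lintegral_mono fun x => ?_)
  rw [Real.enorm_eq_ofReal (sq_nonneg _), energyWeight]

lemma curvWeight_le (x) : curvWeight v x ≤ ‖hessSq v x‖ₑ := by
  rw [Real.enorm_eq_ofReal (hessSq_nonneg x), curvWeight]
  refine ENNReal.ofReal_le_ofReal ?_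
  split_ifs
  · exact hessSq_nonneg x
  · exact katoDefect_le_hessSq x

lemma lintegral_curvWeight_ne_top (hv : ContDiff ℝ 2 v) (hc : HasCompactSupport v) :
    ∫⁻ x, curvWeight v x ≠ ∞ :=
  ne_top_of_le_ne_top (Continuous.lintegral_enorm_ne_top (continuous_hessSq hv)
    (hasCompactSupport_hessSq hc)) (lintegral_mono curvWeight_le)

lemma lintegral_regularWeight_eq (hv : ContDiff ℝ 2 v) :
    ∫⁻ x, regularWeight v x = volume {x | gradSq v x ≠ 0} := by
  rw [← lintegral_indicator_one
    (s := {x | gradSq v x ≠ 0}) (measurableSet_gradSq_eq_zero hv).compl]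
  refine lintegral_congr fun x => ?_
  by_cases h : gradSq v x = 0 <;> simp [regularWeight, h]

lemma lintegral_regularWeight_ne_top (hv : ContDiff ℝ 2 v) (hc : HasCompactSupport v) :
    ∫⁻ x, regularWeight v x ≠ ∞ := by
  rw [lintegral_regularWeight_eq hv]
  refine ne_top_of_le_ne_top hc.isCompact.measure_lt_top.ne (measure_mono fun x hx => ?_)
  by_contra h
  exact hx (gradSq_eq_zero_of_notMem_tsupport h)

lemma lintegral_mixedWeight_ne_top (hv : ContDiff ℝ 2 v) (hc : HasCompactSupport v) :
    ∫⁻ x, mixedWeight v x ≠ ∞ := by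
  have h := ENNReal.lintegral_mul_norm_pow_le (measurable_energyWeight hv).aemeasurable
    (measurable_curvWeight hv).aemeasurable (p := 1 / 2) (q := 1 / 2) (μ := volume)
    (by norm_num) (by norm_num) (by norm_num)
  refine ne_top_of_le_ne_top (ENNReal.mul_ne_top ?_ ?_) h
  · exact ENNReal.rpow_ne_top_of_nonneg (by norm_num) (lintegral_energyWeight_ne_top hv hc)
  · exact ENNReal.rpow_ne_top_of_nonneg (by norm_num) (lintegral_curvWeight_ne_top hv hc)

lemma enorm_partialDeriv_eq_zero_of_gradSq_eq_zero {x} (h : gradSq v x = 0) (i : Fin n) :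
    ‖partialDeriv v i x‖ₑ = 0 := by
  simp [partialDeriv_eq_zero_of_gradSq_eq_zero h i]

lemma energyWeight_le (x) : energyWeight v x ≤ n * ∑ i, ‖partialDeriv v i x‖ₑ ^ 4 := by
  have h : gradSq v x ^ 2 ≤ n * ∑ i, |partialDeriv v i x| ^ 4 := by
    have := sq_sum_le_card_mul_sum_sq (s := Finset.univ) (f := fun i => partialDeriv v i x ^ 2)
    simp only [Finset.card_univ, Fintype.card_fin] at this
    refine this.trans (le_of_eq ?_)
    congr 1
    refine Finset.sum_congr rfl fun i _ => ?_
    rw [← pow_mul, Even.pow_abs (by decide)]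
  rw [energyWeight]
  refine (ENNReal.ofReal_le_ofReal h).trans (le_of_eq ?_)
  rw [ENNReal.ofReal_mul (by positivity), ENNReal.ofReal_natCast,
    ENNReal.ofReal_sum_of_nonneg (fun _ _ => by positivity)]
  congr 1
  refine Finset.sum_congr rfl fun i _ => ?_
  rw [ENNReal.ofReal_pow (abs_nonneg _), ← Real.norm_eq_abs, ofReal_norm]

end levelWeights

section comparison

variable {α β : Type*} [MeasurableSpace α] [MeasurableSpace β] {μ : Measure α} {ν : Measure β}

lemma levelDensity_le_const_mul {v : α → ℝ} {a : α → ℝ≥0∞} {w : β → ℝ} {b : β → ℝ≥0∞}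
    (ha0 : NullPreimages μ v a) (hv : Measurable v) (ha : Measurable a)
    (hfa : ∫⁻ x, a x ∂μ ≠ ∞) (hb0 : NullPreimages ν w b) (hw : Measurable w) (hb : Measurable b)
    (hfb : ∫⁻ x, b x ∂ν ≠ ∞) {c : ℝ≥0∞} (hc : c ≠ ∞)
    (h : ∀ k : ℝ → ℝ≥0∞, Measurable k → ∫⁻ x, a x * k (v x) ∂μ ≤ c * ∫⁻ x, b x * k (w x) ∂ν) :
    ∀ᵐ s, levelDensity μ v a s ≤ c * levelDensity ν w b s := by
  filter_upwards [levelDensity_tendsto ha0 hv ha hfa, levelDensity_tendsto hb0 hw hb hfb]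
    with s h1 h2
  refine le_of_tendsto_of_tendsto' h1 (ENNReal.Tendsto.const_mul h2 (Or.inr hc)) fun k => ?_
  exact h (fun σ => ENNReal.ofReal (lineKernel k (s - σ)))
    (ENNReal.measurable_ofReal.comp
      ((continuous_lineKernel k).comp (continuous_const.sub continuous_id)).measurable)

lemma levelDensity_le_of_forall_lintegral_le {v : α → ℝ} {a : α → ℝ≥0∞}
    (ha0 : NullPreimages μ v a) (hv : Measurable v) (ha : Measurable a)
    (hfa : ∫⁻ x, a x ∂μ ≠ ∞) {G : ℝ → ℝ≥0∞}
    (h : ∀ ψ : ℝ → ℝ≥0∞, Measurable ψ → ∫⁻ x, a x * ψ (v x) ∂μ ≤ ∫⁻ s, G s * ψ s) :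
    ∀ᵐ s, levelDensity μ v a s ≤ G s := by
  refine ae_le_of_forall_setLIntegral_le_of_sigmaFinite measurable_levelDensity fun S hS _ => ?_
  have := h (S.indicator 1) (measurable_one.indicator hS)
  rw [← lintegral_levelDensity_mul ha0 hv ha hfa (measurable_one.indicator hS)] at this
  rw [← lintegral_indicator hS, ← lintegral_indicator hS]
  refine le_trans (le_of_eq ?_) (this.trans (le_of_eq ?_)) <;>
  · refine lintegral_congr fun s => ?_
    by_cases hs : s ∈ S <;> simp [hs]

end comparison

section nullPreimages

variable {m : ℕ} {v : EuclideanSpace ℝ (Fin (m + 1)) → ℝ}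

lemma nullPreimages_partialDeriv (hv : ContDiff ℝ 1 v) (j : Fin (m + 1)) :
    NullPreimages volume v fun x => ‖partialDeriv v j x‖ₑ := by
  intro N hN hN0
  have h := nullPreimages_dirDeriv_slice (V := v ∘ sliceEquiv j)
    (hv.comp (sliceEquiv j).contDiff) N hN hN0
  rw [dirDeriv_comp_sliceEquiv_normal (hv.differentiable one_ne_zero)] at h
  rw [← (measurePreserving_sliceEquiv j).setLIntegral_comp_preimage_emb
    (sliceEquiv j).toHomeomorph.measurableEmbedding]
  exact h

lemma nullPreimages_energyWeight (hv : ContDiff ℝ 2 v) :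
    NullPreimages volume v (energyWeight v) := by
  have hv1 : ContDiff ℝ 1 v := hv.of_le (by norm_num)
  have hm : ∀ i, Measurable fun x => ‖partialDeriv v i x‖ₑ := fun i =>
    (hv1.continuous_partialDeriv i).measurable.enorm
  intro N hN hN0
  refine le_antisymm ?_ zero_le
  calc ∫⁻ x in v ⁻¹' N, energyWeight v x
      ≤ ∫⁻ x in v ⁻¹' N, ((m + 1 : ℕ) : ℝ≥0∞) * ∑ i, ‖partialDeriv v i x‖ₑ ^ 4 :=
        lintegral_mono fun x => energyWeight_le x
    _ = ((m + 1 : ℕ) : ℝ≥0∞) * ∑ i, ∫⁻ x in v ⁻¹' N, ‖partialDeriv v i x‖ₑ ^ 4 := by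
        rw [lintegral_const_mul _ (Finset.measurable_fun_sum _ fun i _ => (hm i).pow_const 4),
          lintegral_finsetSum _ fun i _ => (hm i).pow_const 4]
    _ = 0 := by
        rw [Finset.sum_eq_zero, mul_zero]
        intro i _
        exact ((nullPreimages_partialDeriv hv1 i).mono (fun x hx => by simp [hx]) (hm i)
          ((hm i).pow_const 4)) N hN hN0

lemma gradSq_eq_zero_of_energyWeight_eq_zero {x} (h : energyWeight v x = 0) : gradSq v x = 0 := by
  rw [energyWeight, ENNReal.ofReal_eq_zero] at h
  exact pow_eq_zero_iff two_ne_zero |>.1 (le_antisymm h (sq_nonneg _))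

lemma nullPreimages_of_gradSq (hv : ContDiff ℝ 2 v) {b : EuclideanSpace ℝ (Fin (m + 1)) → ℝ≥0∞}
    (hb : Measurable b) (h : ∀ x, gradSq v x = 0 → b x = 0) : NullPreimages volume v b :=
  (nullPreimages_energyWeight hv).mono
    (fun x hx => h x (gradSq_eq_zero_of_energyWeight_eq_zero hx)) (measurable_energyWeight hv) hb

lemma nullPreimages_curvWeight (hv : ContDiff ℝ 2 v) : NullPreimages volume v (curvWeight v) :=
  nullPreimages_of_gradSq hv (measurable_curvWeight hv) fun x hx => by simp [curvWeight, hx]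

lemma nullPreimages_regularWeight (hv : ContDiff ℝ 2 v) :
    NullPreimages volume v (regularWeight v) :=
  nullPreimages_of_gradSq hv (measurable_regularWeight hv) fun x hx => by simp [regularWeight, hx]

lemma nullPreimages_mixedWeight (hv : ContDiff ℝ 2 v) : NullPreimages volume v (mixedWeight v) :=
  nullPreimages_of_gradSq hv (measurable_mixedWeight hv) fun x hx => by
    simp [mixedWeight, energyWeight, hx]

lemma levelDensity_mixedWeight_le (hv : ContDiff ℝ 2 v) (hc : HasCompactSupport v) :
    ∀ᵐ s, levelDensity volume v (mixedWeight v) s ≤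
      levelDensity volume v (energyWeight v) s ^ (1 / 2 : ℝ) *
        levelDensity volume v (curvWeight v) s ^ (1 / 2 : ℝ) :=
  levelDensity_holder (nullPreimages_energyWeight hv) (nullPreimages_curvWeight hv)
    hv.continuous.measurable (measurable_energyWeight hv) (measurable_curvWeight hv)
    (lintegral_energyWeight_ne_top hv hc) (lintegral_curvWeight_ne_top hv hc)
    (measurable_mixedWeight hv) (by norm_num) (by norm_num) (by norm_num) fun x => le_rfl

end nullPreimages

section sliceComparison

variable {m : ℕ} {v : EuclideanSpace ℝ (Fin (m + 1)) → ℝ}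

lemma enorm_le_mixedWeight {n : ℕ} {v : EuclideanSpace ℝ (Fin n) → ℝ} (i j : Fin n) (x) :
    ‖|partialDeriv v j x| * (partialDeriv v j x * partialDeriv (partialDeriv v i) j x -
      partialDeriv v i x * partialDeriv (partialDeriv v j) j x)‖ₑ ≤ mixedWeight v x := by
  by_cases h : gradSq v x = 0
  · simp [partialDeriv_eq_zero_of_gradSq_eq_zero h]
  set X := |partialDeriv v j x| * (partialDeriv v j x * partialDeriv (partialDeriv v i) j x -
      partialDeriv v i x * partialDeriv (partialDeriv v j) j x) with hX
  have h1 : X ^ 2 ≤ gradSq v x ^ 2 * katoDefect v x := by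
    rw [hX, mul_pow, sq_abs, sq (gradSq v x), mul_assoc]
    exact mul_le_mul (sq_partialDeriv_le_gradSq j x) (sq_wedge_le_gradSq_mul_katoDefect i j x)
      (sq_nonneg _) (gradSq_nonneg x)
  have h2 : ‖X‖ₑ = (‖X‖ₑ ^ (2 : ℝ)) ^ (1 / 2 : ℝ) := by
    rw [← ENNReal.rpow_mul]; norm_num
  rw [h2, mixedWeight, ← ENNReal.mul_rpow_of_nonneg _ _ (by norm_num)]
  refine ENNReal.rpow_le_rpow ?_ (by norm_num)
  rw [energyWeight, curvWeight, if_neg h, ← ENNReal.ofReal_mul (sq_nonneg _), ENNReal.rpow_two,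
    Real.enorm_eq_ofReal_abs, ← ENNReal.ofReal_pow (abs_nonneg _), sq_abs]
  exact ENNReal.ofReal_le_ofReal h1

lemma sliceWeight_le (hv : ContDiff ℝ 2 v) (j : Fin (m + 1)) (p) :
    sliceWeight (v ∘ sliceEquiv j) p ≤ m * mixedWeight v (sliceEquiv j p) := by
  have hd : Differentiable ℝ v := hv.differentiable two_ne_zero
  have hd' : Differentiable ℝ (partialDeriv v j) :=
    (hv.partialDeriv (m := 1) (by norm_num) j).differentiable one_ne_zero
  refine (Finset.sum_le_card_nsmul Finset.univ _ (mixedWeight v (sliceEquiv j p))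
    fun i _ => ?_).trans (by simp)
  rw [dirDeriv_comp_sliceEquiv_normal hd, dirDeriv_comp_sliceEquiv_tangent hd,
    dirDeriv_comp_sliceEquiv_normal hd', dirDeriv_comp_sliceEquiv_tangent hd']
  simp only [Function.comp]
  rw [partialDeriv_comm hv j]
  exact enorm_le_mixedWeight _ _ _

lemma hasCompactSupport_comp_sliceEquiv (hc : HasCompactSupport v) (j : Fin (m + 1)) :
    HasCompactSupport (v ∘ sliceEquiv j) :=
  hc.comp_homeomorph (sliceEquiv j).toHomeomorph

lemma levelDensity_sliceWeight_le (hv : ContDiff ℝ 2 v) (hc : HasCompactSupport v)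
    (j : Fin (m + 1)) :
    ∀ᵐ s, levelDensity volume (v ∘ sliceEquiv j) (sliceWeight (v ∘ sliceEquiv j)) s ≤
      m * levelDensity volume v (mixedWeight v) s := by
  have hV : ContDiff ℝ 2 (v ∘ sliceEquiv j) := hv.comp (sliceEquiv j).contDiff
  have hVc := hasCompactSupport_comp_sliceEquiv hc j
  refine levelDensity_le_const_mul (nullPreimages_sliceWeight hV) hV.continuous.measurable
    (measurable_sliceWeight hV) (lintegral_sliceWeight_ne_top hV hVc)
    (nullPreimages_mixedWeight hv) hv.continuous.measurable (measurable_mixedWeight hv)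
    (lintegral_mixedWeight_ne_top hv hc) (by simp) fun k hk => ?_
  rw [← lintegral_const_mul' _ _ (ENNReal.natCast_ne_top m), ← lintegral_comp_sliceEquiv j]
  refine lintegral_mono fun p => ?_
  rw [← mul_assoc]
  exact mul_le_mul_left (sliceWeight_le hv j p) _

lemma lintegral_enorm_partialDeriv_ne_top (hv : ContDiff ℝ 1 v) (hc : HasCompactSupport v)
    (j : Fin (m + 1)) {r : ℝ} (hr : 0 < r) : ∫⁻ x, ‖partialDeriv v j x‖ₑ ^ r ≠ ∞ := by
  have hcont := hv.continuous_partialDeriv j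
  have h := Continuous.lintegral_enorm_ne_top (μ := volume)
    (f := fun x => ‖partialDeriv v j x‖ ^ r) (hcont.norm.rpow_const fun _ => Or.inr hr.le)
    (HasCompactSupport.intro hc fun x hx => by
      simp [partialDeriv_eq_zero_of_notMem_tsupport hx, Real.zero_rpow hr.ne'])
  refine ne_top_of_le_ne_top h (lintegral_mono fun x => le_of_eq ?_)
  rw [Real.enorm_rpow_of_nonneg (norm_nonneg _) hr.le, enorm_norm]

/-- The codimension one Sobolev inequality bounds the level densities of the partial
derivatives. -/
lemma levelDensity_partialDeriv_le {q : ℝ} (hq : Real.HolderConjugate m q) :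
    ∃ C : ℝ≥0∞, C ≠ ∞ ∧ ∀ v : EuclideanSpace ℝ (Fin (m + 1)) → ℝ, ContDiff ℝ 2 v →
      HasCompactSupport v → ∀ j, ∀ᵐ s,
        levelDensity volume v (fun x => ‖partialDeriv v j x‖ₑ ^ (1 + 2 * q)) s ≤
          C * levelDensity volume v (mixedWeight v) s ^ q := by
  have hq0 : 0 ≤ q := hq.symm.pos.le
  set c : ℝ≥0∞ :=
    ((lintegralPowLePowLIntegralFDerivConst (volume : Measure (Fin m → ℝ)) q : NNReal) : ℝ≥0∞)
  have hctop : c ≠ ∞ := ENNReal.coe_ne_top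
  refine ⟨c * 2 ^ q * (m : ℝ≥0∞) ^ q, ?_, fun v hv hc j => ?_⟩
  · refine ENNReal.mul_ne_top (ENNReal.mul_ne_top hctop ?_) ?_ <;>
      exact ENNReal.rpow_ne_top_of_nonneg hq0 (by simp)
  have hV : ContDiff ℝ 2 (v ∘ sliceEquiv j) := hv.comp (sliceEquiv j).contDiff
  have hVc := hasCompactSupport_comp_sliceEquiv hc j
  have hv1 : ContDiff ℝ 1 v := hv.of_le (by norm_num)
  have hm : Measurable fun x => ‖partialDeriv v j x‖ₑ :=
    (hv1.continuous_partialDeriv j).measurable.enorm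
  refine levelDensity_le_of_forall_lintegral_le ((nullPreimages_partialDeriv hv1 j).mono
    (fun x hx => by rw [hx, ENNReal.zero_rpow_of_pos (by linarith)]) hm (hm.pow_const _))
    hv.continuous.measurable (hm.pow_const _)
    (lintegral_enorm_partialDeriv_ne_top hv1 hc j (by linarith)) fun ψ hψ => ?_
  have key := lintegral_slice_crossing_le hV hVc hq.symm.lt.le hctop (fun g hg hgc =>
    lintegral_pow_le_pow_lintegral_fderiv volume hg hgc (by simpa using hq)) hψ
  rw [dirDeriv_comp_sliceEquiv_normal (hv1.differentiable one_ne_zero)] at key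
  rw [← lintegral_comp_sliceEquiv j]
  calc ∫⁻ p, ‖partialDeriv v j (sliceEquiv j p)‖ₑ ^ (1 + 2 * q) * ψ (v (sliceEquiv j p))
      = _ := ?_
    _ ≤ _ := key
    _ ≤ _ := ?_
  · refine lintegral_congr fun p => ?_
    simp only [Function.comp]
    congr 1
    rw [ENNReal.rpow_add_of_nonneg _ _ zero_le_one (by linarith), ENNReal.rpow_mul,
      ENNReal.rpow_one, ENNReal.rpow_two]
  · rw [← lintegral_const_mul' _ _ (ENNReal.mul_ne_top hctop
      (ENNReal.rpow_ne_top_of_nonneg hq0 (by simp)))]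
    refine lintegral_mono_ae ?_
    filter_upwards [levelDensity_sliceWeight_le hv hc j] with s hs
    rw [mul_assoc (c * 2 ^ q) ((m : ℝ≥0∞) ^ q), ← ENNReal.mul_rpow_of_nonneg _ _ hq0,
      mul_assoc (c * 2 ^ q) (_ ^ q)]
    gcongr

end sliceComparison

section levelInequality

lemma NullPreimages.ae_of_ae {α : Type*} [MeasurableSpace α] {μ : Measure α} {v : α → ℝ}
    {a : α → ℝ≥0∞} (h : NullPreimages μ v a) (hv : Measurable v) (ha : Measurable a)
    {P : ℝ → Prop} (hP : ∀ᵐ s, P s) : ∀ᵐ x ∂μ, a x ≠ 0 → P (v x) := by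
  have h1 := h (toMeasurable volume {s | ¬ P s}) (measurableSet_toMeasurable _ _)
    (by rw [measure_toMeasurable]; exact hP)
  rw [lintegral_eq_zero_iff ha, EventuallyEq,
    ae_restrict_iff' (hv (measurableSet_toMeasurable _ _))] at h1
  filter_upwards [h1] with x hx hax
  by_contra hPx
  exact hax (hx (subset_toMeasurable volume {s | ¬ P s} hPx))

variable {m : ℕ} {v : EuclideanSpace ℝ (Fin (m + 1)) → ℝ}

lemma levelDensity_energyWeight_le_of_partialDeriv {G : ℝ → ℝ≥0∞} (hv : ContDiff ℝ 2 v)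
    (hc : HasCompactSupport v)
    (h : ∀ j, ∀ᵐ s, levelDensity volume v (fun x => ‖partialDeriv v j x‖ₑ ^ (4 : ℝ)) s ≤ G s) :
    ∀ᵐ s, levelDensity volume v (energyWeight v) s ≤ ((m + 1 : ℕ) : ℝ≥0∞) ^ 2 * G s := by
  have hv1 : ContDiff ℝ 1 v := hv.of_le (by norm_num)
  have hm : ∀ j, Measurable fun x => ‖partialDeriv v j x‖ₑ ^ (4 : ℝ) := fun j =>
    (hv1.continuous_partialDeriv j).measurable.enorm.pow_const _
  refine levelDensity_le_of_forall_lintegral_le (nullPreimages_energyWeight hv)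
    hv.continuous.measurable (measurable_energyWeight hv) (lintegral_energyWeight_ne_top hv hc)
    fun ψ hψ => ?_
  have hmψ : ∀ j, Measurable fun x => ‖partialDeriv v j x‖ₑ ^ (4 : ℝ) * ψ (v x) := fun j =>
    (hm j).mul (hψ.comp hv.continuous.measurable)
  calc ∫⁻ x, energyWeight v x * ψ (v x)
      ≤ ∫⁻ x, ((m + 1 : ℕ) : ℝ≥0∞) * ∑ j, ‖partialDeriv v j x‖ₑ ^ (4 : ℝ) * ψ (v x) := by
        refine lintegral_mono fun x => ?_
        rw [← Finset.sum_mul, ← mul_assoc]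
        refine mul_le_mul_left ((energyWeight_le x).trans (le_of_eq ?_)) _
        congr 1
        exact Finset.sum_congr rfl fun j _ => by norm_cast
    _ = ((m + 1 : ℕ) : ℝ≥0∞) * ∑ j, ∫⁻ x, ‖partialDeriv v j x‖ₑ ^ (4 : ℝ) * ψ (v x) := by
        rw [lintegral_const_mul' _ _ (ENNReal.natCast_ne_top _),
          lintegral_finsetSum _ fun j _ => hmψ j]
    _ ≤ ((m + 1 : ℕ) : ℝ≥0∞) * ∑ _j : Fin (m + 1), ∫⁻ s, G s * ψ s := by
        refine mul_le_mul_right (Finset.sum_le_sum fun j _ => ?_) _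
        rw [← lintegral_levelDensity_mul ((nullPreimages_partialDeriv hv1 j).mono
          (fun x hx => by rw [hx, ENNReal.zero_rpow_of_pos (by norm_num)])
          (hv1.continuous_partialDeriv j).measurable.enorm (hm j)) hv.continuous.measurable (hm j)
          (lintegral_enorm_partialDeriv_ne_top hv1 hc j (by norm_num)) hψ]
        refine lintegral_mono_ae ?_
        filter_upwards [h j] with s hs
        gcongr
    _ = ∫⁻ s, ((m + 1 : ℕ) : ℝ≥0∞) ^ 2 * G s * ψ s := by
        simp_rw [mul_assoc]
        rw [lintegral_const_mul' _ _ (ENNReal.pow_ne_top (ENNReal.natCast_ne_top _)),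
          Finset.sum_const, Finset.card_univ, Fintype.card_fin, nsmul_eq_mul, sq, mul_assoc]

lemma levelDensity_partialDeriv_le_two (v : EuclideanSpace ℝ (Fin 2) → ℝ) (hv : ContDiff ℝ 2 v)
    (hc : HasCompactSupport v) (j : Fin 2) :
    ∀ᵐ s, levelDensity volume v (fun x => ‖partialDeriv v j x‖ₑ ^ (4 : ℝ)) s ≤
      4 * levelDensity volume v (mixedWeight v) s ^ (2 : ℝ) *
        levelDensity volume v (regularWeight v) s := by
  have hV : ContDiff ℝ 2 (v ∘ sliceEquiv j) := hv.comp (sliceEquiv j).contDiff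
  have hVc := hasCompactSupport_comp_sliceEquiv hc j
  have hv1 : ContDiff ℝ 1 v := hv.of_le (by norm_num)
  have hm : Measurable fun x => ‖partialDeriv v j x‖ₑ :=
    (hv1.continuous_partialDeriv j).measurable.enorm
  have hD : Measurable (levelDensity volume v (mixedWeight v)) := measurable_levelDensity
  have h1 : ∀ᵐ s, ∀ x, v x = s → ‖partialDeriv v j x‖ₑ ^ 2 ≤
      2 * levelDensity volume v (mixedWeight v) s := by
    filter_upwards [enorm_dirDeriv_sq_le hV hVc, levelDensity_sliceWeight_le hv hc j]
      with s hs hs' x hx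
    have := hs ((sliceEquiv j).symm x) (by simpa using hx)
    rw [dirDeriv_comp_sliceEquiv_normal (hv1.differentiable one_ne_zero)] at this
    simp only [Function.comp, ContinuousLinearEquiv.apply_symm_apply] at this
    refine this.trans (mul_le_mul_right (hs'.trans (by simp)) _)
  refine levelDensity_le_of_forall_lintegral_le ((nullPreimages_partialDeriv hv1 j).mono
    (fun x hx => by rw [hx, ENNReal.zero_rpow_of_pos (by norm_num)]) hm (hm.pow_const _))
    hv.continuous.measurable (hm.pow_const _)
    (lintegral_enorm_partialDeriv_ne_top hv1 hc j (by norm_num)) fun ψ hψ => ?_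
  have e : ∀ s, 4 * levelDensity volume v (mixedWeight v) s ^ (2 : ℝ) *
        levelDensity volume v (regularWeight v) s * ψ s =
      levelDensity volume v (regularWeight v) s *
        (4 * levelDensity volume v (mixedWeight v) s ^ (2 : ℝ) * ψ s) := fun s => by ring
  have hDψ : Measurable fun s => 4 * levelDensity volume v (mixedWeight v) s ^ (2 : ℝ) * ψ s :=
    ((hD.pow_const _).const_mul _).mul hψ
  simp_rw [e]
  rw [lintegral_levelDensity_mul (nullPreimages_regularWeight hv) hv.continuous.measurable
    (measurable_regularWeight hv) (lintegral_regularWeight_ne_top hv hc) hDψ]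
  refine lintegral_mono_ae ?_
  filter_upwards [(nullPreimages_regularWeight hv).ae_of_ae hv.continuous.measurable
    (measurable_regularWeight hv) h1] with x hx
  by_cases h0 : gradSq v x = 0
  · rw [enorm_partialDeriv_eq_zero_of_gradSq_eq_zero h0, ENNReal.zero_rpow_of_pos (by norm_num),
      zero_mul]
    exact zero_le
  · have h2 := hx (by simp [regularWeight, h0]) x rfl
    rw [regularWeight, if_neg h0, one_mul]
    refine mul_le_mul_left ?_ _
    calc ‖partialDeriv v j x‖ₑ ^ (4 : ℝ) = (‖partialDeriv v j x‖ₑ ^ 2) ^ 2 := by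
          rw [← pow_mul]; norm_cast
      _ ≤ (2 * levelDensity volume v (mixedWeight v) (v x)) ^ 2 := by gcongr
      _ = _ := by rw [mul_pow, ENNReal.rpow_two]; norm_num

lemma levelDensity_partialDeriv_le_three : ∃ C : ℝ≥0∞, C ≠ ∞ ∧
    ∀ v : EuclideanSpace ℝ (Fin 3) → ℝ, ContDiff ℝ 2 v → HasCompactSupport v → ∀ j, ∀ᵐ s,
      levelDensity volume v (fun x => ‖partialDeriv v j x‖ₑ ^ (4 : ℝ)) s ≤
        C * levelDensity volume v (mixedWeight v) s ^ (8 / 5 : ℝ) *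
          levelDensity volume v (regularWeight v) s ^ (1 / 5 : ℝ) := by
  obtain ⟨C, hC, h⟩ := levelDensity_partialDeriv_le (m := 2) (q := 2)
    (by constructor <;> norm_num)
  refine ⟨C ^ (4 / 5 : ℝ), ENNReal.rpow_ne_top_of_nonneg (by norm_num) hC,
    fun v hv hc j => ?_⟩
  have hv1 : ContDiff ℝ 1 v := hv.of_le (by norm_num)
  have hm : Measurable fun x => ‖partialDeriv v j x‖ₑ :=
    (hv1.continuous_partialDeriv j).measurable.enorm
  have h2 := levelDensity_holder (p := 4 / 5) (q := 1 / 5)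
    (c := fun x => ‖partialDeriv v j x‖ₑ ^ (4 : ℝ)) ((nullPreimages_partialDeriv hv1 j).mono
    (fun x hx => by rw [hx, ENNReal.zero_rpow_of_pos (by norm_num)]) hm
    (hm.pow_const (1 + 2 * 2 : ℝ)))
    (nullPreimages_regularWeight hv) hv.continuous.measurable (hm.pow_const _)
    (measurable_regularWeight hv)
    (lintegral_enorm_partialDeriv_ne_top hv1 hc j (by norm_num))
    (lintegral_regularWeight_ne_top hv hc) (hm.pow_const _) (by norm_num) (by norm_num)
    (by norm_num) fun x => ?_
  · filter_upwards [h2, h v hv hc j] with s hs hs'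
    refine hs.trans (mul_le_mul_left ?_ _)
    refine (ENNReal.rpow_le_rpow hs' (by norm_num)).trans (le_of_eq ?_)
    rw [ENNReal.mul_rpow_of_nonneg _ _ (by norm_num), ← ENNReal.rpow_mul]
    norm_num
  · by_cases h0 : gradSq v x = 0
    · rw [enorm_partialDeriv_eq_zero_of_gradSq_eq_zero h0, ENNReal.zero_rpow_of_pos (by norm_num)]
      exact zero_le
    · rw [regularWeight, if_neg h0, ENNReal.one_rpow, mul_one, ← ENNReal.rpow_mul]
      norm_num

lemma levelDensity_partialDeriv_le_four : ∃ C : ℝ≥0∞, C ≠ ∞ ∧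
    ∀ v : EuclideanSpace ℝ (Fin 4) → ℝ, ContDiff ℝ 2 v → HasCompactSupport v → ∀ j, ∀ᵐ s,
      levelDensity volume v (fun x => ‖partialDeriv v j x‖ₑ ^ (4 : ℝ)) s ≤
        C * levelDensity volume v (mixedWeight v) s ^ (3 / 2 : ℝ) := by
  obtain ⟨C, hC, h⟩ := levelDensity_partialDeriv_le (m := 3) (q := 3 / 2)
    (by constructor <;> norm_num)
  refine ⟨C, hC, fun v hv hc j => ?_⟩
  have := h v hv hc j
  norm_num at this ⊢
  exact this

/-- Dividing a power inequality by a power of the left-hand side. -/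
lemma rpow_le_of_le_mul_rpow {C D H E P : ℝ≥0∞} {a b θ : ℝ} (ha : 0 ≤ a)
    (hθ : 0 ≤ θ) (hH : H ≠ 0) (hH' : H ≠ ∞) (hD : D ≤ H ^ (1 / 2 : ℝ) * E ^ (1 / 2 : ℝ))
    (h : H ≤ C * D ^ a * P ^ b) :
    H ^ (θ * (1 - a / 2)) ≤ C ^ θ * (P ^ (θ * b) * E ^ (θ * (a / 2))) := by
  have h1 : H ≤ H ^ (a / 2) * (C * P ^ b * E ^ (a / 2)) := by
    calc H ≤ C * (H ^ (1 / 2 : ℝ) * E ^ (1 / 2 : ℝ)) ^ a * P ^ b := by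
          refine h.trans ?_
          gcongr
      _ = _ := by
          rw [ENNReal.mul_rpow_of_nonneg _ _ ha, ← ENNReal.rpow_mul, ← ENNReal.rpow_mul,
            show 1 / 2 * a = a / 2 by ring]
          ring
  have h2 : H ^ (1 - a / 2) ≤ C * P ^ b * E ^ (a / 2) := by
    have h3 : H ^ (a / 2) ≠ 0 := (ENNReal.rpow_pos (pos_iff_ne_zero.2 hH) hH').ne'
    have h4 : H ^ (a / 2) ≠ ∞ := ENNReal.rpow_ne_top_of_ne_zero hH hH'
    rw [ENNReal.rpow_sub _ _ hH hH', ENNReal.rpow_one]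
    rw [mul_comm] at h1
    exact ENNReal.div_le_of_le_mul h1
  calc H ^ (θ * (1 - a / 2)) = (H ^ (1 - a / 2)) ^ θ := by rw [mul_comm, ENNReal.rpow_mul]
    _ ≤ (C * P ^ b * E ^ (a / 2)) ^ θ := ENNReal.rpow_le_rpow h2 hθ
    _ = _ := by
        rw [ENNReal.mul_rpow_of_nonneg _ _ hθ, ENNReal.mul_rpow_of_nonneg _ _ hθ,
          ← ENNReal.rpow_mul, ← ENNReal.rpow_mul, mul_assoc, mul_comm b, mul_comm (a / 2)]

lemma exists_levelDensity_energyWeight_le {a b θ : ℝ} (ha : 0 ≤ a) (hθ : 0 ≤ θ)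
    (h : ∃ C : ℝ≥0∞, C ≠ ∞ ∧ ∀ v : EuclideanSpace ℝ (Fin (m + 1)) → ℝ, ContDiff ℝ 2 v →
      HasCompactSupport v → ∀ j, ∀ᵐ s,
        levelDensity volume v (fun x => ‖partialDeriv v j x‖ₑ ^ (4 : ℝ)) s ≤
          C * levelDensity volume v (mixedWeight v) s ^ a *
            levelDensity volume v (regularWeight v) s ^ b) :
    ∃ C : ℝ≥0∞, C ≠ ∞ ∧ ∀ v : EuclideanSpace ℝ (Fin (m + 1)) → ℝ, ContDiff ℝ 2 v →
      HasCompactSupport v → ∀ᵐ s, levelDensity volume v (energyWeight v) s ≠ 0 →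
        levelDensity volume v (energyWeight v) s ^ (θ * (1 - a / 2)) ≤
          C * (levelDensity volume v (regularWeight v) s ^ (θ * b) *
            levelDensity volume v (curvWeight v) s ^ (θ * (a / 2))) := by
  obtain ⟨C, hC, h⟩ := h
  refine ⟨(((m + 1 : ℕ) : ℝ≥0∞) ^ 2 * C) ^ θ, ENNReal.rpow_ne_top_of_nonneg hθ
    (ENNReal.mul_ne_top (ENNReal.pow_ne_top (ENNReal.natCast_ne_top _)) hC), fun v hv hc => ?_⟩
  filter_upwards [levelDensity_energyWeight_le_of_partialDeriv hv hc (h v hv hc),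
    levelDensity_mixedWeight_le hv hc, levelDensity_ne_top (nullPreimages_energyWeight hv)
    hv.continuous.measurable (measurable_energyWeight hv) (lintegral_energyWeight_ne_top hv hc)]
    with s h1 h2 h3 h4
  refine rpow_le_of_le_mul_rpow ha hθ h4 h3 h2 (h1.trans (le_of_eq ?_))
  ring

/-- The isoperimetric type inequality between the level densities, in low dimensions. -/
theorem exists_levelDensity_energyWeight_rpow_le (hm : m ∈ ({1, 2, 3} : Set ℕ)) :
    ∃ β γ : ℝ, 0 ≤ β ∧ 0 ≤ γ ∧ β + 1 / 2 + γ = 1 ∧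
      β = (4 - ((m + 1 : ℕ) : ℝ)) / (2 * ((m + 1 : ℕ) : ℝ)) ∧
      ∃ C : ℝ≥0∞, C ≠ ∞ ∧ ∀ v : EuclideanSpace ℝ (Fin (m + 1)) → ℝ, ContDiff ℝ 2 v →
        HasCompactSupport v → ∀ᵐ s, levelDensity volume v (energyWeight v) s ≠ 0 →
          levelDensity volume v (energyWeight v) s ^ (γ / 2) ≤
            C * (levelDensity volume v (regularWeight v) s ^ β *
              levelDensity volume v (curvWeight v) s ^ (1 / 2 + γ / 2)) := by
  rcases hm with rfl | rfl | rfl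
  · refine ⟨1 / 2, 0, by norm_num, by norm_num, by norm_num, by norm_num, ?_⟩
    have := exists_levelDensity_energyWeight_le (m := 1) (a := 2) (b := 1) (θ := 1 / 2)
      (by norm_num) (by norm_num) ⟨4, by norm_num, fun v hv hc j => by
        simpa using levelDensity_partialDeriv_le_two v hv hc j⟩
    norm_num at this ⊢
    exact this
  · refine ⟨1 / 6, 1 / 3, by norm_num, by norm_num, by norm_num, by norm_num, ?_⟩
    have := exists_levelDensity_energyWeight_le (m := 2) (θ := 5 / 6)
      (by norm_num) (by norm_num) levelDensity_partialDeriv_le_three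
    norm_num at this ⊢
    exact this
  · refine ⟨0, 1 / 2, by norm_num, by norm_num, by norm_num, by norm_num, ?_⟩
    have := exists_levelDensity_energyWeight_le (m := 3) (a := 3 / 2) (b := 0) (θ := 1)
      (by norm_num) (by norm_num)
      (by simpa using levelDensity_partialDeriv_le_four)
    norm_num at this ⊢
    exact this

end levelInequality

section positivity

lemma volume_le_lintegral_enorm_deriv {w : ℝ → ℝ} (hw : ContDiff ℝ 1 w) (hc : HasCompactSupport w)
    {T y : ℝ} (hy : T < w y) {S : Set ℝ} (hS : MeasurableSet S) (hST : S ⊆ Set.Ioo 0 T) :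
    volume S ≤ ∫⁻ y, ‖deriv w y‖ₑ * S.indicator 1 (w y) := by
  have hwS : MeasurableSet (w ⁻¹' S) := hw.continuous.measurable hS
  have h1 : S ⊆ w '' (w ⁻¹' S) := by
    intro s hs
    obtain ⟨y', hy'⟩ : ∃ y', y' ∉ tsupport w := by
      by_contra! h
      exact NoncompactSpace.noncompact_univ (X := ℝ)
        (by rw [← Set.eq_univ_of_forall h]; exact hc.isCompact)
    have hy0 : w y' = 0 := image_eq_zero_of_notMem_tsupport hy'
    have := intermediate_value_univ y' y hw.continuous
    obtain ⟨z, hz⟩ := this ⟨hy0.trans_le (hST hs).1.le, ((hST hs).2.trans hy).le⟩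
    exact ⟨z, by rwa [Set.mem_preimage, hz], hz⟩
  have h2 := addHaar_image_le_lintegral_abs_det_fderiv volume hwS (f := w) (f' := fun y =>
    ContinuousLinearMap.toSpanSingleton ℝ (deriv w y))
    fun y _ => (hw.differentiable one_ne_zero y).hasDerivAt.hasFDerivAt.hasFDerivWithinAt
  refine (measure_mono h1).trans (h2.trans (le_of_eq ?_))
  rw [← lintegral_indicator hwS]
  refine lintegral_congr fun y => ?_
  by_cases h : w y ∈ S
  · rw [Set.indicator_of_mem (by exact h), Set.indicator_of_mem h]
    simp [Real.enorm_eq_ofReal_abs]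
  · rw [Set.indicator_of_notMem (by exact h), Set.indicator_of_notMem h, mul_zero]

variable {m : ℕ} {v : EuclideanSpace ℝ (Fin (m + 1)) → ℝ}

lemma levelDensity_energyWeight_ne_zero (hv : ContDiff ℝ 2 v) (hc : HasCompactSupport v)
    {T : ℝ} {x : EuclideanSpace ℝ (Fin (m + 1))} (hx : T < v x) :
    ∀ᵐ s, s ∈ Set.Ioo 0 T → levelDensity volume v (energyWeight v) s ≠ 0 := by
  set S : Set ℝ := Set.Ioo 0 T ∩ {s | levelDensity volume v (energyWeight v) s = 0}
  have hS : MeasurableSet S :=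
    measurableSet_Ioo.inter (measurable_levelDensity (measurableSet_singleton 0))
  suffices h : volume S = 0 by
    rw [ae_iff]
    refine measure_mono_null (fun s hs => ?_) h
    simp only [ne_eq, Classical.not_imp, not_not, Set.mem_ofPred_eq] at hs
    exact hs
  have hind : Measurable (S.indicator (1 : ℝ → ℝ≥0∞)) := measurable_one.indicator hS
  have hv1 : ContDiff ℝ 1 v := hv.of_le (by norm_num)
  have hV : ContDiff ℝ 1 (v ∘ sliceEquiv 0) := hv1.comp (sliceEquiv 0).contDiff
  have hVc := hasCompactSupport_comp_sliceEquiv hc 0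
  have h1 : ∫⁻ x, energyWeight v x * S.indicator 1 (v x) = 0 := by
    rw [← lintegral_levelDensity_mul (nullPreimages_energyWeight hv) hv.continuous.measurable
      (measurable_energyWeight hv) (lintegral_energyWeight_ne_top hv hc) hind]
    refine lintegral_eq_zero_of_ae_eq_zero (Eventually.of_forall fun s => ?_)
    by_cases hs : s ∈ S
    · have : levelDensity volume v (energyWeight v) s = 0 := hs.2
      simp [this]
    · simp [hs]
  have hSv : Measurable fun x => energyWeight v x * S.indicator 1 (v x) :=
    (measurable_energyWeight hv).mul (hind.comp hv.continuous.measurable)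
  rw [lintegral_eq_zero_iff hSv] at h1
  have h2 : ∫⁻ x, ‖partialDeriv v 0 x‖ₑ * S.indicator 1 (v x) = 0 := by
    refine lintegral_eq_zero_of_ae_eq_zero ?_
    filter_upwards [h1] with x hx
    rcases mul_eq_zero.1 hx with h | h
    · simp [enorm_partialDeriv_eq_zero_of_gradSq_eq_zero (gradSq_eq_zero_of_energyWeight_eq_zero h)]
    · simp [h]
  have hm : Measurable fun p : (Fin m → ℝ) × ℝ =>
      ‖dirDeriv (v ∘ sliceEquiv 0) (0, 1) p‖ₑ * S.indicator 1 ((v ∘ sliceEquiv 0) p) :=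
    (hV.continuous_dirDeriv _).measurable.enorm.mul (hind.comp hV.continuous.measurable)
  have h3 : ∫⁻ p, ‖dirDeriv (v ∘ sliceEquiv 0) (0, 1) p‖ₑ *
      S.indicator 1 ((v ∘ sliceEquiv 0) p) = 0 := by
    rw [dirDeriv_comp_sliceEquiv_normal (hv1.differentiable one_ne_zero), ← h2,
      ← lintegral_comp_sliceEquiv 0]
    rfl
  rw [Measure.volume_eq_prod, lintegral_prod _ hm.aemeasurable,
    lintegral_eq_zero_iff hm.lintegral_prod_right'] at h3
  set y := (sliceEquiv 0).symm x
  have hO : IsOpen {z : Fin m → ℝ | T < (v ∘ sliceEquiv 0) (z, y.2)} :=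
    isOpen_lt continuous_const (hV.continuous.comp (by fun_prop))
  have hO0 : volume {z : Fin m → ℝ | T < (v ∘ sliceEquiv 0) (z, y.2)} ≠ 0 :=
    (hO.measure_pos _ ⟨y.1, by simpa [y] using hx⟩).ne'
  obtain ⟨z, hz, hz'⟩ := (frequently_ae_mem_iff.2 hO0).and_eventually h3 |>.exists
  have hw : ContDiff ℝ 1 fun y => (v ∘ sliceEquiv 0) (z, y) := contDiff_slice hV z
  have h4 := volume_le_lintegral_enorm_deriv hw (hVc.slice z) hz hS Set.inter_subset_left
  refine le_antisymm (h4.trans (le_of_eq ?_)) zero_le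
  refine Eq.trans ?_ hz'
  refine lintegral_congr fun y => ?_
  rw [deriv_slice hV]

end positivity

section integrationByParts

variable {E : Type*} [NormedAddCommGroup E] [NormedSpace ℝ E] [FiniteDimensional ℝ E]
  [MeasurableSpace E] [BorelSpace E] {μ : Measure E} [μ.IsAddHaarMeasure]

lemma integral_mul_dirDeriv_eq_neg {f g : E → ℝ} (hf : ContDiff ℝ 1 f) (hg : ContDiff ℝ 1 g)
    (hgc : HasCompactSupport g) (e : E) :
    ∫ x, f x * dirDeriv g e x ∂μ = -∫ x, dirDeriv f e x * g x ∂μ := by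
  have hg' := hg.continuous
  have hf' := hf.continuous
  refine integral_mul_fderiv_eq_neg_fderiv_mul_of_integrable ?_ ?_ ?_
    (fun x _ => hf.differentiable one_ne_zero x) (fun x _ => hg.differentiable one_ne_zero x)
  · exact ((hf.continuous_dirDeriv e).mul hg').integrable_of_hasCompactSupport hgc.mul_left
  · exact (hf'.mul (hg.continuous_dirDeriv e)).integrable_of_hasCompactSupport
      (hgc.dirDeriv e).mul_left
  · exact (hf'.mul hg').integrable_of_hasCompactSupport hgc.mul_left

/-- Derivatives in different directions can be exchanged in an integral of a product, without
second derivatives. -/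
lemma integral_dirDeriv_mul_dirDeriv_comm {w ζ : E → ℝ} (hw : ContDiff ℝ 1 w)
    (hwc : HasCompactSupport w) (hζ : ContDiff ℝ 1 ζ) (hζc : HasCompactSupport ζ) (e d : E) :
    ∫ x, dirDeriv w e x * dirDeriv ζ d x ∂μ = ∫ x, dirDeriv w d x * dirDeriv ζ e x ∂μ := by
  obtain ⟨K, hK⟩ := hw.lipschitzWith_of_hasCompactSupport hwc one_ne_zero
  obtain ⟨L, hL⟩ := hζ.lipschitzWith_of_hasCompactSupport hζc one_ne_zero
  have hlw : ∀ x e, lineDeriv ℝ w x e = dirDeriv w e x := fun x e =>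
    (hw.differentiable one_ne_zero x).lineDeriv_eq_fderiv
  have hlζ : ∀ x e, lineDeriv ℝ ζ x e = dirDeriv ζ e x := fun x e =>
    (hζ.differentiable one_ne_zero x).lineDeriv_eq_fderiv
  have h1 := hK.integral_inv_smul_sub_mul_tendsto_integral_lineDeriv_mul' (μ := μ) hwc
    (hζ.continuous_dirDeriv d) e
  have h2 := hL.integral_inv_smul_sub_mul_tendsto_integral_lineDeriv_mul' (μ := μ) hζc
    (hw.continuous_dirDeriv d) (-e)
  have hneg : ∀ x, dirDeriv ζ (-e) x = -dirDeriv ζ e x := fun x => by simp [dirDeriv]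
  simp only [hlw] at h1
  simp only [hlζ, hneg, neg_mul, integral_neg] at h2
  have h3 := h2.neg
  rw [neg_neg] at h3
  simp_rw [mul_comm (dirDeriv ζ e _)] at h3
  refine tendsto_nhds_unique h1 (h3.congr fun t => ?_)
  have hwt : ContDiff ℝ 1 fun x => w (x + t • e) := hw.comp (contDiff_id.add contDiff_const)
  have hwtc : HasCompactSupport fun x => w (x + t • e) :=
    hwc.comp_homeomorph (Homeomorph.addRight (t • e))
  have hwd : ∀ x, dirDeriv (fun x => w (x + t • e)) d x = dirDeriv w d (x + t • e) := fun x => by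
    simp only [dirDeriv]
    rw [fderiv_comp_add_right]
  have hcd := hw.continuous_dirDeriv d
  have hcζ := hζ.continuous
  have i1 : Integrable (fun x => dirDeriv w d (x + t • e) * ζ x) μ :=
    ((hcd.comp (by fun_prop : Continuous fun x => x + t • e)).mul
      hcζ).integrable_of_hasCompactSupport hζc.mul_left
  have i2 : Integrable (fun x => dirDeriv w d x * ζ x) μ :=
    (hcd.mul hcζ).integrable_of_hasCompactSupport hζc.mul_left
  have i3 : Integrable (fun x => w (x + t • e) * dirDeriv ζ d x) μ :=
    (hwt.continuous.mul (hζ.continuous_dirDeriv d)).integrable_of_hasCompactSupport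
      (hζc.dirDeriv d).mul_left
  have i4 : Integrable (fun x => w x * dirDeriv ζ d x) μ :=
    (hw.continuous.mul (hζ.continuous_dirDeriv d)).integrable_of_hasCompactSupport
      (hζc.dirDeriv d).mul_left
  have i5 : Integrable (fun x => ζ (x + t • -e) * dirDeriv w d x) μ :=
    ((hcζ.comp (by fun_prop : Continuous fun x => x + t • -e)).mul
      hcd).integrable_of_hasCompactSupport (hwc.dirDeriv d).mul_left
  have i6 : Integrable (fun x => ζ x * dirDeriv w d x) μ :=
    (hcζ.mul hcd).integrable_of_hasCompactSupport (hwc.dirDeriv d).mul_left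
  have e1 : ∫ x, ζ (x + t • -e) * dirDeriv w d x ∂μ = ∫ x, dirDeriv w d (x + t • e) * ζ x ∂μ := by
    rw [← integral_add_right_eq_self _ (t • e)]
    refine integral_congr_ae (Eventually.of_forall fun x => ?_)
    simp [mul_comm]
  have e2 := integral_mul_dirDeriv_eq_neg (μ := μ) hwt hζ hζc d
  simp_rw [hwd] at e2
  have e3 := integral_mul_dirDeriv_eq_neg (μ := μ) hw hζ hζc d
  simp only [smul_eq_mul, mul_assoc, integral_const_mul, sub_mul]
  rw [integral_sub i5 i6, integral_sub i3 i4, e1, e2, e3]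
  simp_rw [mul_comm (ζ _)]
  ring

end integrationByParts

section stability

lemma dirDeriv_mul {E : Type*} [NormedAddCommGroup E] [NormedSpace ℝ E] {f g : E → ℝ} {x : E}
    (hf : DifferentiableAt ℝ f x) (hg : DifferentiableAt ℝ g x) (e : E) :
    dirDeriv (fun x => f x * g x) e x = f x * dirDeriv g e x + g x * dirDeriv f e x := by
  simp only [dirDeriv]
  rw [show (fun x => f x * g x) = f * g from rfl, (hf.hasFDerivAt.mul hg.hasFDerivAt).fderiv]
  simp

lemma dirDeriv_comp {E : Type*} [NormedAddCommGroup E] [NormedSpace ℝ E] {φ : ℝ → ℝ} {v : E → ℝ}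
    {x : E} {φ' : ℝ} (hφ : HasDerivAt φ φ' (v x)) (hv : DifferentiableAt ℝ v x) (e : E) :
    dirDeriv (fun x => φ (v x)) e x = φ' * dirDeriv v e x := by
  simp only [dirDeriv]
  rw [show (fun x => φ (v x)) = φ ∘ v from rfl, (hφ.comp_hasFDerivAt x hv.hasFDerivAt).fderiv]
  simp

variable {n : ℕ} {v : EuclideanSpace ℝ (Fin n) → ℝ}

lemma lapl_eq_sum_partialDeriv (x) : lapl v x = ∑ j, partialDeriv (partialDeriv v j) j x := rfl

lemma partialDeriv_mul_sq {p η : EuclideanSpace ℝ (Fin n) → ℝ} (hp : ContDiff ℝ 1 p)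
    (hη : ContDiff ℝ 1 η) (j x) :
    partialDeriv (fun x => p x * (η x * η x)) j x =
      partialDeriv p j x * η x ^ 2 + 2 * η x * partialDeriv η j x * p x := by
  have h1 := hη.differentiable one_ne_zero x
  have h3 : DifferentiableAt ℝ (fun x => η x * η x) x := h1.mul h1
  have h4 := dirDeriv_mul (hp.differentiable one_ne_zero x) h3 (EuclideanSpace.single j 1)
  rw [dirDeriv_mul h1 h1] at h4
  refine h4.trans ?_
  simp only [partialDeriv]
  ring

lemma integrable_partialDeriv_mul_partialDeriv {w ζ : EuclideanSpace ℝ (Fin n) → ℝ}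
    (hw : ContDiff ℝ 1 w) (hwc : HasCompactSupport w) (hζ : ContDiff ℝ 1 ζ) (k l) :
    Integrable fun x => partialDeriv w k x * partialDeriv ζ l x :=
  ((hw.continuous_partialDeriv k).mul (hζ.continuous_partialDeriv l)).integrable_of_hasCompactSupport
    (hwc.dirDeriv _).mul_right

lemma integral_sum_partialDeriv_mul_eq (hv : ContDiff ℝ 2 v) (hc : HasCompactSupport v) {f : ℝ → ℝ}
    (hf : ContDiff ℝ 1 f) {ζ : EuclideanSpace ℝ (Fin n) → ℝ} (hζ : ContDiff ℝ 1 ζ)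
    (hζc : HasCompactSupport ζ) (i : Fin n)
    (heq : ∀ x, partialDeriv ζ i x ≠ 0 → lapl v x + f (v x) = 0) :
    ∫ x, ∑ j, partialDeriv (partialDeriv v j) i x * partialDeriv ζ j x =
      ∫ x, deriv f (v x) * partialDeriv v i x * ζ x := by
  have hv1 : ContDiff ℝ 1 v := hv.of_le (by norm_num)
  have hp : ∀ i, ContDiff ℝ 1 (partialDeriv v i) := fun i => hv.partialDeriv (by norm_num) i
  have hpc : ∀ i, HasCompactSupport (partialDeriv v i) := fun i => hc.dirDeriv _
  have hfv : ContDiff ℝ 1 fun x => f (v x) := hf.comp hv1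
  rw [integral_finsetSum _ fun j _ =>
    integrable_partialDeriv_mul_partialDeriv (hp j) (hpc j) hζ i j]
  have h1 : ∑ j, ∫ x, partialDeriv (partialDeriv v j) i x * partialDeriv ζ j x =
      ∑ j, ∫ x, partialDeriv (partialDeriv v j) j x * partialDeriv ζ i x :=
    Finset.sum_congr rfl fun j _ =>
      integral_dirDeriv_mul_dirDeriv_comm (μ := volume) (hp j) (hpc j) hζ hζc
        (EuclideanSpace.single i 1) (EuclideanSpace.single j 1)
  rw [h1, ← integral_finsetSum _ fun j _ =>
    integrable_partialDeriv_mul_partialDeriv (hp j) (hpc j) hζ j i]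
  have h2 := integral_mul_dirDeriv_eq_neg (μ := volume) hfv hζ hζc (EuclideanSpace.single i 1)
  rw [← neg_eq_iff_eq_neg, ← integral_neg] at h2
  refine Eq.trans (integral_congr_ae (Eventually.of_forall fun x => ?_))
    (h2.trans (integral_congr_ae (Eventually.of_forall fun x => ?_)))
  · have : ∑ j, partialDeriv (partialDeriv v j) j x * partialDeriv ζ i x =
        -(f (v x) * partialDeriv ζ i x) := by
      rw [← Finset.sum_mul, ← lapl_eq_sum_partialDeriv, ← neg_mul]
      by_cases h : partialDeriv ζ i x = 0
      · rw [h, mul_zero, mul_zero]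
      · rw [eq_neg_of_add_eq_zero_left (heq x h)]
    exact this
  · have := dirDeriv_comp (hf.differentiable one_ne_zero _).hasDerivAt
      (hv1.differentiable one_ne_zero x) (EuclideanSpace.single i 1)
    simp only [this, partialDeriv]

lemma hessSq_mul_add_eq (hv : ContDiff ℝ 2 v) {η : EuclideanSpace ℝ (Fin n) → ℝ}
    (hη : ContDiff ℝ 1 η) (x) :
    hessSq v x * η x ^ 2 + 2 * η x * ∑ k, partialDeriv η k x * hessGrad v k x =
      ∑ i, ∑ j, partialDeriv (partialDeriv v j) i x *
        partialDeriv (fun x => partialDeriv v i x * (η x * η x)) j x := by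
  have hp : ∀ i, ContDiff ℝ 1 (partialDeriv v i) := fun i => hv.partialDeriv (by norm_num) i
  have h : ∀ i j, partialDeriv (partialDeriv v j) i x *
        partialDeriv (fun x => partialDeriv v i x * (η x * η x)) j x =
      partialDeriv (partialDeriv v j) i x ^ 2 * η x ^ 2 +
        2 * η x * (partialDeriv η j x *
          (partialDeriv v i x * partialDeriv (partialDeriv v i) j x)) := by
    intro i j
    rw [partialDeriv_mul_sq (hp i) hη, partialDeriv_comm hv j i]
    ring
  simp only [h, Finset.sum_add_distrib, ← Finset.sum_mul, ← Finset.mul_sum, hessSq, hessGrad]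
  congr 2
  rw [Finset.sum_comm]
  simp only [Finset.mul_sum]

/-- The equation satisfied by the gradient of a solution, tested against the gradient. -/
lemma integral_hessSq_mul_eq (hv : ContDiff ℝ 2 v) (hc : HasCompactSupport v) {f : ℝ → ℝ}
    (hf : ContDiff ℝ 1 f) {η : EuclideanSpace ℝ (Fin n) → ℝ} (hη : ContDiff ℝ 1 η)
    (heq : ∀ x, η x ≠ 0 → lapl v x + f (v x) = 0) :
    ∫ x, (hessSq v x * η x ^ 2 + 2 * η x * ∑ k, partialDeriv η k x * hessGrad v k x) =
      ∫ x, deriv f (v x) * gradSq v x * η x ^ 2 := by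
  have hp : ∀ i, ContDiff ℝ 1 (partialDeriv v i) := fun i => hv.partialDeriv (by norm_num) i
  have hpc : ∀ i, HasCompactSupport (partialDeriv v i) := fun i => hc.dirDeriv _
  have hζ : ∀ i, ContDiff ℝ 1 fun x => partialDeriv v i x * (η x * η x) := fun i =>
    (hp i).mul (hη.mul hη)
  have hζc : ∀ i, HasCompactSupport fun x => partialDeriv v i x * (η x * η x) := fun i =>
    (hpc i).mul_right
  have hfd : Continuous fun x => deriv f (v x) :=
    (hf.continuous_deriv (by norm_num)).comp hv.continuous
  have hR : ∀ i, Integrable fun x =>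
      deriv f (v x) * partialDeriv v i x * (partialDeriv v i x * (η x * η x)) := fun i =>
    ((hfd.mul (hp i).continuous).mul (hζ i).continuous).integrable_of_hasCompactSupport
      (hζc i).mul_left
  simp only [hessSq_mul_add_eq hv hη]
  rw [integral_finsetSum _ fun i _ => integrable_finsetSum _ fun j _ =>
    integrable_partialDeriv_mul_partialDeriv (hp j) (hpc j) (hζ i) i j]
  rw [Finset.sum_congr rfl fun i _ => integral_sum_partialDeriv_mul_eq hv hc hf (hζ i) (hζc i) i
    fun x hx => heq x fun h0 => hx (by rw [partialDeriv_mul_sq (hp i) hη, h0]; simp)]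
  rw [← integral_finsetSum _ fun i _ => hR i]
  refine integral_congr_ae (Eventually.of_forall fun x => ?_)
  simp only [gradSq, Finset.mul_sum, Finset.sum_mul]
  exact Finset.sum_congr rfl fun i _ => by ring

lemma partialDeriv_gradSq (hv : ContDiff ℝ 2 v) (k : Fin n) (x) :
    partialDeriv (gradSq v) k x = 2 * hessGrad v k x := by
  have hp : ∀ i, HasFDerivAt (partialDeriv v i) (fderiv ℝ (partialDeriv v i) x) x := fun i =>
    ((hv.partialDeriv (m := 1) (by norm_num) i).differentiable one_ne_zero x).hasFDerivAt
  have h := HasFDerivAt.fun_sum (u := Finset.univ) fun i _ => (hp i).pow 2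
  have : gradSq v = fun x => ∑ i, partialDeriv v i x ^ 2 := rfl
  rw [partialDeriv, dirDeriv, this, h.fderiv, hessGrad, Finset.mul_sum,
    sum_apply]
  refine Finset.sum_congr rfl fun i _ => ?_
  simp [partialDeriv, dirDeriv]
  ring

lemma contDiff_gradSq (hv : ContDiff ℝ 2 v) : ContDiff ℝ 1 (gradSq v) :=
  ContDiff.sum fun i _ => (hv.partialDeriv (m := 1) (by norm_num) i).pow 2

end stability

section geometricStability

variable {n : ℕ} {v : EuclideanSpace ℝ (Fin n) → ℝ}

lemma HasCompactSupport.fun_sq {α : Type*} [TopologicalSpace α] {w : α → ℝ}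
    (h : HasCompactSupport w) : HasCompactSupport fun x => w x ^ 2 := by
  simp only [sq]
  exact h.mul_right

lemma partialDeriv_mul {p q : EuclideanSpace ℝ (Fin n) → ℝ} (hp : ContDiff ℝ 1 p)
    (hq : ContDiff ℝ 1 q) (j x) :
    partialDeriv (fun x => p x * q x) j x = p x * partialDeriv q j x + q x * partialDeriv p j x :=
  dirDeriv_mul (hp.differentiable one_ne_zero x) (hq.differentiable one_ne_zero x) _

lemma gradSq_comp {φ : ℝ → ℝ} (hφ : ContDiff ℝ 1 φ) (hv : ContDiff ℝ 1 v) (x) :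
    gradSq (fun x => φ (v x)) x = deriv φ (v x) ^ 2 * gradSq v x := by
  have h : ∀ i, partialDeriv (fun x => φ (v x)) i x = deriv φ (v x) * partialDeriv v i x :=
    fun i => dirDeriv_comp (hφ.differentiable one_ne_zero _).hasDerivAt
      (hv.differentiable one_ne_zero x) _
  simp only [gradSq, h, mul_pow, Finset.mul_sum]

lemma sum_sq_hessGrad_div_le (hδ : 0 < δ) (x) :
    (∑ k, hessGrad v k x ^ 2) / (gradSq v x + δ) ≤ hessSq v x - katoDefect v x := by
  rw [katoDefect, sub_sub_cancel]
  have h0 : 0 ≤ ∑ k, hessGrad v k x ^ 2 := Finset.sum_nonneg fun _ _ => sq_nonneg _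
  rcases (gradSq_nonneg (v := v) x).eq_or_lt with h | h
  · have : ∑ k, hessGrad v k x ^ 2 = 0 := by
      simp [hessGrad, partialDeriv_eq_zero_of_gradSq_eq_zero h.symm]
    simp [this]
  · exact div_le_div_of_nonneg_left h0 h (by linarith)

lemma gradSq_mul_sqrt_le (hv : ContDiff ℝ 2 v) {η : EuclideanSpace ℝ (Fin n) → ℝ}
    (hη : ContDiff ℝ 1 η) {δ : ℝ} (hδ : 0 < δ) (x) :
    gradSq (fun x => η x * √(gradSq v x + δ)) x ≤ (gradSq v x + δ) * gradSq η x +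
      2 * η x * (∑ k, partialDeriv η k x * hessGrad v k x) +
        η x ^ 2 * (hessSq v x - katoDefect v x) := by
  have hpos : ∀ x, 0 < gradSq v x + δ := fun x => by linarith [gradSq_nonneg (v := v) x]
  have hg := contDiff_gradSq hv
  have hσ : ContDiff ℝ 1 fun x => √(gradSq v x + δ) :=
    (hg.add contDiff_const).sqrt fun x => (hpos x).ne'
  have hs := Real.sq_sqrt (hpos x).le
  have hs0 : √(gradSq v x + δ) ≠ 0 := (Real.sqrt_pos.2 (hpos x)).ne'
  have hk : ∀ k, partialDeriv (fun x => √(gradSq v x + δ)) k x =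
      hessGrad v k x / √(gradSq v x + δ) := by
    intro k
    have h1 : HasDerivAt (fun s => √(s + δ)) (1 / (2 * √(gradSq v x + δ))) (gradSq v x) := by
      have := ((hasDerivAt_id (gradSq v x)).add_const δ).sqrt (hpos x).ne'
      simpa using this
    have h2 := dirDeriv_comp h1 (hg.differentiable one_ne_zero x) (EuclideanSpace.single k 1)
    refine h2.trans ?_
    have h3 : dirDeriv (gradSq v) (EuclideanSpace.single k 1) x = 2 * hessGrad v k x :=
      partialDeriv_gradSq hv k x
    rw [h3]
    field_simp
  have hsq : ∀ k, partialDeriv (fun x => η x * √(gradSq v x + δ)) k x ^ 2 =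
      (gradSq v x + δ) * partialDeriv η k x ^ 2 +
        2 * η x * (partialDeriv η k x * hessGrad v k x) +
          η x ^ 2 * (hessGrad v k x ^ 2 / (gradSq v x + δ)) := by
    intro k
    rw [partialDeriv_mul hη hσ, hk]
    nth_rw 4 [← hs]
    nth_rw 3 [← hs]
    field_simp
    ring
  have h := mul_le_mul_of_nonneg_left (sum_sq_hessGrad_div_le (v := v) hδ x) (sq_nonneg (η x))
  have e : gradSq (fun x => η x * √(gradSq v x + δ)) x =
      (gradSq v x + δ) * gradSq η x +
      2 * η x * (∑ k, partialDeriv η k x * hessGrad v k x) +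
        η x ^ 2 * ((∑ k, hessGrad v k x ^ 2) / (gradSq v x + δ)) := by
    rw [gradSq]
    simp only [hsq, Finset.sum_add_distrib, ← Finset.mul_sum, Finset.sum_div]
    rfl
  linarith

/-- The Sternberg–Zumbrun inequality in integrated form. -/
lemma integral_katoDefect_mul_le (hv : ContDiff ℝ 2 v) (hc : HasCompactSupport v) {f : ℝ → ℝ}
    (hf : ContDiff ℝ 1 f) {c : ℝ} (hc0 : 0 ≤ c)
    (heq : ∀ x, c < v x → lapl v x + f (v x) = 0)
    (hstab : ∀ ξ, ContDiff ℝ 1 ξ → HasCompactSupport ξ → (∀ x, v x ≤ c → ξ x = 0) →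
      0 ≤ ∫ x, (gradSq ξ x - deriv f (v x) * ξ x ^ 2))
    {φ : ℝ → ℝ} (hφ : ContDiff ℝ 1 φ) (hφ0 : ∀ s ≤ c, φ s = 0) :
    Integrable (fun x => φ (v x) ^ 2 * katoDefect v x) ∧
    ∫ x, φ (v x) ^ 2 * katoDefect v x ≤ ∫ x, deriv φ (v x) ^ 2 * gradSq v x ^ 2 := by
  have hv1 : ContDiff ℝ 1 v := hv.of_le (by norm_num)
  have hη : ContDiff ℝ 1 fun x => φ (v x) := hφ.comp hv1
  have hηc : HasCompactSupport fun x => φ (v x) := hc.comp_left (hφ0 0 hc0)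
  have hg := contDiff_gradSq hv
  have hgc := hasCompactSupport_gradSq hc
  have hfd : Continuous fun x => deriv f (v x) :=
    (hf.continuous_deriv (by norm_num)).comp hv.continuous
  have hφd : Continuous fun x => deriv φ (v x) :=
    (hφ.continuous_deriv (by norm_num)).comp hv.continuous
  have hη2c : HasCompactSupport fun x => φ (v x) ^ 2 :=
    hηc.fun_sq
  have iK : Integrable fun x => φ (v x) ^ 2 * katoDefect v x := by
    have i1 : Integrable fun x => φ (v x) ^ 2 * hessSq v x :=
      ((hη.continuous.pow 2).mul (continuous_hessSq hv)).integrable_of_hasCompactSupport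
        hη2c.mul_right
    refine i1.mono' ((hη.continuous.pow 2).measurable.mul
      (measurable_katoDefect hv)).aestronglyMeasurable (Eventually.of_forall fun x => ?_)
    rw [Real.norm_of_nonneg (mul_nonneg (sq_nonneg _) (katoDefect_nonneg x))]
    exact mul_le_mul_of_nonneg_left (katoDefect_le_hessSq x) (sq_nonneg _)
  refine ⟨iK, ?_⟩
  have iE : Integrable fun x => deriv φ (v x) ^ 2 * gradSq v x ^ 2 :=
    ((hφd.pow 2).mul (hg.continuous.pow 2)).integrable_of_hasCompactSupport
      (HasCompactSupport.mul_left hgc.fun_sq)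
  have iD : Integrable fun x => deriv φ (v x) ^ 2 * gradSq v x - deriv f (v x) * φ (v x) ^ 2 := by
    refine Integrable.sub ?_ ?_
    · exact ((hφd.pow 2).mul hg.continuous).integrable_of_hasCompactSupport hgc.mul_left
    · exact (hfd.mul (hη.continuous.pow 2)).integrable_of_hasCompactSupport hη2c.mul_left
  have iH : Integrable fun x => hessSq v x * φ (v x) ^ 2 +
      2 * φ (v x) * ∑ k, partialDeriv (fun x => φ (v x)) k x * hessGrad v k x := by
    refine Integrable.add ?_ ?_
    · exact ((continuous_hessSq hv).mul (hη.continuous.pow 2)).integrable_of_hasCompactSupport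
        hη2c.mul_left
    · exact ((continuous_const.mul hη.continuous).mul (continuous_finsetSum _ fun k _ =>
        (hη.continuous_partialDeriv k).mul
          (continuous_hessGrad hv k))).integrable_of_hasCompactSupport
        (HasCompactSupport.mul_right hηc.mul_left)
  have iF : Integrable fun x => deriv f (v x) * gradSq v x * φ (v x) ^ 2 :=
    ((hfd.mul hg.continuous).mul (hη.continuous.pow 2)).integrable_of_hasCompactSupport
      hη2c.mul_left
  have hB := integral_hessSq_mul_eq hv hc hf hη fun x hx => heq x (by
    by_contra h
    exact hx (hφ0 _ (not_lt.1 h)))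
  have key : ∀ δ : ℝ, 0 < δ → ∫ x, φ (v x) ^ 2 * katoDefect v x ≤
      (∫ x, deriv φ (v x) ^ 2 * gradSq v x ^ 2) +
      δ * ∫ x, (deriv φ (v x) ^ 2 * gradSq v x - deriv f (v x) * φ (v x) ^ 2) := by
    intro δ hδ
    have hpos : ∀ x, 0 < gradSq v x + δ := fun x => by linarith [gradSq_nonneg (v := v) x]
    have hξ : ContDiff ℝ 1 fun x => φ (v x) * √(gradSq v x + δ) :=
      hη.mul ((hg.add contDiff_const).sqrt fun x => (hpos x).ne')
    have hξc : HasCompactSupport fun x => φ (v x) * √(gradSq v x + δ) := hηc.mul_right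
    have h0 := hstab _ hξ hξc fun x hx => by simp [hφ0 _ hx]
    have i1 : Integrable fun x => deriv φ (v x) ^ 2 * gradSq v x ^ 2 +
      δ * (deriv φ (v x) ^ 2 * gradSq v x - deriv f (v x) * φ (v x) ^ 2) :=
      iE.add (iD.const_mul δ)
    have i2 : Integrable fun x => deriv φ (v x) ^ 2 * gradSq v x ^ 2 +
      δ * (deriv φ (v x) ^ 2 * gradSq v x - deriv f (v x) * φ (v x) ^ 2) +
      (hessSq v x * φ (v x) ^ 2 +
        2 * φ (v x) * ∑ k, partialDeriv (fun x => φ (v x)) k x * hessGrad v k x) := i1.add iH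
    have i3 : Integrable fun x => deriv φ (v x) ^ 2 * gradSq v x ^ 2 +
      δ * (deriv φ (v x) ^ 2 * gradSq v x - deriv f (v x) * φ (v x) ^ 2) +
      (hessSq v x * φ (v x) ^ 2 +
        2 * φ (v x) * ∑ k, partialDeriv (fun x => φ (v x)) k x * hessGrad v k x) -
      deriv f (v x) * gradSq v x * φ (v x) ^ 2 := i2.sub iF
    have h1 := h0.trans (integral_mono (g := fun x =>
      deriv φ (v x) ^ 2 * gradSq v x ^ 2 +
      δ * (deriv φ (v x) ^ 2 * gradSq v x - deriv f (v x) * φ (v x) ^ 2) +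
      (hessSq v x * φ (v x) ^ 2 +
        2 * φ (v x) * ∑ k, partialDeriv (fun x => φ (v x)) k x * hessGrad v k x) -
      deriv f (v x) * gradSq v x * φ (v x) ^ 2 - φ (v x) ^ 2 * katoDefect v x) ?_ ?_ ?_)
    · rw [integral_sub i3 iK, integral_sub i2 iF, integral_add i1 iH,
        integral_add iE (iD.const_mul δ), hB, integral_const_mul] at h1
      linarith
    · refine Integrable.sub ?_ ?_
      · exact (continuous_gradSq hξ).integrable_of_hasCompactSupport
          (hasCompactSupport_gradSq hξc)
      · exact (hfd.mul (hξ.continuous.pow 2)).integrable_of_hasCompactSupport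
          (HasCompactSupport.mul_left hξc.fun_sq)
    · exact i3.sub iK
    · intro x
      have h2 := gradSq_mul_sqrt_le hv hη hδ x
      rw [gradSq_comp hφ hv1] at h2
      have h3 := Real.sq_sqrt (hpos x).le
      simp only [mul_pow, h3]
      linarith
  have hlim : Tendsto (fun δ : ℝ => (∫ x, deriv φ (v x) ^ 2 * gradSq v x ^ 2) +
      δ * ∫ x, (deriv φ (v x) ^ 2 * gradSq v x - deriv f (v x) * φ (v x) ^ 2)) (𝓝[>] 0)
      (𝓝 ((∫ x, deriv φ (v x) ^ 2 * gradSq v x ^ 2) +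
      0 * ∫ x, (deriv φ (v x) ^ 2 * gradSq v x - deriv f (v x) * φ (v x) ^ 2))) :=
    tendsto_const_nhds.add ((tendsto_id.mono_left nhdsWithin_le_nhds).mul_const _)
  rw [zero_mul, add_zero] at hlim
  exact ge_of_tendsto hlim (eventually_mem_nhdsWithin.mono fun δ hδ => key δ hδ)

lemma lintegral_curvWeight_mul_le (hv : ContDiff ℝ 2 v) (hc : HasCompactSupport v) {f : ℝ → ℝ}
    (hf : ContDiff ℝ 1 f) {c : ℝ} (hc0 : 0 ≤ c)
    (heq : ∀ x, c < v x → lapl v x + f (v x) = 0)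
    (hstab : ∀ ξ, ContDiff ℝ 1 ξ → HasCompactSupport ξ → (∀ x, v x ≤ c → ξ x = 0) →
      0 ≤ ∫ x, (gradSq ξ x - deriv f (v x) * ξ x ^ 2))
    {φ : ℝ → ℝ} (hφ : ContDiff ℝ 1 φ) (hφ0 : ∀ s ≤ c, φ s = 0) :
    ∫⁻ x, curvWeight v x * ENNReal.ofReal (φ (v x) ^ 2) ≤
      ∫⁻ x, energyWeight v x * ENNReal.ofReal (deriv φ (v x) ^ 2) := by
  obtain ⟨iK, h⟩ := integral_katoDefect_mul_le hv hc hf hc0 heq hstab hφ hφ0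
  have hφd : Continuous fun x => deriv φ (v x) :=
    (hφ.continuous_deriv (by norm_num)).comp hv.continuous
  have iE : Integrable fun x => deriv φ (v x) ^ 2 * gradSq v x ^ 2 :=
    ((hφd.pow 2).mul ((contDiff_gradSq hv).continuous.pow 2)).integrable_of_hasCompactSupport
      (HasCompactSupport.mul_left
        (hasCompactSupport_gradSq hc).fun_sq)
  calc ∫⁻ x, curvWeight v x * ENNReal.ofReal (φ (v x) ^ 2)
      ≤ ∫⁻ x, ENNReal.ofReal (φ (v x) ^ 2 * katoDefect v x) := by
        refine lintegral_mono fun x => ?_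
        rw [ENNReal.ofReal_mul (sq_nonneg _), mul_comm]
        gcongr
        rw [curvWeight]
        split_ifs with h0
        · exact ENNReal.ofReal_le_ofReal (katoDefect_nonneg x)
        · rfl
    _ = ENNReal.ofReal (∫ x, φ (v x) ^ 2 * katoDefect v x) :=
        (ofReal_integral_eq_lintegral_ofReal iK (Eventually.of_forall fun x =>
          mul_nonneg (sq_nonneg _) (katoDefect_nonneg x))).symm
    _ ≤ ENNReal.ofReal (∫ x, deriv φ (v x) ^ 2 * gradSq v x ^ 2) := ENNReal.ofReal_le_ofReal h
    _ = ∫⁻ x, ENNReal.ofReal (deriv φ (v x) ^ 2 * gradSq v x ^ 2) :=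
        ofReal_integral_eq_lintegral_ofReal iE (Eventually.of_forall fun x => by positivity)
    _ = ∫⁻ x, energyWeight v x * ENNReal.ofReal (deriv φ (v x) ^ 2) := by
        refine lintegral_congr fun x => ?_
        rw [ENNReal.ofReal_mul (sq_nonneg _), mul_comm]
        rfl

end geometricStability

section lineApproximation

lemma integral_lineKernel (k : ℕ) (s : ℝ) : ∫ σ, lineKernel k (s - σ) = 1 := by
  rw [integral_sub_left_eq_self (lineKernel k) volume s]
  exact (lineBump k).integral_normed

lemma exists_abs_deriv_smoothTransition_le :
    ∃ K : ℝ, 0 < K ∧ ∀ s, |deriv Real.smoothTransition s| ≤ K := by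
  have hc : Continuous (deriv Real.smoothTransition) :=
    (Real.smoothTransition.contDiff (n := 1)).continuous_deriv (by norm_num)
  have hs : HasCompactSupport (deriv Real.smoothTransition) := by
    refine HasCompactSupport.intro (isCompact_Icc (a := (0 : ℝ)) (b := 1)) fun s hs => ?_
    rcases lt_or_ge s 0 with h | h
    · have : Real.smoothTransition =ᶠ[𝓝 s] fun _ => 0 := by
        filter_upwards [Iio_mem_nhds h] with σ hσ
        exact Real.smoothTransition.zero_of_nonpos (le_of_lt hσ)
      rw [this.deriv_eq, deriv_const]
    · have h1 : 1 < s := by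
        by_contra h2
        exact hs ⟨h, not_lt.1 h2⟩
      have : Real.smoothTransition =ᶠ[𝓝 s] fun _ => 1 := by
        filter_upwards [Ioi_mem_nhds h1] with σ hσ
        exact Real.smoothTransition.one_of_one_le (le_of_lt hσ)
      rw [this.deriv_eq, deriv_const]
  obtain ⟨K, hK⟩ := hc.bounded_above_of_compact_support hs
  refine ⟨max K 1, by positivity, fun s => (hK s).trans (le_max_left _ _)⟩

/-- Bounded functions are a.e. limits of bounded continuous functions, with control of the
support on the right. -/
lemma exists_continuous_approx {r : ℝ → ℝ} (hr : Measurable r) {N T : ℝ} (h0 : ∀ s, 0 ≤ r s)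
    (hN : ∀ s, r s ≤ N) (hT : ∀ s, T ≤ s → r s = 0) :
    ∃ ρ : ℕ → ℝ → ℝ, (∀ k, Continuous (ρ k)) ∧ (∀ k s, 0 ≤ ρ k s) ∧ (∀ k s, ρ k s ≤ N) ∧
      (∀ k s, T + 1 ≤ s → ρ k s = 0) ∧ ∀ᵐ s, Tendsto (fun k => ρ k s) atTop (𝓝 (r s)) := by
  have hN0 : 0 ≤ N := (h0 0).trans (hN 0)
  have hloc : LocallyIntegrable r volume := by
    refine (locallyIntegrable_const N).mono hr.aestronglyMeasurable
      (Eventually.of_forall fun s => ?_)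
    rw [Real.norm_of_nonneg (h0 s), Real.norm_of_nonneg hN0]
    exact hN s
  have hK : ∀ k s, Integrable fun σ => lineKernel k (s - σ) := fun k s =>
    ((continuous_lineKernel k).integrable_of_hasCompactSupport
      (hasCompactSupport_lineKernel k)).comp_sub_left s
  have hc : ∀ k, Continuous fun s => ∫ σ, lineKernel k (s - σ) * r σ := by
    intro k
    have := (hasCompactSupport_lineKernel k).continuous_convolution_right
      (ContinuousLinearMap.mul ℝ ℝ) hloc (continuous_lineKernel k)
    refine this.congr fun s => ?_
    simp only [convolution_def, ContinuousLinearMap.mul_apply']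
    exact integral_congr_ae (Eventually.of_forall fun σ => mul_comm _ _)
  have hI0 : ∀ k s, 0 ≤ ∫ σ, lineKernel k (s - σ) * r σ := fun k s =>
    integral_nonneg fun σ => mul_nonneg (lineKernel_nonneg _ _) (h0 σ)
  have hIN : ∀ k s, ∫ σ, lineKernel k (s - σ) * r σ ≤ N := by
    intro k s
    calc ∫ σ, lineKernel k (s - σ) * r σ ≤ ∫ σ, lineKernel k (s - σ) * N := by
          refine integral_mono_of_nonneg (Eventually.of_forall fun σ =>
            mul_nonneg (lineKernel_nonneg _ _) (h0 σ)) ((hK k s).mul_const N)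
            (Eventually.of_forall fun σ =>
              mul_le_mul_of_nonneg_left (hN σ) (lineKernel_nonneg _ _))
      _ = N := by rw [integral_mul_const, integral_lineKernel, one_mul]
  refine ⟨fun k s => Real.smoothTransition (T + 1 - s) * ∫ σ, lineKernel k (s - σ) * r σ,
    fun k => (Real.smoothTransition.continuous.comp (by fun_prop)).mul (hc k),
    fun k s => mul_nonneg (Real.smoothTransition.nonneg _) (hI0 k s), fun k s => ?_,
    fun k s hs => ?_, ?_⟩
  · exact (mul_le_of_le_one_left (hI0 k s) (Real.smoothTransition.le_one _)).trans (hIN k s)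
  · simp only
    rw [Real.smoothTransition.zero_of_nonpos (by linarith), zero_mul]
  · filter_upwards [lineKernel_conv_ae hloc] with s hs
    have h := hs.const_mul (Real.smoothTransition (T + 1 - s))
    have e : Real.smoothTransition (T + 1 - s) * r s = r s := by
      rcases le_or_gt T s with h1 | h1
      · rw [hT s h1, mul_zero]
      · rw [Real.smoothTransition.one_of_one_le (by linarith), one_mul]
    rwa [e] at h

variable {ρ : ℝ → ℝ} {N T : ℝ}

lemma intervalIntegrable_of_bounded (hi : Measurable ρ) (h0 : ∀ s, 0 ≤ ρ s) (hN : ∀ s, ρ s ≤ N)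
    (a b : ℝ) : IntervalIntegrable ρ volume a b := by
  refine (intervalIntegrable_const (c := N)).mono_fun hi.aestronglyMeasurable
    (Eventually.of_forall fun s => ?_)
  simp only
  rw [Real.norm_of_nonneg (h0 s), Real.norm_of_nonneg ((h0 0).trans (hN 0))]
  exact hN s

lemma intervalIntegral_le_of_bounded (hi : Measurable ρ) (h0 : ∀ s, 0 ≤ ρ s) (hN : ∀ s, ρ s ≤ N)
    (hT : ∀ s, T ≤ s → ρ s = 0) (hT0 : 0 ≤ T) (s : ℝ) :
    ∫ σ in (0 : ℝ)..s, ρ σ ≤ N * T := by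
  have hN0 : 0 ≤ N := (h0 0).trans (hN 0)
  have h_int := intervalIntegrable_of_bounded hi h0 hN
  have h1 : ∀ b, 0 ≤ b → ∫ σ in (0 : ℝ)..b, ρ σ ≤ N * b := fun b hb => by
    have := intervalIntegral.integral_mono hb (h_int 0 b) (intervalIntegrable_const (c := N))
      fun s => hN s
    simpa [mul_comm] using this
  rcases le_total s 0 with hs | hs
  · rw [intervalIntegral.integral_symm]
    exact (neg_nonpos.2 (intervalIntegral.integral_nonneg hs fun σ _ => h0 σ)).trans (by positivity)
  rcases le_total s T with h | h
  · exact (h1 s hs).trans (mul_le_mul_of_nonneg_left h hN0)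
  · rw [← intervalIntegral.integral_add_adjacent_intervals (h_int 0 T) (h_int T s)]
    have : ∫ σ in T..s, ρ σ = 0 := by
      rw [intervalIntegral.integral_congr (g := fun _ => 0), intervalIntegral.integral_zero]
      intro σ hσ
      rw [Set.uIcc_of_le h] at hσ
      exact hT σ hσ.1
    rw [this, add_zero]
    exact h1 T hT0

end lineApproximation

section weightedInequality

variable {h E : ℝ → ℝ≥0∞} {t T N K : ℝ} {ρ r : ℝ → ℝ}

/-- A smooth step from `0` at `t / 2` to `1` at `t`. -/
def smoothStep (t s : ℝ) : ℝ := Real.smoothTransition (2 / t * s - 1)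

lemma contDiff_smoothStep (t : ℝ) {n : ℕ∞} : ContDiff ℝ n (smoothStep t) :=
  Real.smoothTransition.contDiff.comp ((contDiff_const.mul contDiff_id).sub contDiff_const)

lemma smoothStep_nonneg (t s : ℝ) : 0 ≤ smoothStep t s := Real.smoothTransition.nonneg _

lemma smoothStep_le_one (t s : ℝ) : smoothStep t s ≤ 1 := Real.smoothTransition.le_one _

lemma smoothStep_eq_zero (ht : 0 < t) {s : ℝ} (hs : s ≤ t / 2) : smoothStep t s = 0 := by
  refine Real.smoothTransition.zero_of_nonpos ?_
  have : 2 / t * s ≤ 2 / t * (t / 2) := mul_le_mul_of_nonneg_left hs (by positivity)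
  have e : 2 / t * (t / 2) = 1 := by field_simp
  linarith

lemma smoothStep_eq_one (ht : 0 < t) {s : ℝ} (hs : t ≤ s) : smoothStep t s = 1 := by
  refine Real.smoothTransition.one_of_one_le ?_
  have : 2 / t * t ≤ 2 / t * s := mul_le_mul_of_nonneg_left hs (by positivity)
  have e : 2 / t * t = 2 := by field_simp
  linarith

lemma abs_deriv_smoothStep_le (ht : 0 < t) (hK : ∀ s, |deriv Real.smoothTransition s| ≤ K) (s) :
    |deriv (smoothStep t) s| ≤ 2 / t * K := by
  have h1 : HasDerivAt (fun s => 2 / t * s - 1) (2 / t) s := by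
    simpa using ((hasDerivAt_id s).const_mul (2 / t)).sub_const 1
  have h2 : HasDerivAt Real.smoothTransition (deriv Real.smoothTransition (2 / t * s - 1))
      (2 / t * s - 1) :=
    ((Real.smoothTransition.contDiff (n := 1)).differentiable one_ne_zero _).hasDerivAt
  have h3 : HasDerivAt (smoothStep t) _ s := h2.comp s h1
  rw [h3.deriv, abs_mul, mul_comm, abs_of_pos (by positivity : 0 < 2 / t)]
  exact mul_le_mul_of_nonneg_left (hK _) (by positivity)

lemma deriv_smoothStep_eq_zero_of_lt (ht : 0 < t) {s : ℝ} (hs : s < t / 2) :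
    deriv (smoothStep t) s = 0 := by
  have : smoothStep t =ᶠ[𝓝 s] fun _ => 0 := by
    filter_upwards [Iio_mem_nhds hs] with σ hσ using smoothStep_eq_zero ht (le_of_lt hσ)
  rw [this.deriv_eq, deriv_const]

lemma deriv_smoothStep_eq_zero_of_gt (ht : 0 < t) {s : ℝ} (hs : t < s) :
    deriv (smoothStep t) s = 0 := by
  have : smoothStep t =ᶠ[𝓝 s] fun _ => 1 := by
    filter_upwards [Ioi_mem_nhds hs] with σ hσ using smoothStep_eq_one ht (le_of_lt hσ)
  rw [this.deriv_eq, deriv_const]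

/-- A spectral inequality on the line, tested with `smoothStep t s * exp (P s / 2)`, where `P`
is a primitive of a continuous function. -/
lemma lintegral_exp_primitive_le_of_continuous (ht : 0 < t)
    (hS : ∀ φ : ℝ → ℝ, ContDiff ℝ 1 φ → (∀ s ≤ t / 2, φ s = 0) →
      ∫⁻ s, E s * ENNReal.ofReal (φ s ^ 2) ≤ ∫⁻ s, h s * ENNReal.ofReal (deriv φ s ^ 2))
    (hρ : Continuous ρ) :
    ∫⁻ s, E s * ENNReal.ofReal (smoothStep t s ^ 2 * Real.exp (∫ σ in (0 : ℝ)..s, ρ σ)) ≤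
      ∫⁻ s, h s * ENNReal.ofReal ((deriv (smoothStep t) s + smoothStep t s * ρ s / 2) ^ 2 *
        Real.exp (∫ σ in (0 : ℝ)..s, ρ σ)) := by
  have hP : ∀ s, HasDerivAt (fun s => ∫ σ in (0 : ℝ)..s, ρ σ) (ρ s) s := fun s =>
    intervalIntegral.integral_hasDerivAt_right (hρ.intervalIntegrable _ _)
      hρ.aestronglyMeasurable.stronglyMeasurableAtFilter hρ.continuousAt
  have hP1 : ContDiff ℝ 1 fun s => ∫ σ in (0 : ℝ)..s, ρ σ := by
    rw [contDiff_one_iff_deriv]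
    refine ⟨fun s => (hP s).differentiableAt, ?_⟩
    rwa [show deriv (fun s => ∫ σ in (0 : ℝ)..s, ρ σ) = ρ from funext fun s => (hP s).deriv]
  have h1 := hS (fun s => smoothStep t s * Real.exp ((∫ σ in (0 : ℝ)..s, ρ σ) / 2))
    ((contDiff_smoothStep t).mul (Real.contDiff_exp.comp (hP1.div_const 2)))
    fun s hs => by simp [smoothStep_eq_zero ht hs]
  have hexp : ∀ s, Real.exp ((∫ σ in (0 : ℝ)..s, ρ σ) / 2) ^ 2 =
      Real.exp (∫ σ in (0 : ℝ)..s, ρ σ) := fun s => by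
    rw [← Real.exp_nat_mul]
    congr 1
    push_cast
    ring
  have hd : ∀ s, deriv (fun s => smoothStep t s * Real.exp ((∫ σ in (0 : ℝ)..s, ρ σ) / 2)) s =
      (deriv (smoothStep t) s + smoothStep t s * ρ s / 2) *
        Real.exp ((∫ σ in (0 : ℝ)..s, ρ σ) / 2) := by
    intro s
    have h2 : HasDerivAt (smoothStep t) (deriv (smoothStep t) s) s :=
      ((contDiff_smoothStep t (n := 1)).differentiable one_ne_zero _).hasDerivAt
    rw [(h2.fun_mul ((hP s).div_const 2).exp).deriv]
    ring
  simpa only [hd, mul_pow, hexp] using h1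

lemma tendsto_primitive {ρ : ℕ → ℝ → ℝ} (hρ : ∀ k, Continuous (ρ k)) (h0 : ∀ k s, 0 ≤ ρ k s)
    (hN : ∀ k s, ρ k s ≤ N) (hlim : ∀ᵐ s, Tendsto (fun k => ρ k s) atTop (𝓝 (r s))) (s : ℝ) :
    Tendsto (fun k => ∫ σ in (0 : ℝ)..s, ρ k σ) atTop (𝓝 (∫ σ in (0 : ℝ)..s, r σ)) :=
  intervalIntegral.tendsto_integral_filter_of_dominated_convergence (fun _ => N)
    (Eventually.of_forall fun k => (hρ k).aestronglyMeasurable)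
    (Eventually.of_forall fun k => Eventually.of_forall fun σ _ => by
      rw [Real.norm_of_nonneg (h0 k σ)]
      exact hN k σ)
    intervalIntegrable_const (hlim.mono fun σ hσ _ => hσ)

lemma lintegral_exp_primitive_le (ht : 0 < t) (htT : t < T)
    (hE : Measurable E) (hh : Measurable h) (hE1 : ∫⁻ s, E s ≠ ∞) (hh1 : ∫⁻ s, h s ≠ ∞)
    (hS : ∀ φ : ℝ → ℝ, ContDiff ℝ 1 φ → (∀ s ≤ t / 2, φ s = 0) →
      ∫⁻ s, E s * ENNReal.ofReal (φ s ^ 2) ≤ ∫⁻ s, h s * ENNReal.ofReal (deriv φ s ^ 2))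
    (hK : ∀ s, |deriv Real.smoothTransition s| ≤ K)
    (hr : Measurable r) (h0 : ∀ s, 0 ≤ r s) (hN : ∀ s, r s ≤ N) (hT : ∀ s, T ≤ s → r s = 0) :
    ∫⁻ s, E s * ENNReal.ofReal (smoothStep t s ^ 2 * Real.exp (∫ σ in (0 : ℝ)..s, r σ)) ≤
      ∫⁻ s, h s * ENNReal.ofReal ((deriv (smoothStep t) s + smoothStep t s * r s / 2) ^ 2 *
        Real.exp (∫ σ in (0 : ℝ)..s, r σ)) := by
  obtain ⟨ρ, hρ, hρ0, hρN, hρT, hlim⟩ := exists_continuous_approx hr h0 hN hT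
  have hPlim := tendsto_primitive hρ hρ0 hρN hlim
  have hN0 : 0 ≤ N := (h0 0).trans (hN 0)
  have hPk : ∀ k, Continuous fun s => ∫ σ in (0 : ℝ)..s, ρ k σ := fun k =>
    intervalIntegral.continuous_primitive (fun a b => (hρ k).intervalIntegrable a b) 0
  have hstep : Continuous (smoothStep t) := (contDiff_smoothStep t (n := 1)).continuous
  have hstep' : Continuous (deriv (smoothStep t)) :=
    (contDiff_smoothStep t (n := 1)).continuous_deriv (by norm_num)
  have hL : ∫⁻ s, E s * ENNReal.ofReal (smoothStep t s ^ 2 * Real.exp (∫ σ in (0 : ℝ)..s, r σ)) ≤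
      liminf (fun k => ∫⁻ s, E s * ENNReal.ofReal (smoothStep t s ^ 2 *
        Real.exp (∫ σ in (0 : ℝ)..s, ρ k σ))) atTop := by
    refine le_trans (lintegral_mono_ae ?_) (lintegral_liminf_le fun k => hE.mul
      ((hstep.pow 2).mul (Real.continuous_exp.comp (hPk k))).measurable.ennreal_ofReal)
    filter_upwards [ae_lt_top hE hE1] with s hs
    refine le_of_eq (Tendsto.liminf_eq ?_).symm
    refine ENNReal.Tendsto.const_mul (ENNReal.tendsto_ofReal ?_) (Or.inr hs.ne)
    exact ((Real.continuous_exp.tendsto _).comp (hPlim s)).const_mul _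
  have hR : Tendsto (fun k => ∫⁻ s, h s * ENNReal.ofReal
      ((deriv (smoothStep t) s + smoothStep t s * ρ k s / 2) ^ 2 *
        Real.exp (∫ σ in (0 : ℝ)..s, ρ k σ))) atTop
      (𝓝 (∫⁻ s, h s * ENNReal.ofReal ((deriv (smoothStep t) s + smoothStep t s * r s / 2) ^ 2 *
        Real.exp (∫ σ in (0 : ℝ)..s, r σ)))) := by
    refine tendsto_lintegral_of_dominated_convergence
      (fun s => h s * ENNReal.ofReal ((2 / t * K + N / 2) ^ 2 * Real.exp (N * (T + 1))))
      (fun k => ?_) (fun k => ?_) ?_ ?_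
    · exact hh.mul (((hstep'.add ((hstep.mul (hρ k)).div_const 2)).pow 2).mul
        (Real.continuous_exp.comp (hPk k))).measurable.ennreal_ofReal
    · refine Eventually.of_forall fun s => ?_
      refine mul_le_mul_right (ENNReal.ofReal_le_ofReal (mul_le_mul ?_ (Real.exp_le_exp.2 ?_)
        (Real.exp_pos _).le (sq_nonneg _))) _
      · have h1 := abs_deriv_smoothStep_le ht hK s
        have h2 : |smoothStep t s * ρ k s / 2| ≤ N / 2 := by
          rw [abs_of_nonneg (by have := smoothStep_nonneg t s; have := hρ0 k s; positivity)]
          have := mul_le_mul (smoothStep_le_one t s) (hρN k s) (hρ0 k s) zero_le_one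
          linarith
        exact sq_le_sq.2 (((abs_add_le _ _).trans (add_le_add h1 h2)).trans (le_abs_self _))
      · exact intervalIntegral_le_of_bounded (hρ k).measurable (hρ0 k) (hρN k) (hρT k)
          (by linarith) s
    · rw [lintegral_mul_const _ hh]
      exact ENNReal.mul_ne_top hh1 ENNReal.ofReal_ne_top
    · filter_upwards [hlim, ae_lt_top hh hh1] with s hs hs1
      refine ENNReal.Tendsto.const_mul (ENNReal.tendsto_ofReal ?_) (Or.inr hs1.ne)
      exact (((hs.const_mul _).div_const 2).const_add _ |>.pow 2).mul
        ((Real.continuous_exp.tendsto _).comp (hPlim s))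
  refine hL.trans ?_
  rw [← hR.liminf_eq]
  exact liminf_le_liminf (Eventually.of_forall fun k =>
    lintegral_exp_primitive_le_of_continuous ht hS (hρ k))

/-- The exponential weight attached to `r` satisfies `∫ r exp (-P) ≤ 1`. -/
lemma lintegral_mul_exp_neg_primitive_le_one (hT0 : 0 ≤ T)
    (hr : Measurable r) (h0 : ∀ s, 0 ≤ r s) (hN : ∀ s, r s ≤ N) (hT : ∀ s, T ≤ s → r s = 0) :
    ∫⁻ s in Set.Ioc 0 T, ENNReal.ofReal (r s * Real.exp (-∫ σ in (0 : ℝ)..s, r σ)) ≤ 1 := by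
  obtain ⟨ρ, hρ, hρ0, hρN, hρT, hlim⟩ := exists_continuous_approx hr h0 hN hT
  have hPlim := tendsto_primitive hρ hρ0 hρN hlim
  have hPk : ∀ k, Continuous fun s => ∫ σ in (0 : ℝ)..s, ρ k σ := fun k =>
    intervalIntegral.continuous_primitive (fun a b => (hρ k).intervalIntegrable a b) 0
  have hc : ∀ k, Continuous fun s => ρ k s * Real.exp (-∫ σ in (0 : ℝ)..s, ρ k σ) := fun k =>
    (hρ k).mul (Real.continuous_exp.comp (hPk k).neg)
  have hk : ∀ k, ∫⁻ s in Set.Ioc 0 T,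
      ENNReal.ofReal (ρ k s * Real.exp (-∫ σ in (0 : ℝ)..s, ρ k σ)) ≤ 1 := by
    intro k
    have hd : ∀ s, HasDerivAt (fun s => -Real.exp (-∫ σ in (0 : ℝ)..s, ρ k σ))
        (ρ k s * Real.exp (-∫ σ in (0 : ℝ)..s, ρ k σ)) s := fun s => by
      have h1 := (intervalIntegral.integral_hasDerivAt_right ((hρ k).intervalIntegrable 0 s)
        (hρ k).aestronglyMeasurable.stronglyMeasurableAtFilter
        (hρ k).continuousAt).fun_neg.exp.fun_neg
      refine h1.congr_deriv ?_
      ring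
    have h2 := intervalIntegral.integral_eq_sub_of_hasDerivAt (a := 0) (b := T) (fun s _ => hd s)
      ((hc k).intervalIntegrable 0 T)
    rw [intervalIntegral.integral_of_le hT0] at h2
    rw [← ofReal_integral_eq_lintegral_ofReal
      ((intervalIntegrable_iff_integrableOn_Ioc_of_le hT0).1 ((hc k).intervalIntegrable 0 T))
      (Eventually.of_forall fun s => mul_nonneg (hρ0 k s) (Real.exp_pos _).le), h2]
    rw [ENNReal.ofReal_le_one, intervalIntegral.integral_same, neg_zero, Real.exp_zero]
    linarith [Real.exp_pos (-∫ σ in (0 : ℝ)..T, ρ k σ)]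
  calc ∫⁻ s in Set.Ioc 0 T, ENNReal.ofReal (r s * Real.exp (-∫ σ in (0 : ℝ)..s, r σ))
      = ∫⁻ s in Set.Ioc 0 T, liminf (fun k =>
          ENNReal.ofReal (ρ k s * Real.exp (-∫ σ in (0 : ℝ)..s, ρ k σ))) atTop := by
        refine lintegral_congr_ae (ae_restrict_of_ae ?_)
        filter_upwards [hlim] with s hs
        refine (Tendsto.liminf_eq (ENNReal.tendsto_ofReal (hs.mul ?_))).symm
        exact (Real.continuous_exp.tendsto _).comp (hPlim s).neg
    _ ≤ liminf (fun k => ∫⁻ s in Set.Ioc 0 T,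
          ENNReal.ofReal (ρ k s * Real.exp (-∫ σ in (0 : ℝ)..s, ρ k σ))) atTop :=
        lintegral_liminf_le fun k => (hc k).measurable.ennreal_ofReal
    _ ≤ liminf (fun _ : ℕ => (1 : ℝ≥0∞)) atTop := liminf_le_liminf (Eventually.of_forall hk)
    _ = 1 := liminf_const 1

end weightedInequality

section comparison

variable {h E p : ℝ → ℝ≥0∞} {t T N K : ℝ} {r : ℝ → ℝ}

lemma ennreal_le_two_mul_of_le_add_quarter {a b : ℝ≥0∞} (ha : a ≠ ∞)
    (hab : a ≤ b + ENNReal.ofReal (1 / 4) * a) : a ≤ 2 * b := by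
  rcases eq_or_ne b ∞ with rfl | hb
  · simp
  lift a to NNReal using ha
  lift b to NNReal using hb
  rw [ENNReal.ofReal, ← ENNReal.coe_mul, ← ENNReal.coe_add, ENNReal.coe_le_coe,
    ← NNReal.coe_le_coe] at hab
  rw [← ENNReal.coe_ofNat, ← ENNReal.coe_mul, ENNReal.coe_le_coe, ← NNReal.coe_le_coe]
  push_cast at hab ⊢
  rw [Real.coe_toNNReal _ (by norm_num)] at hab
  have := b.coe_nonneg
  linarith

lemma lintegral_exp_primitive_le_two_mul (ht : 0 < t) (htT : t < T)
    (hE : Measurable E) (hh : Measurable h) (hE1 : ∫⁻ s, E s ≠ ∞) (hh1 : ∫⁻ s, h s ≠ ∞)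
    (hS : ∀ φ : ℝ → ℝ, ContDiff ℝ 1 φ → (∀ s ≤ t / 2, φ s = 0) →
      ∫⁻ s, E s * ENNReal.ofReal (φ s ^ 2) ≤ ∫⁻ s, h s * ENNReal.ofReal (deriv φ s ^ 2))
    (hK : ∀ s, |deriv Real.smoothTransition s| ≤ K)
    (hr : Measurable r) (h0 : ∀ s, 0 ≤ r s) (hN : ∀ s, r s ≤ N) (hT : ∀ s, T ≤ s → r s = 0)
    (ht0 : ∀ s ≤ t, r s = 0) (hrE : ∀ s, h s * ENNReal.ofReal (r s ^ 2) ≤ E s) :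
    ∫⁻ s, E s * ENNReal.ofReal (smoothStep t s ^ 2 * Real.exp (∫ σ in (0 : ℝ)..s, r σ)) ≤
      2 * (ENNReal.ofReal ((2 / t * K) ^ 2) * ∫⁻ s in Set.Ioo (t / 2) t, h s) := by
  have hfin : ∫⁻ s, E s * ENNReal.ofReal (smoothStep t s ^ 2 *
      Real.exp (∫ σ in (0 : ℝ)..s, r σ)) ≠ ∞ := by
    refine ne_top_of_le_ne_top (ENNReal.mul_ne_top hE1
      (ENNReal.ofReal_ne_top (r := Real.exp (N * T)))) ?_
    rw [← lintegral_mul_const _ hE]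
    refine lintegral_mono fun s => mul_le_mul_right (ENNReal.ofReal_le_ofReal ?_) _
    refine (mul_le_of_le_one_left (Real.exp_pos _).le
      (pow_le_one₀ (smoothStep_nonneg t s) (smoothStep_le_one t s))).trans (Real.exp_le_exp.2 ?_)
    exact intervalIntegral_le_of_bounded hr h0 hN hT (by linarith) s
  refine ennreal_le_two_mul_of_le_add_quarter hfin ?_
  have hPc : Continuous fun s => ∫ σ in (0 : ℝ)..s, r σ :=
    intervalIntegral.continuous_primitive (intervalIntegrable_of_bounded hr h0 hN) 0
  have hstep : Continuous (smoothStep t) := (contDiff_smoothStep t (n := 1)).continuous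
  refine (lintegral_exp_primitive_le ht htT hE hh hE1 hh1 hS hK hr h0 hN hT).trans ?_
  have hm : Measurable fun s => E s * ENNReal.ofReal (smoothStep t s ^ 2 *
      Real.exp (∫ σ in (0 : ℝ)..s, r σ)) :=
    hE.mul ((hstep.pow 2).mul (Real.continuous_exp.comp hPc)).measurable.ennreal_ofReal
  rw [← lintegral_const_mul _ hh, ← lintegral_indicator measurableSet_Ioo,
    ← lintegral_const_mul _ hm,
    ← lintegral_add_left ((hh.const_mul _).indicator measurableSet_Ioo)]
  refine lintegral_mono_ae ?_
  filter_upwards [Measure.ae_ne volume (t / 2), Measure.ae_ne volume t] with s hs1 hs2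
  rcases lt_or_gt_of_ne hs2 with hs | hs
  · have hr0 : r s = 0 := ht0 s hs.le
    rcases lt_or_gt_of_ne hs1 with hs' | hs'
    · rw [deriv_smoothStep_eq_zero_of_lt ht hs', hr0]
      simp
    · have hP : ∫ σ in (0 : ℝ)..s, r σ = 0 := by
        rw [intervalIntegral.integral_congr (g := fun _ => 0), intervalIntegral.integral_zero]
        intro σ hσ
        rw [Set.uIcc_of_le (by linarith)] at hσ
        exact ht0 σ (hσ.2.trans hs.le)
      refine le_add_of_le_of_nonneg ?_ zero_le
      rw [Set.indicator_of_mem (Set.mem_Ioo.2 ⟨hs', hs⟩), hP, hr0, Real.exp_zero, mul_comm]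
      refine mul_le_mul_left (ENNReal.ofReal_le_ofReal ?_) _
      rw [mul_zero, zero_div, add_zero, mul_one]
      exact sq_le_sq.2 ((abs_deriv_smoothStep_le ht hK s).trans (le_abs_self _))
  · refine le_add_of_nonneg_of_le zero_le ?_
    rw [deriv_smoothStep_eq_zero_of_gt ht hs, smoothStep_eq_one ht hs.le]
    have e : (0 + 1 * r s / 2) ^ 2 * Real.exp (∫ σ in (0 : ℝ)..s, r σ) =
        1 / 4 * (r s ^ 2 * (1 ^ 2 * Real.exp (∫ σ in (0 : ℝ)..s, r σ))) := by ring
    rw [e, ENNReal.ofReal_mul (by norm_num), ENNReal.ofReal_mul (sq_nonneg _), mul_left_comm,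
      ← mul_assoc (h s)]
    exact mul_le_mul_right (mul_le_mul_left (hrE s) _) _

/-- The length of an interval on which a spectral inequality and an isoperimetric inequality
hold simultaneously is controlled. -/
theorem ofReal_sub_le_of_spectral {β γ : ℝ} (hβ : 0 ≤ β) (hγ : 0 ≤ γ) (hβγ : β + 1 / 2 + γ = 1)
    {C : ℝ≥0∞} (ht : 0 < t) (htT : t < T)
    (hE : Measurable E) (hh : Measurable h) (hp : Measurable p)
    (hE1 : ∫⁻ s, E s ≠ ∞) (hh1 : ∫⁻ s, h s ≠ ∞)
    (hS : ∀ φ : ℝ → ℝ, ContDiff ℝ 1 φ → (∀ s ≤ t / 2, φ s = 0) →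
      ∫⁻ s, E s * ENNReal.ofReal (φ s ^ 2) ≤ ∫⁻ s, h s * ENNReal.ofReal (deriv φ s ^ 2))
    (hK : ∀ s, |deriv Real.smoothTransition s| ≤ K)
    (hG : ∀ᵐ s, s ∈ Set.Ioo t T → h s ≠ 0 ∧
      h s ^ (γ / 2) ≤ C * (p s ^ β * E s ^ (1 / 2 + γ / 2))) :
    ENNReal.ofReal (T - t) ≤ C * ((∫⁻ s, p s) ^ β *
      (2 * (ENNReal.ofReal ((2 / t * K) ^ 2) * ∫⁻ s in Set.Ioo (t / 2) t, h s)) ^ (1 / 2 : ℝ)) := by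
  set q : ℝ → ℝ := fun s => √(E s / h s).toReal with hq
  have hqm : Measurable q := (hE.div hh).ennreal_toReal.sqrt
  set S : ℕ → Set ℝ := fun N => Set.Ioo t T ∩ {s | q s ≤ N} with hSdef
  have hSm : ∀ N, MeasurableSet (S N) := fun N =>
    measurableSet_Ioo.inter (measurableSet_le hqm measurable_const)
  have hSmono : Monotone S := fun N M hNM s hs =>
    ⟨hs.1, le_trans (Set.mem_ofPred_eq ▸ hs.2) (by exact_mod_cast hNM)⟩
  have hSU : ⋃ N, S N = Set.Ioo t T := by
    refine Set.Subset.antisymm (Set.iUnion_subset fun N s hs => hs.1) fun s hs => ?_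
    obtain ⟨N, hN⟩ := exists_nat_ge (q s)
    exact Set.mem_iUnion.2 ⟨N, hs, hN⟩
  have hlim := tendsto_measure_iUnion_atTop (μ := volume) hSmono
  rw [hSU, Real.volume_Ioo] at hlim
  refine le_of_tendsto' hlim fun N => ?_
  set r : ℝ → ℝ := (Set.Ioo t T).indicator fun s => min (q s) N with hrdef
  have hr : Measurable r := (hqm.min measurable_const).indicator measurableSet_Ioo
  have hq0 : ∀ s, 0 ≤ q s := fun s => Real.sqrt_nonneg _
  have h0 : ∀ s, 0 ≤ r s := fun s =>
    Set.indicator_nonneg (fun s _ => le_min (hq0 s) (Nat.cast_nonneg N)) s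
  have hN : ∀ s, r s ≤ N := fun s =>
    Set.indicator_le' (fun s _ => min_le_right _ _) (fun s _ => Nat.cast_nonneg N) s
  have hT : ∀ s, T ≤ s → r s = 0 := fun s hs =>
    Set.indicator_of_notMem (fun h => absurd h.2 (not_lt.2 hs)) _
  have ht0 : ∀ s ≤ t, r s = 0 := fun s hs =>
    Set.indicator_of_notMem (fun h => absurd h.1 (not_lt.2 hs)) _
  have hrE : ∀ s, h s * ENNReal.ofReal (r s ^ 2) ≤ E s := by
    intro s
    have h1 : r s ≤ q s :=
      Set.indicator_le' (fun s _ => min_le_left _ _) (fun s _ => hq0 s) s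
    calc h s * ENNReal.ofReal (r s ^ 2) ≤ h s * ENNReal.ofReal ((E s / h s).toReal) := by
          refine mul_le_mul_right (ENNReal.ofReal_le_ofReal ?_) _
          rw [← Real.sq_sqrt (ENNReal.toReal_nonneg (a := E s / h s))]
          exact pow_le_pow_left₀ (h0 s) h1 2
      _ ≤ h s * (E s / h s) := mul_le_mul_right ENNReal.ofReal_toReal_le _
      _ ≤ E s := ENNReal.mul_div_le
  set P : ℝ → ℝ := fun s => ∫ σ in (0 : ℝ)..s, r σ with hP
  have hPc : Continuous P :=
    intervalIntegral.continuous_primitive (intervalIntegrable_of_bounded hr h0 hN) 0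
  set F : ℝ → ℝ≥0∞ := fun s => E s * ENNReal.ofReal (smoothStep t s ^ 2 * Real.exp (P s)) with hF
  set G : ℝ → ℝ≥0∞ := fun s => ENNReal.ofReal (r s * Real.exp (-P s)) with hGdef
  have hFm : Measurable F := hE.mul ((((contDiff_smoothStep t (n := 1)).continuous.pow 2).mul
    (Real.continuous_exp.comp hPc)).measurable.ennreal_ofReal)
  have hGm : Measurable G :=
    (hr.mul (Real.continuous_exp.comp hPc.neg).measurable).ennreal_ofReal
  have hF1 : ∫⁻ s, F s ≤ _ :=
    lintegral_exp_primitive_le_two_mul ht htT hE hh hE1 hh1 hS hK hr h0 hN hT ht0 hrE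
  have hG1 : ∫⁻ s in Set.Ioc 0 T, G s ≤ 1 :=
    lintegral_mul_exp_neg_primitive_le_one (by linarith) hr h0 hN hT
  have hpt : ∀ᵐ s, s ∈ S N → 1 ≤ C * (p s ^ β * F s ^ (1 / 2 : ℝ) * G s ^ γ) := by
    filter_upwards [hG, ae_lt_top hE hE1, ae_lt_top hh hh1] with s hs hEs hhs hsN
    obtain ⟨hh0, hs⟩ := hs hsN.1
    have hqN : q s ≤ N := hsN.2
    have hrs : r s = q s := by
      rw [hrdef, Set.indicator_of_mem hsN.1, min_eq_left hqN]
    have hPs : 0 ≤ P s := intervalIntegral.integral_nonneg (by linarith [hsN.1.1]) fun σ _ => h0 σ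
    have hdiv : E s / h s ≠ ∞ := ENNReal.div_ne_top hEs.ne hh0
    have e1 : ENNReal.ofReal (r s) ^ γ = (E s / h s) ^ (γ / 2) := by
      rw [hrs, hq]
      simp only
      rw [Real.sqrt_eq_rpow, ← ENNReal.ofReal_rpow_of_nonneg ENNReal.toReal_nonneg (by norm_num),
        ENNReal.ofReal_toReal hdiv, ← ENNReal.rpow_mul]
      congr 1
      ring
    have e2 : 1 ≤ ENNReal.ofReal (Real.exp (P s)) ^ (1 / 2 : ℝ) *
        ENNReal.ofReal (Real.exp (-P s)) ^ γ := by
      rw [ENNReal.ofReal_rpow_of_pos (Real.exp_pos _), ENNReal.ofReal_rpow_of_pos (Real.exp_pos _),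
        ← ENNReal.ofReal_mul (by positivity), ← Real.exp_mul, ← Real.exp_mul, ← Real.exp_add,
        ENNReal.one_le_ofReal, Real.one_le_exp_iff]
      nlinarith
    have e3 : 1 ≤ C * (p s ^ β * (E s ^ (1 / 2 : ℝ) * (E s / h s) ^ (γ / 2))) := by
      have e : C * (p s ^ β * (E s ^ (1 / 2 : ℝ) * (E s / h s) ^ (γ / 2))) =
          C * (p s ^ β * E s ^ (1 / 2 + γ / 2)) / h s ^ (γ / 2) := by
        rw [ENNReal.div_rpow_of_nonneg _ _ (by positivity),
          ENNReal.rpow_add_of_nonneg _ _ (by norm_num) (by positivity)]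
        simp only [div_eq_mul_inv, mul_assoc]
      rw [e, ENNReal.le_div_iff_mul_le, one_mul]
      · exact hs
      · exact Or.inl (ENNReal.rpow_pos (pos_iff_ne_zero.2 hh0) hhs.ne).ne'
      · exact Or.inl (ENNReal.rpow_ne_top_of_nonneg (by positivity) hhs.ne)
    calc (1 : ℝ≥0∞) = 1 * 1 := (one_mul 1).symm
      _ ≤ (C * (p s ^ β * (E s ^ (1 / 2 : ℝ) * (E s / h s) ^ (γ / 2)))) *
          (ENNReal.ofReal (Real.exp (P s)) ^ (1 / 2 : ℝ) *
            ENNReal.ofReal (Real.exp (-P s)) ^ γ) := mul_le_mul' e3 e2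
      _ = C * (p s ^ β * F s ^ (1 / 2 : ℝ) * G s ^ γ) := by
        rw [hF, hGdef]
        simp only
        rw [smoothStep_eq_one ht hsN.1.1.le, one_pow, one_mul, ENNReal.ofReal_mul (h0 s),
          ENNReal.mul_rpow_of_nonneg _ _ (by norm_num), ENNReal.mul_rpow_of_nonneg _ _ hγ, e1]
        ring
  have hold := ENNReal.lintegral_prod_norm_pow_le (μ := volume.restrict (S N)) Finset.univ
    (f := ![p, F, G]) (p := ![β, 1 / 2, γ])
    (by
      intro i _
      fin_cases i
      · exact hp.aemeasurable
      · exact hFm.aemeasurable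
      · exact hGm.aemeasurable)
    (by simpa [Fin.sum_univ_three] using hβγ)
    (by
      intro i _
      fin_cases i
      · exact hβ
      · norm_num
      · exact hγ)
  simp only [Fin.prod_univ_three, Matrix.cons_val_zero, Matrix.cons_val_one,
    Matrix.cons_val] at hold
  calc volume (S N) = ∫⁻ _ in S N, 1 := by simp
    _ ≤ ∫⁻ s in S N, C * (p s ^ β * F s ^ (1 / 2 : ℝ) * G s ^ γ) :=
        setLIntegral_mono_ae' (hSm N) hpt
    _ = C * ∫⁻ s in S N, p s ^ β * F s ^ (1 / 2 : ℝ) * G s ^ γ :=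
        lintegral_const_mul _ (((hp.pow_const _).mul (hFm.pow_const _)).mul (hGm.pow_const _))
    _ ≤ C * ((∫⁻ s in S N, p s) ^ β * (∫⁻ s in S N, F s) ^ (1 / 2 : ℝ) *
          (∫⁻ s in S N, G s) ^ γ) := mul_le_mul_right hold _
    _ ≤ C * ((∫⁻ s, p s) ^ β *
      (2 * (ENNReal.ofReal ((2 / t * K) ^ 2) * ∫⁻ s in Set.Ioo (t / 2) t, h s)) ^ (1 / 2 : ℝ) *
          1 ^ γ) := by
        have hsub : S N ⊆ Set.Ioc 0 T := fun s hs => ⟨ht.trans hs.1.1, hs.1.2.le⟩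
        have h1 : ∫⁻ s in S N, G s ≤ 1 := (lintegral_mono_set hsub).trans hG1
        have h2 := (setLIntegral_le_lintegral (S N) F).trans hF1
        have h3 := setLIntegral_le_lintegral (μ := volume) (S N) p
        gcongr
    _ = _ := by rw [ENNReal.one_rpow, mul_one]

end comparison

section truncation

variable {n : ℕ} {Ω : Set (EuclideanSpace ℝ (Fin n))} {u v : EuclideanSpace ℝ (Fin n) → ℝ}
  {f : ℝ → ℝ} {t : ℝ}

lemma sq_norm_gradient (x) : ‖gradient v x‖ ^ 2 = gradSq v x := by
  rw [EuclideanSpace.norm_sq_eq, gradSq]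
  refine Finset.sum_congr rfl fun i _ => ?_
  have h : gradient v x i = partialDeriv v i x := by
    have h1 : inner ℝ (gradient v x) (EuclideanSpace.single i (1 : ℝ)) =
        fderiv ℝ v x (EuclideanSpace.single i 1) := by
      rw [gradient, InnerProductSpace.toDual_symm_apply]
    rw [EuclideanSpace.inner_single_right] at h1
    simpa [partialDeriv, dirDeriv] using h1
  rw [h, Real.norm_eq_abs, sq_abs]

lemma lapl_congr {w : EuclideanSpace ℝ (Fin n) → ℝ} {x} (h : v =ᶠ[𝓝 x] w) :
    lapl v x = lapl w x := by
  refine Finset.sum_congr rfl fun i _ => ?_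
  have h1 : (fun y => fderiv ℝ v y (EuclideanSpace.single i 1)) =ᶠ[𝓝 x]
      fun y => fderiv ℝ w y (EuclideanSpace.single i 1) := by
    filter_upwards [h.fderiv (𝕜 := ℝ)] with y hy
    rw [hy]
  rw [h1.fderiv_eq]

lemma gradSq_congr {w : EuclideanSpace ℝ (Fin n) → ℝ} {x} (h : v =ᶠ[𝓝 x] w) :
    gradSq v x = gradSq w x := by
  simp only [gradSq, partialDeriv, dirDeriv, h.fderiv_eq]

/-- A positive solution can be truncated below the level `t / 2` into a compactly supported `C²`
function on the whole space. -/
theorem exists_truncation (hΩ : IsSmoothBoundedDomain Ω) (hu : IsClassicalSol Ω f u)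
    (hpos : ∀ x ∈ Ω, 0 < u x) (ht : 0 < t) :
    ∃ v : EuclideanSpace ℝ (Fin n) → ℝ, ContDiff ℝ 2 v ∧ HasCompactSupport v ∧
      (∀ x ∉ Ω, v =ᶠ[𝓝 x] fun _ => 0) ∧ (∀ x, t / 2 < v x → x ∈ Ω ∧ v =ᶠ[𝓝 x] u) ∧
      ∀ x ∈ Ω, t / 2 < u x → v x = u x := by
  obtain ⟨⟨U, hU, hΩU, hu2⟩, -, hb⟩ := hu
  have hΩo := hΩ.1
  have hu2' : ∀ x ∈ closure Ω, ContDiffAt ℝ 2 u x := fun x hx =>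
    hu2.contDiffAt (hU.mem_nhds (hΩU hx))
  set v : EuclideanSpace ℝ (Fin n) → ℝ :=
    Ω.indicator fun x => u x * smoothStep (t / 2) (u x) with hv
  have hout : ∀ x ∉ Ω, v =ᶠ[𝓝 x] fun _ => 0 := by
    intro x hx
    by_cases hxc : x ∈ closure Ω
    · have hx0 : u x = 0 := hb x (hΩo.frontier_eq ▸ ⟨hxc, hx⟩)
      have hlt : ∀ᶠ y in 𝓝 x, u y < t / 2 / 2 :=
        (hu2' x hxc).continuousAt.eventually_lt_const (by rw [hx0]; positivity)
      filter_upwards [hlt] with y hy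
      by_cases hyΩ : y ∈ Ω
      · rw [hv, Set.indicator_of_mem hyΩ, smoothStep_eq_zero (by positivity) hy.le, mul_zero]
      · rw [hv, Set.indicator_of_notMem hyΩ]
    · filter_upwards [isClosed_closure.isOpen_compl.mem_nhds hxc] with y hy
      exact Set.indicator_of_notMem (fun h => hy (subset_closure h)) _
  have hin : ∀ x ∈ Ω, v =ᶠ[𝓝 x] fun x => u x * smoothStep (t / 2) (u x) := by
    intro x hx
    filter_upwards [hΩo.mem_nhds hx] with y hy
    exact Set.indicator_of_mem hy _
  have heq : ∀ x ∈ Ω, t / 2 < u x → v =ᶠ[𝓝 x] u := by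
    intro x hx hxt
    have hlt : ∀ᶠ y in 𝓝 x, t / 2 < u y :=
      (hu2' x (subset_closure hx)).continuousAt.eventually_const_lt hxt
    filter_upwards [hin x hx, hlt] with y hy hyt
    rw [hy, smoothStep_eq_one (by positivity) hyt.le, mul_one]
  refine ⟨v, ?_, ?_, hout, ?_, fun x hx hxt => (heq x hx hxt).eq_of_nhds⟩
  · rw [contDiff_iff_contDiffAt]
    intro x
    by_cases hx : x ∈ Ω
    · have h := hu2' x (subset_closure hx)
      exact (h.mul ((contDiff_smoothStep (t / 2) (n := 2)).contDiffAt.comp x h)).congr_of_eventuallyEq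
        (hin x hx)
    · exact contDiffAt_const.congr_of_eventuallyEq (hout x hx)
  · exact HasCompactSupport.intro hΩ.2.1.isCompact_closure fun x hx =>
      Set.indicator_of_notMem (fun h => hx (subset_closure h)) _
  · intro x hx
    have hxΩ : x ∈ Ω := by
      by_contra h
      rw [(hout x h).eq_of_nhds] at hx
      linarith
    refine ⟨hxΩ, heq x hxΩ (hx.trans_le ?_)⟩
    rw [(hin x hxΩ).eq_of_nhds]
    exact mul_le_of_le_one_right (hpos x hxΩ).le (smoothStep_le_one _ _)

lemma integrableOn_norm_gradient_pow (hΩ : Bornology.IsBounded Ω) (hu : IsClassicalSol Ω f u) :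
    IntegrableOn (fun x => ‖gradient u x‖ ^ 4) Ω := by
  obtain ⟨⟨U, hU, hΩU, hu2⟩, -, -⟩ := hu
  have hc : ContinuousOn (fun x => ‖gradient u x‖ ^ 4) (closure Ω) := by
    have h := (hu2.continuousOn_fderiv_of_isOpen hU (by norm_num)).mono hΩU
    exact (((InnerProductSpace.toDual ℝ _).symm.continuous.comp_continuousOn h).norm).pow 4
  exact (hc.integrableOn_compact hΩ.isCompact_closure).mono_set subset_closure

lemma lintegral_levelDensity_energyWeight_le {m : ℕ}
    {Ω : Set (EuclideanSpace ℝ (Fin (m + 1)))} {u v : EuclideanSpace ℝ (Fin (m + 1)) → ℝ}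
    (hΩ : IsSmoothBoundedDomain Ω) (hu : IsClassicalSol Ω f u)
    (hv : ContDiff ℝ 2 v) (hc : HasCompactSupport v)
    (hvu : ∀ x, t / 2 < v x → x ∈ Ω ∧ v =ᶠ[𝓝 x] u) :
    ∫⁻ s in Set.Ioo (t / 2) t, levelDensity volume v (energyWeight v) s ≤
      ENNReal.ofReal (∫ y in {y ∈ Ω | u y < t}, ‖gradient u y‖ ^ 4) := by
  have hsub : {y ∈ Ω | u y < t} ⊆ Ω := fun y hy => hy.1
  have hm : MeasurableSet {y ∈ Ω | u y < t} := by
    obtain ⟨⟨U, hU, hΩU, hu2⟩, -, -⟩ := hu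
    exact ((hu2.continuousOn.mono (subset_closure.trans hΩU)).isOpen_inter_preimage hΩ.1
      isOpen_Iio).measurableSet
  have hind : Measurable ((Set.Ioo (t / 2) t).indicator (1 : ℝ → ℝ≥0∞)) :=
    measurable_one.indicator measurableSet_Ioo
  rw [ofReal_integral_eq_lintegral_ofReal
    ((integrableOn_norm_gradient_pow hΩ.2.1 hu).mono_set hsub)
    (Eventually.of_forall fun x => by positivity), ← lintegral_indicator hm,
    ← lintegral_indicator measurableSet_Ioo]
  calc ∫⁻ s, (Set.Ioo (t / 2) t).indicator (levelDensity volume v (energyWeight v)) s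
      = ∫⁻ s, levelDensity volume v (energyWeight v) s * (Set.Ioo (t / 2) t).indicator 1 s := by
        refine lintegral_congr fun s => ?_
        by_cases hs : s ∈ Set.Ioo (t / 2) t <;> simp [hs]
    _ = ∫⁻ x, energyWeight v x * (Set.Ioo (t / 2) t).indicator 1 (v x) :=
        lintegral_levelDensity_mul (nullPreimages_energyWeight hv) hv.continuous.measurable
          (measurable_energyWeight hv) (lintegral_energyWeight_ne_top hv hc) hind
    _ ≤ _ := by
        refine lintegral_mono fun x => ?_
        by_cases hs : v x ∈ Set.Ioo (t / 2) t
        · obtain ⟨hx, hxu⟩ := hvu x hs.1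
          have hxt : u x < t := hxu.eq_of_nhds ▸ hs.2
          rw [Set.indicator_of_mem hs, Set.indicator_of_mem (Set.mem_sep hx hxt), Pi.one_apply,
            mul_one, energyWeight, gradSq_congr hxu, ← sq_norm_gradient, ← pow_mul]
        · simp [hs]

lemma stability_of_truncation (hΩ : IsOpen Ω) (hst : IsSemiStable Ω f u)
    (hout : ∀ x ∉ Ω, v =ᶠ[𝓝 x] fun _ => 0) (ht : 0 < t)
    (hvu : ∀ x, t / 2 < v x → x ∈ Ω ∧ v =ᶠ[𝓝 x] u)
    {ξ : EuclideanSpace ℝ (Fin n) → ℝ} (hξ : ContDiff ℝ 1 ξ) (hξc : HasCompactSupport ξ)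
    (hξ0 : ∀ x, v x ≤ t / 2 → ξ x = 0) :
    0 ≤ ∫ x, (gradSq ξ x - deriv f (v x) * ξ x ^ 2) := by
  have hloc : ∀ x ∉ Ω, ξ =ᶠ[𝓝 x] fun _ => 0 := by
    intro x hx
    filter_upwards [hout x hx] with y hy
    exact hξ0 y (by rw [hy]; positivity)
  have h := hst ξ (hξ.lipschitzWith_of_hasCompactSupport hξc one_ne_zero)
    fun x hx => (hloc x (by rw [hΩ.frontier_eq] at hx; exact hx.2)).eq_of_nhds
  rw [← setIntegral_eq_integral_of_forall_compl_eq_zero (s := Ω)]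
  · refine h.trans_eq (setIntegral_congr_fun hΩ.measurableSet fun x _ => ?_)
    rw [sq_norm_gradient]
    rcases le_or_gt (v x) (t / 2) with hx | hx
    · rw [hξ0 x hx]
      ring
    · rw [(hvu x hx).2.eq_of_nhds]
  · intro x hx
    have h1 : gradSq (fun _ : EuclideanSpace ℝ (Fin n) => (0 : ℝ)) x = 0 := by
      simp [gradSq, partialDeriv, dirDeriv]
    rw [(hloc x hx).eq_of_nhds, gradSq_congr (hloc x hx), h1]
    ring

end truncation

section estimate

lemma le_of_forall_ofReal_sub_le {a t R : ℝ} (hR : 0 ≤ R)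
    (h : ∀ T, t < T → T < a → ENNReal.ofReal (T - t) ≤ ENNReal.ofReal R) : a ≤ t + R := by
  by_contra! hlt
  obtain ⟨T, hT1, hT2⟩ := exists_between hlt
  have := (ENNReal.ofReal_le_ofReal_iff hR).1 (h T (by linarith) hT2)
  linarith

lemma toReal_bound {C V : ℝ≥0∞} (hC : C ≠ ∞) (hV : V ≠ ∞) {t K I β : ℝ} (ht : 0 < t)
    (hK : 0 < K) (hI : 0 ≤ I) (hβ : 0 ≤ β) :
    C * (V ^ β * (2 * (ENNReal.ofReal ((2 / t * K) ^ 2) * ENNReal.ofReal I)) ^ (1 / 2 : ℝ)) =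
      ENNReal.ofReal (C.toReal * (√2 * (2 * K)) / t * V.toReal ^ β * I ^ ((1 : ℝ) / 2)) := by
  have h2 : (2 : ℝ≥0∞) = ENNReal.ofReal 2 := by simp
  rw [h2, ← ENNReal.ofReal_mul (by positivity), ← ENNReal.ofReal_mul (by norm_num),
    ENNReal.ofReal_rpow_of_nonneg (by positivity) (by norm_num)]
  nth_rw 1 [← ENNReal.ofReal_toReal hC]
  nth_rw 1 [← ENNReal.ofReal_toReal hV]
  rw [ENNReal.ofReal_rpow_of_nonneg ENNReal.toReal_nonneg hβ,
    ← ENNReal.ofReal_mul (by positivity), ← ENNReal.ofReal_mul (by positivity)]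
  congr 1
  rw [Real.mul_rpow (by norm_num) (by positivity), Real.mul_rpow (by positivity) hI,
    ← Real.sqrt_eq_rpow, ← Real.sqrt_eq_rpow, ← Real.sqrt_eq_rpow, Real.sqrt_sq (by positivity)]
  ring

/-- The estimate in a fixed dimension. -/
theorem exists_estimate {m : ℕ} (hm : m ∈ ({1, 2, 3} : Set ℕ)) :
    ∃ C : ℝ, 0 ≤ C ∧
      ∀ (f : ℝ → ℝ), ContDiff ℝ 1 f →
      ∀ (Ω : Set (EuclideanSpace ℝ (Fin (m + 1)))), IsSmoothBoundedDomain Ω →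
      ∀ (u : EuclideanSpace ℝ (Fin (m + 1)) → ℝ),
        IsClassicalSol Ω f u → IsSemiStable Ω f u → (∀ x ∈ Ω, 0 < u x) →
      ∀ t : ℝ, 0 < t →
      ∀ x ∈ Ω,
        u x ≤ t + C / t *
          (volume Ω).toReal ^ ((4 - ((m + 1 : ℕ) : ℝ)) / (2 * ((m + 1 : ℕ) : ℝ))) *
          (∫ y in {y ∈ Ω | u y < t}, ‖gradient u y‖ ^ 4) ^ ((1 : ℝ) / 2) := by
  obtain ⟨β, γ, hβ, hγ, hβγ, hβe, C, hC, hG⟩ := exists_levelDensity_energyWeight_rpow_le hm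
  obtain ⟨K, hK0, hK⟩ := exists_abs_deriv_smoothTransition_le
  rw [← hβe]
  refine ⟨C.toReal * (√2 * (2 * K)), by positivity, ?_⟩
  intro f hf Ω hΩ u hu hst hpos t ht x hx
  have hI : 0 ≤ ∫ y in {y ∈ Ω | u y < t}, ‖gradient u y‖ ^ 4 :=
    integral_nonneg fun y => by positivity
  have hV : volume Ω ≠ ∞ := hΩ.2.1.measure_lt_top.ne
  refine le_of_forall_ofReal_sub_le (by positivity) fun T htT hTx => ?_
  rw [← toReal_bound hC hV ht hK0 hI hβ]
  obtain ⟨v, hv, hc, hout, hvu, huv⟩ := exists_truncation hΩ hu hpos ht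
  have hvm := hv.continuous.measurable
  have hTv : T < v x := by rwa [huv x hx (by linarith)]
  have hSp := fun φ : ℝ → ℝ => lintegral_curvWeight_mul_le (φ := φ) hv hc hf (half_pos ht).le
    (fun y hy => by
      obtain ⟨hyΩ, hyu⟩ := hvu y hy
      rw [lapl_congr hyu, hyu.eq_of_nhds]
      exact hu.2.1 y hyΩ)
    (fun ξ hξ hξc hξ0 => stability_of_truncation hΩ.1 hst hout ht hvu hξ hξc hξ0)
  have hp : ∫⁻ s, levelDensity volume v (regularWeight v) s ≤ volume Ω := by
    rw [lintegral_levelDensity (nullPreimages_regularWeight hv) hvm (measurable_regularWeight hv)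
      (lintegral_regularWeight_ne_top hv hc), lintegral_regularWeight_eq hv]
    refine measure_mono fun y hy => ?_
    by_contra hyΩ
    refine hy ?_
    rw [gradSq_congr (hout y hyΩ)]
    simp [gradSq, partialDeriv, dirDeriv]
  have hmain := ofReal_sub_le_of_spectral (C := C) hβ hγ hβγ ht htT
    (measurable_levelDensity (μ := volume) (v := v) (a := curvWeight v))
    (measurable_levelDensity (μ := volume) (v := v) (a := energyWeight v))
    (measurable_levelDensity (μ := volume) (v := v) (a := regularWeight v))
    ((lintegral_levelDensity (nullPreimages_curvWeight hv) hvm (measurable_curvWeight hv)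
      (lintegral_curvWeight_ne_top hv hc)).trans_ne (lintegral_curvWeight_ne_top hv hc))
    ((lintegral_levelDensity (nullPreimages_energyWeight hv) hvm (measurable_energyWeight hv)
      (lintegral_energyWeight_ne_top hv hc)).trans_ne (lintegral_energyWeight_ne_top hv hc))
    (fun φ hφ hφ0 => by
      rw [lintegral_levelDensity_mul (nullPreimages_curvWeight hv) hvm (measurable_curvWeight hv)
          (lintegral_curvWeight_ne_top hv hc) (ψ := fun s => ENNReal.ofReal (φ s ^ 2))
          (hφ.continuous.pow 2).measurable.ennreal_ofReal,
        lintegral_levelDensity_mul (nullPreimages_energyWeight hv) hvm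
          (measurable_energyWeight hv) (lintegral_energyWeight_ne_top hv hc)
          (ψ := fun s => ENNReal.ofReal (deriv φ s ^ 2))
          ((hφ.continuous_deriv (by norm_num)).pow 2).measurable.ennreal_ofReal]
      exact hSp φ hφ hφ0)
    hK
    (by
      filter_upwards [hG v hv hc, levelDensity_energyWeight_ne_zero hv hc hTv] with s hs hs0 hsT
      have h0 := hs0 ⟨ht.trans hsT.1, hsT.2⟩
      exact ⟨h0, hs h0⟩)
  refine hmain.trans ?_
  have hE := lintegral_levelDensity_energyWeight_le hΩ hu hv hc hvu
  gcongr

end estimate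

/-- Main a priori `L^∞` estimate for positive semi-stable
solutions in dimensions `2 ≤ n ≤ 4`, with a universal constant. -/
theorem main_estimate :
    ∃ C : ℝ, 0 < C ∧
      ∀ (n : ℕ), n ∈ ({2, 3, 4} : Set ℕ) →
      ∀ (f : ℝ → ℝ), ContDiff ℝ (⊤ : ℕ∞) f →
      ∀ (Ω : Set (EuclideanSpace ℝ (Fin n))), IsSmoothBoundedDomain Ω →
      ∀ (u : EuclideanSpace ℝ (Fin n) → ℝ),
        IsClassicalSol Ω f u → IsSemiStable Ω f u → (∀ x ∈ Ω, 0 < u x) →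
      ∀ t : ℝ, 0 < t →
      ∀ x ∈ Ω,
        u x ≤ t + C / t * (volume Ω).toReal ^ ((4 - (n : ℝ)) / (2 * n)) *
          (∫ y in {y ∈ Ω | u y < t}, ‖gradient u y‖ ^ 4) ^ ((1 : ℝ) / 2) := by
  obtain ⟨C₁, hC₁, h₁⟩ := exists_estimate (m := 1) (by simp)
  obtain ⟨C₂, hC₂, h₂⟩ := exists_estimate (m := 2) (by simp)
  obtain ⟨C₃, hC₃, h₃⟩ := exists_estimate (m := 3) (by simp)
  refine ⟨C₁ + C₂ + C₃ + 1, by positivity, ?_⟩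
  intro n hn f hf Ω hΩ u hu hst hpos t ht x hx
  have hf1 : ContDiff ℝ 1 f := hf.of_le (by exact_mod_cast le_top)
  have hI : 0 ≤ ∫ y in {y ∈ Ω | u y < t}, ‖gradient u y‖ ^ 4 :=
    integral_nonneg fun y => by positivity
  simp only [Set.mem_insert_iff, Set.mem_singleton_iff] at hn
  rcases hn with rfl | rfl | rfl
  · refine (h₁ f hf1 Ω hΩ u hu hst hpos t ht x hx).trans ?_
    gcongr
    linarith
  · refine (h₂ f hf1 Ω hΩ u hu hst hpos t ht x hx).trans ?_
    gcongr
    linarith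
  · refine (h₃ f hf1 Ω hΩ u hu hst hpos t ht x hx).trans ?_
    gcongr
    linarith
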